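/- (Iwaniec–Šverák theorem, Theorem 1.1.) Let Ω ⊆ ℝ² be a nonempty open connected set and let f lie in W^{1,2}_loc(Ω,ℝ²) with weak derivative Df. Suppose there is a measurable function K : Ω → ℝ with K(x) ≥ 1 for all x, with K integrable on compact subsets of Ω, and such that ‖Df(x)‖² ≤ K(x) · det Df(x) for almost every x ∈ Ω. If f is not almost everywhere equal to a constant, then there exists a continuous map f̃ : Ω → ℝ² with f̃ = f almost everywhere on Ω, and this f̃ is an open map and is discrete, i.e., for every y ∈ ℝ² the set f̃⁻¹({y}) has no accumulation point in Ω. -/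

import Mathlib

open MeasureTheory Set
open scoped ENNReal Real Topology

noncomputable section

/-- The plane `ℝ²` as a Euclidean space. -/
abbrev E2 : Type := EuclideanSpace ℝ (Fin 2)

/-- `f` lies in `W^{1,2}_loc(Ω, ℝ²)` with weak derivative `Df`:
`f` is locally integrable on `Ω`, `Df` is measurable with locally square-integrable
operator norm, and the integration-by-parts identity holds against smooth compactly
supported test functions. -/
def MemW12loc (Ω : Set E2) (f : E2 → E2) (Df : E2 → E2 →L[ℝ] E2) : Prop :=
  LocallyIntegrableOn f Ω ∧
  Measurable Df ∧
  (∀ A : Set E2, A ⊆ Ω → IsCompact A →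
    ∫⁻ x in A, ENNReal.ofReal (‖Df x‖ ^ 2) < ⊤) ∧
  (∀ φ : E2 → ℝ, ContDiff ℝ (⊤ : ℕ∞) φ → HasCompactSupport φ → tsupport φ ⊆ Ω →
    ∀ i : Fin 2,
      (∫ x in Ω, (fderiv ℝ φ x (EuclideanSpace.single i 1)) • f x) =
        - ∫ x in Ω, φ x • Df x (EuclideanSpace.single i 1))


open Filter Metric Function in
lemma isv_conv_lintegral (φ : ContDiffBump (0 : E2)) (h : E2 → ℝ≥0∞) (hh : AEMeasurable h) :
    ∫⁻ x, ∫⁻ z, ENNReal.ofReal (φ.normed volume z) * h (x - z) = ∫⁻ x, h x := by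
  have hφm : Measurable (fun z => ENNReal.ofReal (φ.normed volume z)) :=
    φ.continuous_normed.measurable.ennreal_ofReal
  rw [lintegral_lintegral_swap]
  · have : ∀ z : E2, ∫⁻ x, ENNReal.ofReal (φ.normed volume z) * h (x - z)
        = ENNReal.ofReal (φ.normed volume z) * ∫⁻ x, h x := by
      intro z
      rw [lintegral_const_mul' _ _ ENNReal.ofReal_ne_top, lintegral_sub_right_eq_self]
    simp_rw [this]
    rw [lintegral_mul_const _ hφm, ← ofReal_integral_eq_lintegral_ofReal
      φ.integrable_normed (Eventually.of_forall φ.nonneg_normed), φ.integral_normed]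
    simp
  · refine AEMeasurable.mul (hφm.comp measurable_snd).aemeasurable ?_
    exact hh.comp_quasiMeasurePreserving (quasiMeasurePreserving_sub volume volume)

lemma isv_conv_enorm_le {F : Type*} [NormedAddCommGroup F] [NormedSpace ℝ F]
    (φ : ContDiffBump (0 : E2)) (h : E2 → F) (x : E2) :
    ‖convolution (φ.normed volume) h (ContinuousLinearMap.lsmul ℝ ℝ) volume x‖ₑ
      ≤ ∫⁻ z, ENNReal.ofReal (φ.normed volume z) * ‖h (x - z)‖ₑ := by
  unfold convolution
  refine (enorm_integral_le_lintegral_enorm _).trans (le_of_eq ?_)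
  congr 1; ext z
  simp only [ContinuousLinearMap.lsmul_apply, enorm_smul]
  rw [Real.enorm_eq_ofReal (φ.nonneg_normed z)]

lemma isv_young1 {F : Type*} [NormedAddCommGroup F] [NormedSpace ℝ F]
    (φ : ContDiffBump (0 : E2)) (h : E2 → F) (hh : AEStronglyMeasurable h) :
    ∫⁻ x, ‖convolution (φ.normed volume) h (ContinuousLinearMap.lsmul ℝ ℝ) volume x‖ₑ
      ≤ ∫⁻ x, ‖h x‖ₑ := by
  rw [← isv_conv_lintegral φ (fun x => ‖h x‖ₑ) hh.enorm]
  exact lintegral_mono fun x => isv_conv_enorm_le φ h x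

lemma isv_young2 {F : Type*} [NormedAddCommGroup F] [NormedSpace ℝ F]
    (φ : ContDiffBump (0 : E2)) (h : E2 → F) (hh : AEStronglyMeasurable h) :
    ∫⁻ x, ‖convolution (φ.normed volume) h (ContinuousLinearMap.lsmul ℝ ℝ) volume x‖ₑ ^ 2
      ≤ ∫⁻ x, ‖h x‖ₑ ^ 2 := by
  have hφm : Measurable (fun z => ENNReal.ofReal (φ.normed volume z)) :=
    φ.continuous_normed.measurable.ennreal_ofReal
  rw [← isv_conv_lintegral φ (fun x => ‖h x‖ₑ ^ 2) (hh.enorm.pow_const _)]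
  refine lintegral_mono fun x => ?_
  refine (pow_le_pow_left' (isv_conv_enorm_le φ h x) 2).trans ?_
  have hq : AEMeasurable (fun z => ‖h (x - z)‖ₑ) :=
    hh.enorm.comp_quasiMeasurePreserving (quasiMeasurePreserving_sub_left volume x)
  have h1 : ∀ z, ENNReal.ofReal (φ.normed volume z) * ‖h (x - z)‖ₑ =
     ((fun z => ENNReal.ofReal (φ.normed volume z) ^ (1/2 : ℝ)) * fun z =>
      (ENNReal.ofReal (φ.normed volume z) ^ (1/2 : ℝ) * ‖h (x - z)‖ₑ)) z := by
    intro z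
    simp only [Pi.mul_apply]
    rw [← mul_assoc, ← ENNReal.rpow_add_of_nonneg _ _ (by norm_num) (by norm_num)]
    norm_num
  have h2 := ENNReal.lintegral_mul_le_Lp_mul_Lq (volume : Measure E2) Real.HolderConjugate.two_two
    (f := fun z => ENNReal.ofReal (φ.normed volume z) ^ (1/2 : ℝ))
    (g := fun z => (ENNReal.ofReal (φ.normed volume z) ^ (1/2 : ℝ) * ‖h (x - z)‖ₑ))
    (hφm.pow_const _).aemeasurable ((hφm.pow_const _).aemeasurable.mul hq)
  rw [lintegral_congr h1]
  refine (pow_le_pow_left' h2 2).trans (le_of_eq ?_)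
  have h3 : ∀ a : ℝ≥0∞, (a ^ (1/2 : ℝ)) ^ (2 : ℝ) = a := fun a => by
    rw [← ENNReal.rpow_mul]; norm_num
  have h4 : ∀ a : ℝ≥0∞, (a ^ (1/2 : ℝ)) ^ (2 : ℕ) = a := fun a => by
    rw [← ENNReal.rpow_natCast, ← ENNReal.rpow_mul]; norm_num
  rw [mul_pow, h4, h4]
  simp_rw [ENNReal.mul_rpow_of_nonneg _ _ (by norm_num : (0:ℝ) ≤ 2), h3]
  rw [← ofReal_integral_eq_lintegral_ofReal
      φ.integrable_normed (Filter.Eventually.of_forall φ.nonneg_normed), φ.integral_normed]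
  simp


lemma isv_sq_eLpNorm {F : Type*} [NormedAddCommGroup F] (μ : Measure E2) (h : E2 → F) :
    eLpNorm h 2 μ ^ 2 = ∫⁻ x, ‖h x‖ₑ ^ 2 ∂μ := by
  have := eLpNorm_nnreal_pow_eq_lintegral (μ := μ) (f := h) (p := 2) (by norm_num)
  simpa using this

open Filter Metric in
lemma isv_mollify_L2 {F : Type*} [NormedAddCommGroup F] [NormedSpace ℝ F] [CompleteSpace F]
    (φ : ℕ → ContDiffBump (0 : E2)) (hφ : Tendsto (fun n => (φ n).rOut) atTop (𝓝 0))
    (h : E2 → F) (hh : MemLp h 2 volume) :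
    Tendsto (fun n => ∫⁻ x, ‖convolution ((φ n).normed volume) h
      (ContinuousLinearMap.lsmul ℝ ℝ) volume x - h x‖ₑ ^ 2) atTop (𝓝 0) := by
  have key : Tendsto (fun n => eLpNorm (fun x => convolution ((φ n).normed volume) h
      (ContinuousLinearMap.lsmul ℝ ℝ) volume x - h x) 2 volume) atTop (𝓝 0) := by
    rw [ENNReal.tendsto_nhds_zero]
    intro ε hε
    obtain ⟨c, hc1, hc2, hc3, hc4⟩ := hh.exists_hasCompactSupport_eLpNorm_sub_le (by norm_num)
      (ε := ε / 4) (by simpa using hε.ne')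
    have hcu : UniformContinuous c := hc1.uniformContinuous_of_continuous hc3
    set S : Set E2 := cthickening 1 (tsupport c) with hS
    have hScpt : IsCompact S := hc1.isCompact.cthickening
    have hSfin : volume S ≠ ⊤ := hScpt.measure_lt_top.ne
    obtain ⟨δ, hδ, hδ'⟩ : ∃ δ : ℝ, 0 < δ ∧
        ENNReal.ofReal δ * volume S ^ (1 / (2 : ℝ≥0∞).toReal) ≤ ε / 4 := by
      have : Tendsto (fun δ : ℝ => ENNReal.ofReal δ * volume S ^ (1 / (2 : ℝ≥0∞).toReal))
          (𝓝[>] 0) (𝓝 0) := by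
        have h1 : Tendsto (fun δ : ℝ => ENNReal.ofReal δ) (𝓝[>] 0) (𝓝 0) := by
          have := (ENNReal.continuous_ofReal.tendsto 0).mono_left
            (nhdsWithin_le_nhds (s := Ioi (0:ℝ)))
          simpa using this
        have h2 := ENNReal.Tendsto.mul_const (b := volume S ^ (1 / (2 : ℝ≥0∞).toReal)) h1
          (Or.inr (ENNReal.rpow_ne_top_of_nonneg (by positivity) hSfin))
        simpa using h2
      have h3 := (ENNReal.tendsto_nhds_zero.1 this (ε/4)
        (ENNReal.div_pos hε.ne' (by norm_num))).and self_mem_nhdsWithin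
      obtain ⟨δ, h4, h5⟩ := h3.exists
      exact ⟨δ, h5, h4⟩
    obtain ⟨r, hr, hr'⟩ := Metric.uniformContinuous_iff.1 hcu δ hδ
    have hev : ∀ᶠ n in atTop, (φ n).rOut < min r 1 := hφ.eventually_lt_const (by positivity)
    filter_upwards [hev] with n hn
    have hn1 := hn.trans_le (min_le_left _ _)
    have hn2 := hn.trans_le (min_le_right _ _)
    have hex : ∀ k : E2 → F, LocallyIntegrable k → ConvolutionExists ((φ n).normed volume) k
        (ContinuousLinearMap.lsmul ℝ ℝ) volume := fun k hk =>
      (φ n).hasCompactSupport_normed.convolutionExists_left _ (φ n).continuous_normed hk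
    have hl1 : LocallyIntegrable c := hc3.locallyIntegrable
    have hl2 : LocallyIntegrable (h - c) :=
      (hh.sub hc4).locallyIntegrable (by norm_num)
    have hdec : (fun x => convolution ((φ n).normed volume) h
      (ContinuousLinearMap.lsmul ℝ ℝ) volume x - h x) =
      (fun x => convolution ((φ n).normed volume) (h - c)
        (ContinuousLinearMap.lsmul ℝ ℝ) volume x) + ((convolution ((φ n).normed volume) c
        (ContinuousLinearMap.lsmul ℝ ℝ) volume - c) - (h - c)) := by
      ext x
      have h0 : h = (h - c) + c := by simp
      conv_lhs => rw [h0]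
      rw [((hex _ hl2).distrib_add (hex _ hl1))]
      simp only [Pi.add_apply, Pi.sub_apply]
      abel
    have hcont : Continuous (convolution ((φ n).normed volume) c
        (ContinuousLinearMap.lsmul ℝ ℝ) volume) :=
      ((φ n).hasCompactSupport_normed.contDiff_convolution_left (n := 0) _
        ((φ n).contDiff_normed (n := 0)) hl1).continuous
    have hcont2 : Continuous (convolution ((φ n).normed volume) (h - c)
        (ContinuousLinearMap.lsmul ℝ ℝ) volume) :=
      ((φ n).hasCompactSupport_normed.contDiff_convolution_left (n := 0) _
        ((φ n).contDiff_normed (n := 0)) hl2).continuous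
    have hhc := (hh.sub hc4).aestronglyMeasurable
    have t1 : eLpNorm (fun x => convolution ((φ n).normed volume) (h - c)
        (ContinuousLinearMap.lsmul ℝ ℝ) volume x) 2 volume ≤ ε / 4 := by
      refine le_trans ?_ hc2
      have := isv_young2 (φ n) (h - c) hhc
      rw [← isv_sq_eLpNorm, ← isv_sq_eLpNorm] at this
      exact (ENNReal.pow_le_pow_left_iff (by norm_num)).1 this
    have t2 : eLpNorm (convolution ((φ n).normed volume) c
        (ContinuousLinearMap.lsmul ℝ ℝ) volume - c) 2 volume ≤ ε / 4 := by
      refine le_trans ?_ hδ'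
      refine eLpNorm_sub_le_of_dist_bdd volume (by norm_num) hScpt.measurableSet hδ.le ?_ ?_ ?_
      · intro x
        refine (φ n).dist_normed_convolution_le hc3.aestronglyMeasurable ?_
        intro y hy
        exact (hr' ((mem_ball.1 hy).trans hn1)).le
      · refine (support_convolution_subset _).trans ?_
        rw [(φ n).support_normed_eq]
        rintro _ ⟨a, ha, b, hb, rfl⟩
        refine mem_cthickening_of_dist_le (a + b) b 1 _ (subset_tsupport _ hb) ?_
        simp only [dist_add_left, dist_add_self_left]
        exact ((mem_ball_zero_iff.1 ha).trans hn2).le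
      · exact (subset_tsupport c).trans (self_subset_cthickening _)
    rw [hdec]
    refine (eLpNorm_add_le hcont2.aestronglyMeasurable
      ((hcont.aestronglyMeasurable.sub hc3.aestronglyMeasurable).sub hhc) (by norm_num)).trans ?_
    refine (add_le_add t1 ((eLpNorm_sub_le
      (hcont.aestronglyMeasurable.sub hc3.aestronglyMeasurable) hhc (by norm_num)).trans
        (add_le_add t2 hc2))).trans ?_
    calc ε / 4 + (ε / 4 + ε / 4) ≤ ε / 4 + (ε / 4 + ε / 4) + ε / 4 := le_self_add
      _ = 4 * (ε / 4) := by ring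
      _ = ε := ENNReal.mul_div_cancel (by norm_num) (by norm_num)
  have := (ENNReal.continuous_pow 2).tendsto 0 |>.comp key
  simp only [ne_eq, OfNat.ofNat_ne_zero, not_false_eq_true, zero_pow] at this
  refine this.congr fun n => ?_
  exact isv_sq_eLpNorm _ _


abbrev isvE (i : Fin 2) : E2 := EuclideanSpace.single i (1 : ℝ)

lemma isv_clm_ext {F : Type*} [NormedAddCommGroup F] [NormedSpace ℝ F] {A B : E2 →L[ℝ] F}
    (h : ∀ i, A (isvE i) = B (isvE i)) : A = B := by
  apply ContinuousLinearMap.coe_injective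
  apply (EuclideanSpace.basisFun (Fin 2) ℝ).toBasis.ext
  intro i
  simpa using h i

open Filter Metric in
lemma isv_conv_deriv {Ω : Set E2} (hΩ : IsOpen Ω) {f : E2 → E2} {Df : E2 → E2 →L[ℝ] E2}
    (hf : MemW12loc Ω f Df) {S : Set E2} (hS : IsCompact S) (hSΩ : S ⊆ Ω)
    (φ : ContDiffBump (0 : E2)) (x : E2) (hx : closedBall x φ.rOut ⊆ S)
    (hfS : Integrable (S.indicator f)) (hDS : LocallyIntegrable (S.indicator Df)) :
    HasFDerivAt (convolution (φ.normed volume) (S.indicator f)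
      (ContinuousLinearMap.lsmul ℝ ℝ) volume)
      (convolution (φ.normed volume) (S.indicator Df)
      (ContinuousLinearMap.lsmul ℝ ℝ) volume x) x := by
  have h1 := (φ.hasCompactSupport_normed (μ := (volume : Measure E2))).hasFDerivAt_convolution_left (μ := volume)
    (ContinuousLinearMap.lsmul ℝ ℝ : ℝ →L[ℝ] E2 →L[ℝ] E2) (φ.contDiff_normed (n := 1))
    hfS.locallyIntegrable x
  refine h1.congr_fderiv (Eq.symm ?_)
  apply isv_clm_ext
  intro i
  have hex1 := (φ.hasCompactSupport_normed (μ := (volume : Measure E2))).convolutionExists_left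
    (ContinuousLinearMap.lsmul ℝ ℝ : ℝ →L[ℝ] (E2 →L[ℝ] E2) →L[ℝ] (E2 →L[ℝ] E2))
    φ.continuous_normed hDS x
  have hex2 := ((φ.hasCompactSupport_normed (μ := (volume : Measure E2))).fderiv
    (𝕜 := ℝ)).convolutionExists_left
    (ContinuousLinearMap.precompL E2 (ContinuousLinearMap.lsmul ℝ ℝ : ℝ →L[ℝ] E2 →L[ℝ] E2))
    ((φ.contDiff_normed (n := 1)).continuous_fderiv (by norm_num)) hfS.locallyIntegrable x
  rw [convolution_eq_swap, convolution_eq_swap]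
  have hex1' := hex1.integrable_swap
  have hex2' := hex2.integrable_swap
  rw [ContinuousLinearMap.integral_apply hex1', ContinuousLinearMap.integral_apply hex2']
  simp only [ContinuousLinearMap.lsmul_apply, ContinuousLinearMap.precompL_apply,
    _root_.smul_apply]
  -- the test function
  set ψ : E2 → ℝ := fun z => φ.normed volume (x - z) with hψ
  have hψs : ContDiff ℝ (⊤ : ℕ∞) ψ := φ.contDiff_normed.comp (contDiff_const.sub contDiff_id)
  have hψsupp : Function.support ψ ⊆ ball x φ.rOut := by
    intro z hz
    have : x - z ∈ Function.support (φ.normed volume) := hz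
    rw [φ.support_normed_eq] at this
    rw [mem_ball, dist_comm, dist_eq_norm]
    simpa using this
  have hψts : tsupport ψ ⊆ closedBall x φ.rOut :=
    closure_minimal (hψsupp.trans ball_subset_closedBall) isClosed_closedBall
  have hψc : HasCompactSupport ψ :=
    HasCompactSupport.of_support_subset_isCompact (isCompact_closedBall x φ.rOut)
      (hψsupp.trans ball_subset_closedBall)
  have hder : ∀ z v, fderiv ℝ ψ z v = - fderiv ℝ (φ.normed volume) (x - z) v := by
    intro z v
    have hd : HasFDerivAt (φ.normed volume) (fderiv ℝ (φ.normed volume) (x - z)) (x - z) :=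
      ((φ.contDiff_normed (n := 1)).differentiable (by norm_num) _).hasFDerivAt
    have h2 : HasFDerivAt (fun z : E2 => x - z) (-(ContinuousLinearMap.id ℝ E2)) z := by
      simpa using (hasFDerivAt_id z).const_sub x
    have h3 : HasFDerivAt ψ _ z := hd.comp z h2
    rw [h3.fderiv]
    simp
  have hmain := hf.2.2.2 ψ hψs hψc (hψts.trans (hx.trans hSΩ)) i
  have hSm := hS.measurableSet
  have e1 : ∫ z, φ.normed volume (x - z) • (S.indicator Df z) (isvE i)
      = ∫ z in Ω, ψ z • Df z (EuclideanSpace.single i 1) := by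
    rw [← integral_indicator hΩ.measurableSet]
    congr 1; ext1 z
    by_cases hz : z ∈ S
    · rw [indicator_of_mem hz, indicator_of_mem (hSΩ hz)]
    · have h0 : ψ z = 0 := by
        by_contra hne
        exact hz (hx (ball_subset_closedBall (hψsupp hne)))
      have h0' : φ.normed volume (x - z) = 0 := h0
      by_cases hz' : z ∈ Ω
      · rw [indicator_of_mem hz', h0, h0']; simp
      · rw [indicator_of_notMem hz', h0']; simp
  have e2 : ∫ z, (fderiv ℝ (φ.normed volume) (x - z)) (isvE i) • (S.indicator f z)
      = - ∫ z in Ω, (fderiv ℝ ψ z (EuclideanSpace.single i 1)) • f z := by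
    rw [← integral_indicator hΩ.measurableSet, ← integral_neg]
    congr 1; ext1 z
    by_cases hz : z ∈ S
    · rw [indicator_of_mem hz, indicator_of_mem (hSΩ hz), hder]; simp
    · have h0 : fderiv ℝ ψ z = 0 := by
        by_contra hne
        exact hz (hx (hψts (support_fderiv_subset ℝ hne)))
      have h0' : fderiv ℝ (φ.normed volume) (x - z) (isvE i) = 0 := by
        have := hder z (isvE i)
        rw [h0] at this
        simpa using this.symm
      by_cases hz' : z ∈ Ω
      · rw [indicator_of_mem hz', h0, h0']; simp
      · rw [indicator_of_notMem hz', h0']; simp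
  rw [e1, e2, hmain, neg_neg]


open Filter Metric in
/-- Smooth approximation of a `W^{1,2}_loc` map on a ball. -/
theorem isv_approx {Ω : Set E2} (hΩ : IsOpen Ω) {f : E2 → E2} {Df : E2 → E2 →L[ℝ] E2}
    (hf : MemW12loc Ω f Df) {x₀ : E2} {R : ℝ} (hR0 : 0 ≤ R) (hR : closedBall x₀ R ⊆ Ω) :
    ∃ g : ℕ → E2 → E2, (∀ n, ContDiff ℝ (⊤ : ℕ∞) (g n)) ∧
      (∀ᵐ x ∂(volume.restrict (closedBall x₀ R)), Tendsto (fun n => g n x) atTop (𝓝 (f x))) ∧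
      (∃ C : ℝ≥0∞, C ≠ ⊤ ∧ ∀ n, ∫⁻ x in closedBall x₀ R, ‖g n x‖ₑ ≤ C) ∧
      (∀ᵐ x ∂(volume.restrict (closedBall x₀ R)),
        Tendsto (fun n => fderiv ℝ (g n) x) atTop (𝓝 (Df x))) ∧
      Tendsto (fun n => ∫⁻ x in closedBall x₀ R, ‖fderiv ℝ (g n) x - Df x‖ₑ ^ 2) atTop (𝓝 0) ∧
      (ContinuousOn f Ω → TendstoUniformlyOn g f atTop (closedBall x₀ R)) := by
  obtain ⟨δ, hδ, hδΩ⟩ := (isCompact_closedBall x₀ R).exists_cthickening_subset_open hΩ hR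
  rw [cthickening_closedBall hδ.le hR0] at hδΩ
  set S := closedBall x₀ (δ + R) with hSdef
  have hS : IsCompact S := isCompact_closedBall _ _
  have hSm : MeasurableSet S := hS.measurableSet
  have hfS : Integrable (S.indicator f) :=
    (hf.1.integrableOn_compact_subset hδΩ hS).integrable_indicator hSm
  have hDm : AEStronglyMeasurable (S.indicator Df) :=
    (hf.2.1.indicator hSm).aestronglyMeasurable
  have hD2 : MemLp (S.indicator Df) 2 volume := by
    refine ⟨hDm, ?_⟩
    have h1 := hf.2.2.1 S hδΩ hS
    have h2 : eLpNorm (S.indicator Df) 2 volume ^ 2 < ⊤ := by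
      rw [isv_sq_eLpNorm]
      refine lt_of_le_of_lt (le_of_eq ?_) h1
      rw [← lintegral_indicator hSm]
      congr 1; ext x
      by_cases hx : x ∈ S
      · simp only [indicator_of_mem hx]
        rw [ENNReal.ofReal_pow (norm_nonneg _), ofReal_norm]
      · simp [indicator_of_notMem hx]
    by_contra h3
    rw [not_lt, top_le_iff] at h3
    rw [h3] at h2
    simp at h2
  have hDS : LocallyIntegrable (S.indicator Df) := hD2.locallyIntegrable (by norm_num)
  set φ : ℕ → ContDiffBump (0 : E2) := fun n =>
    ⟨δ / (2 * (n + 1)), δ / (n + 1), by positivity, by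
      apply div_lt_div_of_pos_left hδ (by positivity); nlinarith [(n.cast_nonneg : (0:ℝ) ≤ n)]⟩
    with hφdef
  have hφout : Tendsto (fun n => (φ n).rOut) atTop (𝓝 0) := by
    have := tendsto_one_div_add_atTop_nhds_zero_nat (𝕜 := ℝ)
    have := this.const_mul δ
    simpa [hφdef, div_eq_mul_inv] using this
  have hφδ : ∀ n, (φ n).rOut ≤ δ := by
    intro n
    exact div_le_self hδ.le (by linarith [(n.cast_nonneg : (0:ℝ) ≤ n)])
  have hφr : ∀ᶠ n in atTop, (φ n).rOut ≤ 2 * (φ n).rIn := by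
    refine Eventually.of_forall fun n => le_of_eq ?_
    change δ / ((n:ℝ) + 1) = 2 * (δ / (2 * (n + 1)))
    field_simp
  have hsub : ∀ n, ∀ x ∈ closedBall x₀ R, closedBall x (φ n).rOut ⊆ S := by
    intro n x hx
    apply closedBall_subset_closedBall'
    have := hφδ n
    rw [mem_closedBall] at hx
    linarith
  have hRS : closedBall x₀ R ⊆ S := closedBall_subset_closedBall (by linarith)
  have hder : ∀ n, ∀ x ∈ closedBall x₀ R, fderiv ℝ (convolution ((φ n).normed volume)
      (S.indicator f) (ContinuousLinearMap.lsmul ℝ ℝ) volume) x =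
      convolution ((φ n).normed volume) (S.indicator Df)
      (ContinuousLinearMap.lsmul ℝ ℝ) volume x := fun n x hx =>
    (isv_conv_deriv hΩ hf hS hδΩ (φ n) x (hsub n x hx) hfS hDS).fderiv
  refine ⟨fun n => convolution ((φ n).normed volume) (S.indicator f)
      (ContinuousLinearMap.lsmul ℝ ℝ) volume, ?_, ?_, ?_, ?_, ?_, ?_⟩
  · intro n
    exact (φ n).hasCompactSupport_normed.contDiff_convolution_left _
        (φ n).contDiff_normed hfS.locallyIntegrable
  · have := ContDiffBump.ae_convolution_tendsto_right_of_locallyIntegrable hφout hφr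
      hfS.locallyIntegrable
    rw [ae_restrict_iff' isClosed_closedBall.measurableSet]
    filter_upwards [this] with x hx hxS
    rwa [indicator_of_mem (hRS hxS)] at hx
  · refine ⟨∫⁻ x, ‖S.indicator f x‖ₑ, hfS.2.ne, fun n => ?_⟩
    exact (setLIntegral_le_lintegral _ _).trans (isv_young1 _ _ hfS.1)
  · have := ContDiffBump.ae_convolution_tendsto_right_of_locallyIntegrable hφout hφr hDS
    rw [ae_restrict_iff' isClosed_closedBall.measurableSet]
    filter_upwards [this] with x hx hxS
    rw [indicator_of_mem (hRS hxS)] at hx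
    refine hx.congr fun n => ?_
    rw [hder n x hxS]
  · have := isv_mollify_L2 φ hφout _ hD2
    refine tendsto_of_tendsto_of_tendsto_of_le_of_le tendsto_const_nhds this
      (fun _ => zero_le) (fun n => ?_)
    refine le_trans (le_of_eq ?_) (setLIntegral_le_lintegral (closedBall x₀ R) _)
    refine setLIntegral_congr_fun isClosed_closedBall.measurableSet fun x hx => ?_
    simp only
    rw [hder n x hx, indicator_of_mem (hRS hx)]
  · intro hfc
    rw [Metric.tendstoUniformlyOn_iff]
    intro ε hε
    have huc := hS.uniformContinuousOn_of_continuous (hfc.mono hδΩ)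
    obtain ⟨r, hr, hr'⟩ := Metric.uniformContinuousOn_iff.1 huc (ε / 2) (by positivity)
    filter_upwards [hφout.eventually_lt_const hr] with n hn x hx
    rw [dist_comm]
    refine lt_of_le_of_lt ?_ (half_lt_self hε)
    have h1 := (φ n).dist_normed_convolution_le (μ := volume) (x₀ := x) (ε := ε / 2)
      hfS.1 (fun y hy => ?_)
    · rwa [indicator_of_mem (hRS hx)] at h1
    · have hyS : y ∈ S := hsub n x hx (ball_subset_closedBall hy)
      rw [indicator_of_mem hyS, indicator_of_mem (hRS hx)]
      exact (hr' y hyS x (hRS hx) ((mem_ball.1 hy).trans hn)).le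


lemma isv_det (L : E2 →L[ℝ] E2) :
    L.det = (L (isvE 0)) 0 * (L (isvE 1)) 1 - (L (isvE 1)) 0 * (L (isvE 0)) 1 := by
  have h := LinearMap.det_toMatrix (EuclideanSpace.basisFun (Fin 2) ℝ).toBasis (L : E2 →ₗ[ℝ] E2)
  rw [ContinuousLinearMap.det, ← h, Matrix.det_fin_two]
  simp [LinearMap.toMatrix_apply]

lemma isv_decomp (v : E2) : v = v 0 • isvE 0 + v 1 • isvE 1 := by
  ext i; fin_cases i <;> simp

lemma isv_null (A b : E2 → ℝ) (hA : ContDiff ℝ 1 A) (hAc : HasCompactSupport A)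
    (hb : ContDiff ℝ 2 b) :
    ∫ x, (fderiv ℝ A x (isvE 0) * fderiv ℝ b x (isvE 1)
      - fderiv ℝ A x (isvE 1) * fderiv ℝ b x (isvE 0)) = 0 := by
  have hdA : ∀ v, Continuous (fun x => fderiv ℝ A x v) := fun v =>
    (hA.continuous_fderiv (by norm_num)).clm_apply continuous_const
  have hdb1 : ContDiff ℝ 1 (fderiv ℝ b) := hb.fderiv_right (by norm_num)
  have hdb : ∀ v, ContDiff ℝ 1 (fun x => fderiv ℝ b x v) := fun v =>
    hdb1.clm_apply contDiff_const
  have hd2 : ∀ v w, Continuous (fun x => fderiv ℝ (fun x => fderiv ℝ b x v) x w) := fun v w =>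
    ((hdb v).continuous_fderiv (by norm_num)).clm_apply continuous_const
  have hi1 : ∀ v w, Integrable (fun x => fderiv ℝ A x v * fderiv ℝ b x w) := fun v w =>
    ((hdA v).mul (hdb w).continuous).integrable_of_hasCompactSupport
      ((hAc.fderiv_apply (𝕜 := ℝ) v).mul_right)
  have key : ∀ v w, ∫ x, A x * fderiv ℝ (fun x => fderiv ℝ b x w) x v
      = - ∫ x, fderiv ℝ A x v * fderiv ℝ b x w := by
    intro v w
    apply integral_mul_fderiv_eq_neg_fderiv_mul_of_integrable (hi1 v w)
    · exact (hA.continuous.mul (hd2 w v)).integrable_of_hasCompactSupport hAc.mul_right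
    · exact (hA.continuous.mul (hdb w).continuous).integrable_of_hasCompactSupport hAc.mul_right
    · exact fun x _ => hA.differentiable (by norm_num) x
    · exact fun x _ => (hdb w).differentiable (by norm_num) x
  have hsymm : ∀ v w x, fderiv ℝ (fun x => fderiv ℝ b x w) x v
      = fderiv ℝ (fun x => fderiv ℝ b x v) x w := by
    intro v w x
    have h1 : ∀ u s, fderiv ℝ (fun x => fderiv ℝ b x u) x s = fderiv ℝ (fderiv ℝ b) x s u := by
      intro u s
      rw [fderiv_clm_apply (hdb1.differentiable (by norm_num) x) (differentiableAt_const u)]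
      simp
    rw [h1, h1]
    exact (hb.contDiffAt.isSymmSndFDerivAt (by simp)) v w
  rw [integral_sub (hi1 _ _) (hi1 _ _)]
  have h1 := key (isvE 0) (isvE 1)
  have h2 := key (isvE 1) (isvE 0)
  simp_rw [hsymm (isvE 0) (isvE 1)] at h1
  linarith

/-- Divergence. -/
def isvDiv (X : E2 → E2) (w : E2) : ℝ :=
  (fderiv ℝ X w (isvE 0)) 0 + (fderiv ℝ X w (isvE 1)) 1

/-- The boundary term. -/
def isvQ (w : E2) (d : E2 →L[ℝ] ℝ) (L : E2 →L[ℝ] E2) : ℝ :=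
  w 0 * (d (isvE 0) * (L (isvE 1)) 1 - d (isvE 1) * (L (isvE 0)) 1) +
  w 1 * ((L (isvE 0)) 0 * d (isvE 1) - (L (isvE 1)) 0 * d (isvE 0))

lemma isv_fderiv_comp {X : E2 → E2} {x : E2} (h : DifferentiableAt ℝ X x) (i : Fin 2) (v : E2) :
    fderiv ℝ (fun x => X x i) x v = (fderiv ℝ X x v) i := by
  have h1 := (EuclideanSpace.proj i : E2 →L[ℝ] ℝ).hasFDerivAt.comp x
    h.hasFDerivAt
  have h2 : HasFDerivAt (fun x => X x i) _ x := h1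
  rw [h2.fderiv]; simp

theorem isv_master (g : E2 → E2) (hg : ContDiff ℝ 2 g) (ζ : E2 → ℝ) (hζ : ContDiff ℝ 1 ζ)
    (hζc : HasCompactSupport ζ) (X : E2 → E2)
    (hX : ∀ x ∈ tsupport ζ, ContDiffAt ℝ 1 X (g x)) :
    ∫ x, (ζ x * isvDiv X (g x) * (fderiv ℝ g x).det
      + isvQ (X (g x)) (fderiv ℝ ζ x) (fderiv ℝ g x)) = 0 := by
  have hgi : ∀ i, ContDiff ℝ 2 (fun x => g x i) := fun i => contDiff_euclidean.1 hg i
  have hgd : Differentiable ℝ g := hg.differentiable (by norm_num)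
  have hXi : ∀ x ∈ tsupport ζ, ∀ i, ContDiffAt ℝ 1 (fun x => X x i) (g x) := fun x hx i =>
    contDiffAt_euclidean.1 (hX x hx) i
  set A : Fin 2 → E2 → ℝ := fun i x => ζ x * X (g x) i with hA
  have hAc : ∀ i, HasCompactSupport (A i) := fun i => hζc.mul_right
  have hA1 : ∀ i, ContDiff ℝ 1 (A i) := by
    intro i
    rw [contDiff_iff_contDiffAt]
    intro x
    by_cases hx : x ∈ tsupport ζ
    · have h1 : ContDiffAt ℝ 1 (fun x => X (g x) i) x :=
        (hXi x hx i).comp x ((hg.of_le (by norm_num)).contDiffAt)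
      exact hζ.contDiffAt.mul h1
    · have : A i =ᶠ[𝓝 x] fun _ => 0 := by
        filter_upwards [notMem_tsupport_iff_eventuallyEq.1 hx] with y hy
        simp [hA, hy]
      exact contDiffAt_const.congr_of_eventuallyEq this
  have n1 := isv_null (A 0) (fun x => g x 1) (hA1 0) (hAc 0) (hgi 1)
  have n2 := isv_null (A 1) (fun x => g x 0) (hA1 1) (hAc 1) (hgi 0)
  have hi : ∀ i j v w, Integrable (fun x => fderiv ℝ (A i) x v * fderiv ℝ (fun x => g x j) x w) := by
    intro i j v w
    refine Continuous.integrable_of_hasCompactSupport ?_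
      (((hAc i).fderiv_apply (𝕜 := ℝ) v).mul_right)
    exact (((hA1 i).continuous_fderiv (by norm_num)).clm_apply continuous_const).mul
      (((hgi j).continuous_fderiv (by norm_num)).clm_apply continuous_const)
  have hcomb := integral_sub ((hi 0 1 (isvE 0) (isvE 1)).sub (hi 0 1 (isvE 1) (isvE 0)))
    ((hi 1 0 (isvE 0) (isvE 1)).sub (hi 1 0 (isvE 1) (isvE 0)))
  simp only [Pi.sub_apply] at hcomb
  rw [n1, n2, sub_zero] at hcomb
  rw [← hcomb]
  congr 1; ext x
  rw [isv_fderiv_comp (hgd x), isv_fderiv_comp (hgd x), isv_fderiv_comp (hgd x),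
    isv_fderiv_comp (hgd x), isv_det]
  by_cases hx : x ∈ tsupport ζ
  · have hXd : DifferentiableAt ℝ X (g x) := (hX x hx).differentiableAt (by norm_num)
    have hdA : ∀ i v, fderiv ℝ (A i) x v = fderiv ℝ ζ x v * X (g x) i
        + ζ x * (fderiv ℝ X (g x) (fderiv ℝ g x v)) i := by
      intro i v
      have h1 : HasFDerivAt (fun x => X (g x)) ((fderiv ℝ X (g x)).comp (fderiv ℝ g x)) x :=
        hXd.hasFDerivAt.comp x (hgd x).hasFDerivAt
      have h2 : fderiv ℝ (fun x => X (g x) i) x v = (fderiv ℝ X (g x) (fderiv ℝ g x v)) i := by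
        rw [isv_fderiv_comp (X := fun x => X (g x)) h1.differentiableAt, h1.fderiv]; rfl
      have h3 : DifferentiableAt ℝ (fun x => X (g x) i) x :=
        ((hXi x hx i).differentiableAt (by norm_num)).comp x (hgd x)
      rw [hA]
      simp only
      rw [fderiv_fun_mul (hζ.differentiable (by norm_num) x) h3]
      simp only [_root_.add_apply, _root_.smul_apply, smul_eq_mul, h2]
      ring
    have hlin : ∀ v i, (fderiv ℝ X (g x) v) i = v 0 * (fderiv ℝ X (g x) (isvE 0)) i
        + v 1 * (fderiv ℝ X (g x) (isvE 1)) i := by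
      intro v i
      conv_lhs => rw [isv_decomp v, map_add, map_smul, map_smul]
      simp
    simp only [hdA, isvDiv, isvQ]
    rw [hlin (fderiv ℝ g x (isvE 0)), hlin (fderiv ℝ g x (isvE 0)),
      hlin (fderiv ℝ g x (isvE 1)), hlin (fderiv ℝ g x (isvE 1))]
    ring
  · have h1 : ζ x = 0 := image_eq_zero_of_notMem_tsupport hx
    have h2 : fderiv ℝ ζ x = 0 := by
      by_contra h; exact hx (support_fderiv_subset ℝ h)
    have h3 : ∀ i, fderiv ℝ (A i) x = 0 := by
      intro i
      by_contra h
      have h4 := support_fderiv_subset ℝ h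
      exact hx (closure_mono (by intro y hy; simp only [hA, Function.mem_support] at hy ⊢
                                 exact left_ne_zero_of_mul hy) h4)
    simp [h1, h2, h3, isvQ]

open Metric in
theorem isv_L1 (g : E2 → E2) (hg : ContDiff ℝ 2 g) (X : E2 → E2) (hX : ContDiff ℝ 1 X)
    (x₀ : E2) (t : ℝ) (ht : 0 < t) (hS : ∀ x ∈ sphere x₀ t, g x ∉ tsupport X) :
    ∫ x in ball x₀ t, isvDiv X (g x) * (fderiv ℝ g x).det = 0 := by
  set C := closedBall x₀ t ∩ g ⁻¹' (tsupport X) with hC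
  have hCc : IsCompact C := (isCompact_closedBall _ _).inter_right
    ((isClosed_tsupport X).preimage hg.continuous)
  obtain ⟨r, hr0, hrt, hr⟩ : ∃ r, 0 < r ∧ r < t ∧ C ⊆ ball x₀ r := by
    rcases C.eq_empty_or_nonempty with h | h
    · exact ⟨t / 2, by positivity, by linarith, by simp [h]⟩
    · obtain ⟨p, hp, hp'⟩ := hCc.exists_isMaxOn h
        (f := fun y => dist y x₀) (continuous_id.dist continuous_const).continuousOn
      have h1 : dist p x₀ < t := lt_of_le_of_ne hp.1 (fun h => hS p h hp.2)
      refine ⟨(dist p x₀ + t) / 2, by positivity, by linarith, fun q hq => ?_⟩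
      have h2 : dist q x₀ ≤ dist p x₀ := hp' hq
      rw [mem_ball]; linarith
  let ζ : ContDiffBump x₀ := ⟨r, t, hr0, hrt⟩
  have hm := isv_master g hg ζ ζ.contDiff ζ.hasCompactSupport X (fun x _ => hX.contDiffAt)
  rw [← hm, ← integral_indicator measurableSet_ball]
  congr 1; ext x
  have hX0 : x ∈ closedBall x₀ t → x ∉ C → X (g x) = 0 ∧ isvDiv X (g x) = 0 := by
    intro hx hxC
    have : g x ∉ tsupport X := fun h => hxC ⟨hx, h⟩
    refine ⟨image_eq_zero_of_notMem_tsupport this, ?_⟩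
    have h2 : fderiv ℝ X (g x) = 0 := by
      by_contra h; exact this (support_fderiv_subset ℝ h)
    simp [isvDiv, h2]
  by_cases hx : x ∈ ball x₀ t
  · rw [indicator_of_mem hx]
    by_cases hxC : x ∈ C
    · have h1 : ζ =ᶠ[𝓝 x] fun _ => 1 := by
        filter_upwards [isOpen_ball.mem_nhds (hr hxC)] with y hy
        exact ζ.one_of_mem_closedBall (ball_subset_closedBall hy)
      rw [h1.fderiv_eq, h1.eq_of_nhds]
      simp [isvQ]
    · obtain ⟨h1, h2⟩ := hX0 (ball_subset_closedBall hx) hxC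
      simp [h1, h2, isvQ]
  · rw [indicator_of_notMem hx]
    have h1 : ζ x = 0 := ζ.zero_of_le_dist (by simpa using hx)
    rw [h1]
    by_cases hx' : x ∈ closedBall x₀ t
    · have hxC : x ∉ C := fun h => hx (ball_subset_ball hrt.le (hr h))
      obtain ⟨h1, h2⟩ := hX0 hx' hxC
      simp [h1, isvQ]
    · have h2 : fderiv ℝ ζ x = 0 := by
        by_contra h
        have := support_fderiv_subset ℝ h
        rw [ζ.tsupport_eq] at this
        exact hx' this
      simp [h2, isvQ]


open Filter in
structure IsvApprox (S : Set E2) (g : ℕ → E2 → E2) (f : E2 → E2) (Df : E2 → E2 →L[ℝ] E2) :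
    Prop where
  smooth : ∀ n, ContDiff ℝ (⊤ : ℕ∞) (g n)
  ae : ∀ᵐ x ∂(volume.restrict S), Tendsto (fun n => g n x) atTop (𝓝 (f x))
  aeD : ∀ᵐ x ∂(volume.restrict S), Tendsto (fun n => fderiv ℝ (g n) x) atTop (𝓝 (Df x))
  L2 : Tendsto (fun n => ∫⁻ x in S, ‖fderiv ℝ (g n) x - Df x‖ₑ ^ 2) atTop (𝓝 0)
  meas : Measurable Df
  fin : ∫⁻ x in S, ‖Df x‖ₑ ^ 2 < ⊤

open Filter in
lemma IsvApprox.mono {S T : Set E2} {g f Df} (h : IsvApprox S g f Df) (hT : T ⊆ S) :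
    IsvApprox T g f Df where
  smooth := h.smooth
  ae := ae_mono (Measure.restrict_mono hT le_rfl) h.ae
  aeD := ae_mono (Measure.restrict_mono hT le_rfl) h.aeD
  L2 := tendsto_of_tendsto_of_tendsto_of_le_of_le tendsto_const_nhds h.L2 (fun _ => zero_le)
    (fun _ => lintegral_mono_set hT)
  meas := h.meas
  fin := (lintegral_mono_set hT).trans_lt h.fin

open Filter in
lemma IsvApprox.comp {S : Set E2} {g f Df} (h : IsvApprox S g f Df) {φ : ℕ → ℕ}
    (hφ : StrictMono φ) : IsvApprox S (fun n => g (φ n)) f Df where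
  smooth := fun n => h.smooth _
  ae := by filter_upwards [h.ae] with x hx using hx.comp hφ.tendsto_atTop
  aeD := by filter_upwards [h.aeD] with x hx using hx.comp hφ.tendsto_atTop
  L2 := h.L2.comp hφ.tendsto_atTop
  meas := h.meas
  fin := h.fin

open Filter in
/-- generalized dominated convergence -/
lemma isv_gdct {μ : Measure E2} {P h : ℕ → E2 → ℝ} {Q k : E2 → ℝ}
    (hP : ∀ n, AEStronglyMeasurable (P n) μ)
    (hPQ : ∀ᵐ x ∂μ, Tendsto (fun n => P n x) atTop (𝓝 (Q x)))
    (hb : ∀ n, ∀ᵐ x ∂μ, |P n x| ≤ h n x)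
    (hk : Integrable k μ) (hhm : ∀ n, AEStronglyMeasurable (h n) μ)
    (hhk : ∀ᵐ x ∂μ, Tendsto (fun n => h n x) atTop (𝓝 (k x)))
    (hL : Tendsto (fun n => ∫⁻ x, ‖h n x - k x‖ₑ ∂μ) atTop (𝓝 0)) :
    Tendsto (fun n => ∫⁻ x, ‖P n x - Q x‖ₑ ∂μ) atTop (𝓝 0) ∧ Integrable Q μ := by
  have hQm : AEStronglyMeasurable Q μ := aestronglyMeasurable_of_tendsto_ae atTop hP hPQ
  have hQb : ∀ᵐ x ∂μ, |Q x| ≤ k x := by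
    filter_upwards [hPQ, hhk, ae_all_iff.2 hb] with x h1 h2 h3
    exact le_of_tendsto_of_tendsto' h1.abs h2 h3
  have hQi : Integrable Q μ := hk.mono' hQm hQb
  refine ⟨?_, hQi⟩
  have h0 : Tendsto (fun n => ∫⁻ x, min ‖P n x - Q x‖ₑ (2 * ‖k x‖ₑ) ∂μ) atTop (𝓝 0) := by
    have := tendsto_lintegral_of_dominated_convergence' (μ := μ)
      (F := fun n x => min ‖P n x - Q x‖ₑ (2 * ‖k x‖ₑ)) (f := fun _ => 0)
      (fun x => 2 * ‖k x‖ₑ)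
      (fun n => (((hP n).sub hQm).enorm).min (hk.1.enorm.const_mul _))
      (fun n => Eventually.of_forall fun x => min_le_right _ _)
      (by rw [lintegral_const_mul' _ _ (by norm_num)]
          exact ENNReal.mul_ne_top (by norm_num) hk.2.ne) ?_
    · simpa using this
    · filter_upwards [hPQ] with x hx
      have h1 : Tendsto (fun n => ‖P n x - Q x‖ₑ) atTop (𝓝 0) := by
        have := (hx.sub_const (Q x)).enorm
        simpa using this
      exact tendsto_of_tendsto_of_tendsto_of_le_of_le tendsto_const_nhds h1 (fun _ => zero_le)
        (fun n => min_le_left _ _)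
  have h1 := hL.add h0
  rw [add_zero] at h1
  refine tendsto_of_tendsto_of_tendsto_of_le_of_le tendsto_const_nhds h1 (fun _ => zero_le)
    (fun n => ?_)
  simp only
  have hm : AEMeasurable (fun x => ‖h n x - k x‖ₑ) μ := ((hhm n).sub hk.1).enorm
  rw [← lintegral_add_left' hm]
  refine lintegral_mono_ae ?_
  filter_upwards [hQb, hb n] with x h2 h3
  rcases min_choice ‖P n x - Q x‖ₑ (2 * ‖k x‖ₑ) with hc | hc
  · rw [hc]; exact le_add_self
  rw [hc]
  have e : ∀ a : ℝ, ‖a‖ₑ = ENNReal.ofReal |a| := fun a => Real.enorm_eq_ofReal_abs a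
  have h4 : |P n x - Q x| ≤ |h n x - k x| + 2 * |k x| := by
    have a1 := abs_sub (P n x) (Q x)
    have a2 := le_abs_self (h n x - k x)
    have a3 := le_abs_self (k x)
    linarith
  rw [e, e, e]
  refine (ENNReal.ofReal_le_ofReal h4).trans ?_
  rw [ENNReal.ofReal_add (abs_nonneg _) (by positivity), ENNReal.ofReal_mul (by norm_num)]
  simp

open Filter in
theorem isv_lim {S : Set E2} (hS : volume S ≠ ⊤) {g f Df}
    (H : IsvApprox S g f Df) {P : ℕ → E2 → ℝ} {Q : E2 → ℝ}
    (hP : ∀ n, AEStronglyMeasurable (P n) (volume.restrict S))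
    (hPQ : ∀ᵐ x ∂(volume.restrict S), Tendsto (fun n => P n x) atTop (𝓝 (Q x)))
    (C : ℝ) (hb : ∀ n, ∀ᵐ x ∂(volume.restrict S), |P n x| ≤ C * (1 + ‖fderiv ℝ (g n) x‖ ^ 2)) :
    Tendsto (fun n => ∫⁻ x in S, ‖P n x - Q x‖ₑ) atTop (𝓝 0) ∧ IntegrableOn Q S ∧
    Tendsto (fun n => ∫ x in S, P n x) atTop (𝓝 (∫ x in S, Q x)) := by
  set μ := volume.restrict S with hμ
  have hfin : IsFiniteMeasure μ := ⟨by rw [hμ, Measure.restrict_apply_univ]; exact hS.lt_top⟩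
  have hGc : ∀ n, Continuous (fderiv ℝ (g n)) := fun n =>
    (H.smooth n).continuous_fderiv (by simp)
  have hD2 : Integrable (fun x => ‖Df x‖ ^ 2) μ := by
    refine ⟨(H.meas.norm.pow_const 2).aestronglyMeasurable, ?_⟩
    refine lt_of_le_of_lt (le_of_eq ?_) H.fin
    congr 1; ext x; simp
  have hnm : ∀ n, AEMeasurable (fun x => ‖fderiv ℝ (g n) x - Df x‖ₑ) μ := fun n =>
    ((hGc n).measurable.sub H.meas).enorm.aemeasurable
  have hDm : AEMeasurable (fun x => ‖Df x‖ₑ) μ := H.meas.enorm.aemeasurable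
  have hL : Tendsto (fun n => ∫⁻ x, ‖C * (1 + ‖fderiv ℝ (g n) x‖ ^ 2)
      - C * (1 + ‖Df x‖ ^ 2)‖ₑ ∂μ) atTop (𝓝 0) := by
    have h1 : Tendsto (fun n => ‖C‖ₑ * (∫⁻ x, ‖fderiv ℝ (g n) x - Df x‖ₑ ^ 2 ∂μ +
        2 * ((∫⁻ x, ‖fderiv ℝ (g n) x - Df x‖ₑ ^ 2 ∂μ) ^ (1/2 : ℝ) *
          (∫⁻ x, ‖Df x‖ₑ ^ 2 ∂μ) ^ (1/2 : ℝ)))) atTop (𝓝 0) := by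
      have a1 := H.L2
      have a2 : Tendsto (fun n => (∫⁻ x, ‖fderiv ℝ (g n) x - Df x‖ₑ ^ 2 ∂μ) ^ (1/2 : ℝ)) atTop
        (𝓝 0) := by
        have := (ENNReal.continuous_rpow_const (y := 1/2)).tendsto 0 |>.comp a1
        simpa [Function.comp_def] using this
      have a3 := ENNReal.Tendsto.mul_const (b := (∫⁻ x, ‖Df x‖ₑ ^ 2 ∂μ) ^ (1/2 : ℝ)) a2
        (Or.inr (ENNReal.rpow_ne_top_of_nonneg (by norm_num) H.fin.ne))
      have a4 := ENNReal.Tendsto.const_mul (a := 2) a3 (Or.inr (by norm_num))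
      have a5 := ENNReal.Tendsto.const_mul (a := ‖C‖ₑ) (a1.add a4) (Or.inr (by simp))
      simpa using a5
    refine tendsto_of_tendsto_of_tendsto_of_le_of_le tendsto_const_nhds h1 (fun _ => zero_le)
      (fun n => ?_)
    simp only
    have hold := ENNReal.lintegral_mul_le_Lp_mul_Lq μ Real.HolderConjugate.two_two (hnm n) hDm
    simp only [Pi.mul_apply, ENNReal.rpow_two] at hold
    refine le_trans ?_ (mul_le_mul_right (add_le_add_right (mul_le_mul_right hold 2) _) ‖C‖ₑ)
    rw [← lintegral_const_mul' _ _ (by norm_num), ← lintegral_add_left' ((hnm n).pow_const _),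
      ← lintegral_const_mul' _ _ (by simp)]
    refine lintegral_mono fun x => ?_
    have e : C * (1 + ‖fderiv ℝ (g n) x‖ ^ 2) - C * (1 + ‖Df x‖ ^ 2)
      = C * (‖fderiv ℝ (g n) x‖ ^ 2 - ‖Df x‖ ^ 2) := by ring
    rw [e, enorm_mul]
    refine mul_le_mul_right ?_ _
    have a1 : |‖fderiv ℝ (g n) x‖ ^ 2 - ‖Df x‖ ^ 2| ≤ ‖fderiv ℝ (g n) x - Df x‖ ^ 2
      + 2 * (‖fderiv ℝ (g n) x - Df x‖ * ‖Df x‖) := by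
      have b1 := abs_norm_sub_norm_le (fderiv ℝ (g n) x) (Df x)
      have b2 : ‖fderiv ℝ (g n) x‖ ^ 2 - ‖Df x‖ ^ 2 = (‖fderiv ℝ (g n) x‖ - ‖Df x‖) ^ 2
        + 2 * ((‖fderiv ℝ (g n) x‖ - ‖Df x‖) * ‖Df x‖) := by ring
      rw [b2]
      refine (abs_add_le _ _).trans ?_
      rw [abs_of_nonneg (sq_nonneg _), ← sq_abs, abs_mul, abs_mul, abs_two,
        abs_of_nonneg (norm_nonneg (Df x))]
      gcongr
    rw [Real.enorm_eq_ofReal_abs]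
    refine (ENNReal.ofReal_le_ofReal a1).trans (le_of_eq ?_)
    rw [ENNReal.ofReal_add (by positivity) (by positivity), ENNReal.ofReal_mul (by norm_num),
      ENNReal.ofReal_mul (by positivity), ENNReal.ofReal_pow (by positivity)]
    simp
  have hres := isv_gdct hP hPQ hb
    (k := fun x => C * (1 + ‖Df x‖ ^ 2)) (((integrable_const 1).add hD2).const_mul C)
    (fun n => (continuous_const.mul (continuous_const.add
      ((hGc n).norm.pow 2))).aestronglyMeasurable)
    (by filter_upwards [H.aeD] with x hx
        exact ((hx.norm.pow 2).const_add 1).const_mul C) hL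
  refine ⟨hres.1, hres.2, ?_⟩
  refine tendsto_integral_of_L1 Q hres.2.1 ?_ hres.1
  have ev : ∀ᶠ n in atTop, ∫⁻ x, ‖P n x - Q x‖ₑ ∂μ < 1 := by
    have := hres.1.eventually_lt_const (u := 1) (by norm_num)
    exact this
  filter_upwards [ev] with n hn
  have h2 : Integrable (fun x => P n x - Q x) μ :=
    ⟨(hP n).sub hres.2.1, hn.trans (by norm_num)⟩
  have := h2.add hres.2
  refine this.congr (Eventually.of_forall fun x => ?_)
  simp


lemma IsvApprox.c2 {S : Set E2} {g f Df} (h : IsvApprox S g f Df) (n : ℕ) : ContDiff ℝ 2 (g n) := by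
  exact_mod_cast contDiff_infty.1 (h.smooth n) 2

lemma IsvApprox.c1 {S : Set E2} {g f Df} (h : IsvApprox S g f Df) (n : ℕ) : ContDiff ℝ 1 (g n) := by
  exact_mod_cast contDiff_infty.1 (h.smooth n) 1

lemma isv_entry_le (L : E2 →L[ℝ] E2) (i j : Fin 2) : |(L (isvE i)) j| ≤ ‖L‖ := by
  have h1 : ‖(L (isvE i)) j‖ ≤ ‖L (isvE i)‖ := PiLp.norm_apply_le _ j
  have h2 : ‖L (isvE i)‖ ≤ ‖L‖ * ‖isvE i‖ := L.le_opNorm _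
  have h3 : ‖isvE i‖ = 1 := by simp [isvE]
  rw [h3, mul_one] at h2
  exact h1.trans h2

lemma isv_det_le (L : E2 →L[ℝ] E2) : |L.det| ≤ 2 * ‖L‖ ^ 2 := by
  rw [isv_det]
  refine (abs_sub _ _).trans ?_
  rw [abs_mul, abs_mul]
  have := isv_entry_le L
  have h1 := mul_le_mul (this 0 0) (this 1 1) (abs_nonneg _) (norm_nonneg L)
  have h2 := mul_le_mul (this 1 0) (this 0 1) (abs_nonneg _) (norm_nonneg L)
  nlinarith

lemma isv_det_cont : Continuous (fun L : E2 →L[ℝ] E2 => L.det) := by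
  have : (fun L : E2 →L[ℝ] E2 => L.det) = fun L => (L (isvE 0)) 0 * (L (isvE 1)) 1
    - (L (isvE 1)) 0 * (L (isvE 0)) 1 := by ext L; exact isv_det L
  rw [this]
  fun_prop

/-- ramp -/
def isvκ (s : ℝ) : ℝ := min (max s 0) 1
def isvχ (s : ℝ) : ℝ := ∫ u in (0:ℝ)..s, isvκ u

lemma isvκ_cont : Continuous isvκ := by unfold isvκ; fun_prop
lemma isvκ_nonneg (s : ℝ) : 0 ≤ isvκ s := by unfold isvκ; positivity
lemma isvκ_le (s : ℝ) : isvκ s ≤ 1 := min_le_right _ _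
lemma isvκ_pos {s : ℝ} (h : 0 < s) : 0 < isvκ s := by
  unfold isvκ; exact lt_min (lt_max_of_lt_left h) one_pos
lemma isvκ_zero {s : ℝ} (h : s ≤ 0) : isvκ s = 0 := by
  unfold isvκ; simp [max_eq_right h]
lemma isvχ_deriv (s : ℝ) : HasDerivAt isvχ (isvκ s) s :=
  intervalIntegral.integral_hasDerivAt_right (isvκ_cont.intervalIntegrable _ _)
    (isvκ_cont.stronglyMeasurableAtFilter _ _) isvκ_cont.continuousAt
lemma isvχ_contDiff : ContDiff ℝ 1 isvχ := by
  rw [contDiff_one_iff_deriv]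
  refine ⟨fun s => (isvχ_deriv s).differentiableAt, ?_⟩
  have : deriv isvχ = isvκ := funext fun s => (isvχ_deriv s).deriv
  rw [this]; exact isvκ_cont
lemma isvχ_zero {s : ℝ} (h : s ≤ 0) : isvχ s = 0 := by
  unfold isvχ
  rw [intervalIntegral.integral_symm, intervalIntegral.integral_of_le h,
    setIntegral_congr_fun (g := fun _ => (0:ℝ)) measurableSet_Ioc (fun u hu => isvκ_zero hu.2)]
  simp
lemma isvχ_pos {s : ℝ} (h : 0 < s) : 0 < isvχ s := by
  unfold isvχ
  exact intervalIntegral.intervalIntegral_pos_of_pos_on (isvκ_cont.intervalIntegrable _ _)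
    (fun u hu => isvκ_pos hu.1) h

/-- degenerate finite-distortion condition at a matrix -/
def isvFD (L : E2 →L[ℝ] E2) : Prop := 0 ≤ L.det ∧ (L.det = 0 → L = 0)

open Filter Metric in
theorem isv_mp {x₀ : E2} {t : ℝ} (ht : 0 < t) {g f Df} (H : IsvApprox (ball x₀ t) g f Df)
    (hFD : ∀ᵐ x ∂(volume.restrict (ball x₀ t)), isvFD (Df x)) (e : E2) (he : ‖e‖ = 1) (M : ℝ)
    (hM : ∀ n, ∀ x ∈ sphere x₀ t, inner ℝ e (g n x) < M) :
    ∀ᵐ x ∂(volume.restrict (ball x₀ t)), inner ℝ e (f x) ≤ M := by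
  have hvol : volume (ball x₀ t) ≠ ⊤ := measure_ball_lt_top.ne
  have hGc : ∀ n, Continuous (fderiv ℝ (g n)) := fun n =>
    (H.smooth n).continuous_fderiv (by simp)
  have hgc : ∀ n, Continuous (g n) := fun n => (H.smooth n).continuous
  set X : E2 → E2 := fun w => isvχ (inner ℝ e w - M) • e with hX
  have hXd : ∀ w, HasFDerivAt X ((isvκ (inner ℝ e w - M) • innerSL ℝ e).smulRight e) w := by
    intro w
    have h1 : HasFDerivAt (fun w : E2 => inner ℝ e w - M) (innerSL ℝ e) w :=
      (innerSL ℝ e).hasFDerivAt.sub_const M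
    exact ((isvχ_deriv _).comp_hasFDerivAt w h1).smul_const e
  have hXc : ContDiff ℝ 1 X := by
    refine ContDiff.smul (isvχ_contDiff.comp ?_) contDiff_const
    exact (contDiff_const.inner ℝ contDiff_id).sub contDiff_const
  have hdiv : ∀ w, isvDiv X w = isvκ (inner ℝ e w - M) := by
    intro w
    have hn : e 0 ^ 2 + e 1 ^ 2 = 1 := by
      have := EuclideanSpace.real_norm_sq_eq e
      rw [he] at this
      simp [Fin.sum_univ_two] at this
      linarith
    simp only [isvDiv, (hXd w).fderiv]
    simp [isvE, EuclideanSpace.inner_single_right]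
    linear_combination (isvκ (inner ℝ e w - M)) * hn
  have hsupp : tsupport X ⊆ {w | M ≤ inner ℝ e w} := by
    refine closure_minimal ?_ (isClosed_le continuous_const (by fun_prop))
    intro w hw
    by_contra hlt
    simp only [mem_ofPred_eq, not_le] at hlt
    apply hw
    simp [hX, isvχ_zero (sub_nonpos.2 hlt.le)]
  have hz : ∀ n, ∫ x in ball x₀ t, isvκ (inner ℝ e (g n x) - M) * (fderiv ℝ (g n) x).det = 0 := by
    intro n
    have := isv_L1 (g n) (H.c2 n) X hXc x₀ t ht
      (fun x hx hx2 => absurd (hsupp hx2) (not_le.2 (hM n x hx)))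
    simpa only [hdiv] using this
  have hκlim : ∀ᵐ x ∂(volume.restrict (ball x₀ t)), Tendsto
      (fun n => isvκ (inner ℝ e (g n x) - M)) atTop (𝓝 (isvκ (inner ℝ e (f x) - M))) := by
    filter_upwards [H.ae] with x hx
    exact (isvκ_cont.tendsto _).comp ((tendsto_const_nhds.inner hx).sub_const M)
  have hκb : ∀ s, |isvκ s| ≤ 1 := fun s => by
    rw [abs_of_nonneg (isvκ_nonneg s)]; exact isvκ_le s
  have hl1 := isv_lim hvol H
    (P := fun n x => isvκ (inner ℝ e (g n x) - M) * (fderiv ℝ (g n) x).det)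
    (Q := fun x => isvκ (inner ℝ e (f x) - M) * (Df x).det)
    (fun n => Continuous.aestronglyMeasurable (by
      have := isvκ_cont; have := isv_det_cont; have := hGc n; have := hgc n
      exact (isvκ_cont.comp (by fun_prop)).mul (isv_det_cont.comp (hGc n))))
    (by filter_upwards [hκlim, H.aeD] with x h1 h2
        exact h1.mul ((isv_det_cont.tendsto _).comp h2)) 2
    (fun n => Eventually.of_forall fun x => by
      rw [abs_mul]
      have := isv_det_le (fderiv ℝ (g n) x)
      have h2 := hκb (inner ℝ e (g n x) - M)
      have := mul_le_mul h2 this (abs_nonneg _) zero_le_one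
      linarith)
  have hQ0 : ∫ x in ball x₀ t, isvκ (inner ℝ e (f x) - M) * (Df x).det = 0 := by
    refine tendsto_nhds_unique hl1.2.2 ?_
    simp only [hz]; exact tendsto_const_nhds
  have hQae : ∀ᵐ x ∂(volume.restrict (ball x₀ t)), isvκ (inner ℝ e (f x) - M) * ‖Df x‖ = 0 := by
    have := (integral_eq_zero_iff_of_nonneg_ae (by
      filter_upwards [hFD] with x hx using mul_nonneg (isvκ_nonneg _) hx.1) hl1.2.1).1 hQ0
    filter_upwards [this, hFD] with x h1 h2
    rcases mul_eq_zero.1 h1 with h | h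
    · rw [h, zero_mul]
    · rw [h2.2 h, norm_zero, mul_zero]
  have hl2 := (isv_lim hvol H
    (P := fun n x => isvκ (inner ℝ e (g n x) - M) * ‖fderiv ℝ (g n) x‖)
    (Q := fun x => isvκ (inner ℝ e (f x) - M) * ‖Df x‖)
    (fun n => Continuous.aestronglyMeasurable (by
      have := hGc n; have := hgc n
      exact (isvκ_cont.comp (by fun_prop)).mul (by fun_prop)))
    (by filter_upwards [hκlim, H.aeD] with x h1 h2
        exact h1.mul h2.norm) 1
    (fun n => Eventually.of_forall fun x => by
      rw [abs_mul, abs_norm]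
      have h2 := hκb (inner ℝ e (g n x) - M)
      have := mul_le_mul_of_nonneg_right h2 (norm_nonneg (fderiv ℝ (g n) x))
      nlinarith [sq_nonneg (‖fderiv ℝ (g n) x‖ - 1)])).1
  have hl3 : Tendsto (fun n => ∫⁻ x in ball x₀ t,
      ‖isvκ (inner ℝ e (g n x) - M) * ‖fderiv ℝ (g n) x‖‖ₑ) atTop (𝓝 0) := by
    refine hl2.congr fun n => lintegral_congr_ae ?_
    filter_upwards [hQae] with x hx
    rw [hx, sub_zero]
  -- the truncated functions
  set v : ℕ → E2 → ℝ := fun n => (ball x₀ t).indicator (fun x => isvχ (inner ℝ e (g n x) - M))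
    with hv
  have hin : ∀ n x, x ∈ ball x₀ t → v n =ᶠ[𝓝 x] fun x => isvχ (inner ℝ e (g n x) - M) := by
    intro n x hx
    filter_upwards [isOpen_ball.mem_nhds hx] with y hy
    simp [hv, indicator_of_mem hy]
  have hout : ∀ n x, x ∉ ball x₀ t → v n =ᶠ[𝓝 x] fun _ => (0:ℝ) := by
    intro n x hx
    by_cases hx2 : x ∈ sphere x₀ t
    · have : ∀ᶠ y in 𝓝 x, inner ℝ e (g n y) < M := by
        have hc : Continuous fun y => inner ℝ e (g n y) := by have := hgc n; fun_prop
        exact hc.continuousAt.eventually_lt continuousAt_const (hM n x hx2)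
      filter_upwards [this] with y hy
      by_cases hyb : y ∈ ball x₀ t
      · simp only [hv, indicator_of_mem hyb]
        exact isvχ_zero (sub_nonpos.2 hy.le)
      · simp only [hv, indicator_of_notMem hyb]
    · have : x ∈ (closedBall x₀ t)ᶜ := by
        simp only [mem_compl_iff, mem_closedBall, mem_sphere, mem_ball] at *
        intro h; exact hx (lt_of_le_of_ne h hx2)
      filter_upwards [isClosed_closedBall.isOpen_compl.mem_nhds this] with y hy
      simp only [hv]
      exact indicator_of_notMem (fun h => hy (ball_subset_closedBall h)) _
  have hsm : ∀ n, ContDiff ℝ 1 (fun x => isvχ (inner ℝ e (g n x) - M)) := fun n =>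
    isvχ_contDiff.comp ((contDiff_const.inner ℝ (H.c1 n)).sub contDiff_const)
  have hvc : ∀ n, ContDiff ℝ 1 (v n) := by
    intro n
    rw [contDiff_iff_contDiffAt]
    intro x
    by_cases hx : x ∈ ball x₀ t
    · exact (hsm n).contDiffAt.congr_of_eventuallyEq (hin n x hx)
    · exact contDiffAt_const.congr_of_eventuallyEq (hout n x hx)
  have hvs : ∀ n, HasCompactSupport (v n) := fun n =>
    HasCompactSupport.intro (isCompact_closedBall x₀ t) fun x hx =>
      indicator_of_notMem (fun h => hx (ball_subset_closedBall h)) _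
  have hvd : ∀ n, ∫⁻ x, ‖fderiv ℝ (v n) x‖ₑ ≤ ∫⁻ x in ball x₀ t,
      ‖isvκ (inner ℝ e (g n x) - M) * ‖fderiv ℝ (g n) x‖‖ₑ := by
    intro n
    rw [← lintegral_indicator measurableSet_ball]
    refine lintegral_mono fun x => ?_
    by_cases hx : x ∈ ball x₀ t
    · rw [indicator_of_mem hx, (hin n x hx).fderiv_eq]
      have h1 : HasFDerivAt (fun x : E2 => inner ℝ e (g n x) - M)
          ((innerSL ℝ e).comp (fderiv ℝ (g n) x)) x :=
        ((innerSL ℝ e).hasFDerivAt.comp x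
          ((H.smooth n).differentiable (by simp) x).hasFDerivAt).sub_const M
      have h2 := (isvχ_deriv _).comp_hasFDerivAt x h1
      have h3 : HasFDerivAt (fun x => isvχ (inner ℝ e (g n x) - M)) _ x := h2
      rw [h3.fderiv, enorm_smul, enorm_mul]
      gcongr
      rw [enorm_norm, ← ofReal_norm, ← ofReal_norm]
      refine ENNReal.ofReal_le_ofReal ((ContinuousLinearMap.opNorm_comp_le _ _).trans ?_)
      rw [innerSL_apply_norm, he, one_mul]
    · rw [indicator_of_notMem hx, (hout n x hx).fderiv_eq, fderiv_fun_const, Pi.zero_apply, ← ofReal_norm,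
        norm_zero, ENNReal.ofReal_zero]
  have hlim0 : Tendsto (fun n => ∫⁻ x, ‖fderiv ℝ (v n) x‖ₑ) atTop (𝓝 0) :=
    tendsto_of_tendsto_of_tendsto_of_le_of_le tendsto_const_nhds hl3 (fun _ => zero_le) hvd
  have hconj : Real.HolderConjugate (Module.finrank ℝ E2) 2 := by
    simp only [finrank_euclideanSpace, Fintype.card_fin]
    exact_mod_cast Real.HolderConjugate.two_two
  have hv0 : Tendsto (fun n => ∫⁻ x, ‖v n x‖ₑ ^ (2:ℝ)) atTop (𝓝 0) := by
    have h1 : Tendsto (fun n => (lintegralPowLePowLIntegralFDerivConst (volume : Measure E2) 2 :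
        ℝ≥0∞) * (∫⁻ x, ‖fderiv ℝ (v n) x‖ₑ) ^ (2:ℝ)) atTop (𝓝 0) := by
      have a2 := (ENNReal.continuous_rpow_const (y := 2)).tendsto 0 |>.comp hlim0
      have a3 := ENNReal.Tendsto.const_mul (a := (lintegralPowLePowLIntegralFDerivConst
        (volume : Measure E2) 2 : ℝ≥0∞)) a2 (Or.inr (by simp))
      simpa [Function.comp_def] using a3
    exact tendsto_of_tendsto_of_tendsto_of_le_of_le tendsto_const_nhds h1 (fun _ => zero_le)
      fun n => lintegral_pow_le_pow_lintegral_fderiv volume (hvc n) (hvs n) hconj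
  have hfat := lintegral_liminf_le' (μ := volume.restrict (ball x₀ t)) (u := atTop)
    (f := fun n x => ‖v n x‖ₑ ^ (2:ℝ))
    (fun n => ((hvc n).continuous.enorm.measurable.pow_const _).aemeasurable)
  have h0 : liminf (fun n => ∫⁻ x in ball x₀ t, ‖v n x‖ₑ ^ (2:ℝ)) atTop = 0 := by
    refine Tendsto.liminf_eq ?_
    exact tendsto_of_tendsto_of_tendsto_of_le_of_le tendsto_const_nhds hv0 (fun _ => zero_le)
      fun n => setLIntegral_le_lintegral _ _
  rw [h0, nonpos_iff_eq_zero, lintegral_eq_zero_iff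
    (Measurable.liminf fun n => ((hvc n).continuous.enorm.measurable.pow_const _))]
    at hfat
  filter_upwards [hfat, H.ae, ae_restrict_mem measurableSet_ball] with x h1 h2 hx
  by_contra hlt
  push Not at hlt
  have h3 : Tendsto (fun n => ‖v n x‖ₑ ^ (2:ℝ)) atTop
      (𝓝 (‖isvχ (inner ℝ e (f x) - M)‖ₑ ^ (2:ℝ))) := by
    simp only [hv, indicator_of_mem hx]
    have := (isvχ_contDiff.continuous.tendsto _).comp ((tendsto_const_nhds (x := e)).inner (𝕜 := ℝ) h2 |>.sub_const M)
    exact (ENNReal.continuous_rpow_const.tendsto _).comp this.enorm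
  rw [h3.liminf_eq] at h1
  have := isvχ_pos (sub_pos.2 hlt)
  simp at h1
  exact this.ne' h1


/-- circle parametrization -/
def isvC (x₀ : E2) (t θ : ℝ) : E2 := x₀ + !₂[t * Real.cos θ, t * Real.sin θ]

lemma isvC_cont (x₀ : E2) : Continuous (fun p : ℝ × ℝ => isvC x₀ p.1 p.2) := by
  unfold isvC
  refine continuous_const.add ?_
  refine (PiLp.continuous_toLp 2 (fun _ : Fin 2 => ℝ)).comp ?_
  refine continuous_pi fun i => ?_
  fin_cases i
  · simp; fun_prop
  · simp; fun_prop

lemma isvC_norm (x₀ : E2) (t θ : ℝ) : ‖isvC x₀ t θ - x₀‖ = |t| := by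
  unfold isvC
  rw [add_sub_cancel_left, EuclideanSpace.norm_eq, Fin.sum_univ_two]
  simp only [Real.norm_eq_abs, sq_abs]
  simp only [Matrix.cons_val_zero, Matrix.cons_val_one]
  rw [show (t * Real.cos θ) ^ 2 + (t * Real.sin θ) ^ 2
    = t ^ 2 * (Real.sin θ ^ 2 + Real.cos θ ^ 2) by ring, Real.sin_sq_add_cos_sq, mul_one,
    Real.sqrt_sq_eq_abs]

lemma isvC_surj (x₀ : E2) (t : ℝ) (p : E2) (hp : ‖p - x₀‖ = t) :
    ∃ θ ∈ Icc (-π) π, isvC x₀ t θ = p := by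
  set v := p - x₀ with hv
  have hn : ‖(⟨v 0, v 1⟩ : ℂ)‖ = t := by
    rw [← hp, EuclideanSpace.norm_eq, Fin.sum_univ_two, Complex.norm_def, Complex.normSq_mk]
    simp only [Real.norm_eq_abs, sq_abs]
    congr 1; ring
  refine ⟨Complex.arg ⟨v 0, v 1⟩, ⟨(Complex.neg_pi_lt_arg _).le, Complex.arg_le_pi _⟩, ?_⟩
  unfold isvC
  have : p = x₀ + v := by simp [hv]
  rw [this]; congr 1
  have h1 := Complex.norm_mul_cos_arg (⟨v 0, v 1⟩ : ℂ)
  have h2 := Complex.norm_mul_sin_arg (⟨v 0, v 1⟩ : ℂ)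
  rw [hn] at h1 h2
  ext i; fin_cases i
  · simpa using h1
  · simpa using h2

lemma isv_polar (F : E2 → ℝ≥0∞) :
    ∫⁻ x, F x = ∫⁻ p in Ioi (0:ℝ) ×ˢ Ioo (-π) π, ENNReal.ofReal p.1 * F (isvC 0 p.1 p.2) := by
  have h1 := (PiLp.volume_preserving_toLp (Fin 2)).lintegral_comp_emb
    (MeasurableEquiv.toLp 2 (Fin 2 → ℝ)).measurableEmbedding F
  have h2 := ((volume_preserving_finTwoArrow ℝ).symm _).lintegral_comp_emb
    (MeasurableEquiv.finTwoArrow (α := ℝ)).symm.measurableEmbedding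
    (fun a => F (WithLp.toLp 2 a))
  rw [← h1, ← h2, ← lintegral_comp_polarCoord_symm]
  refine lintegral_congr fun p => ?_
  simp only [smul_eq_mul, isvC, zero_add]
  congr 2

open Metric in
lemma isv_polar_ball (x₀ : E2) (R : ℝ) (F : E2 → ℝ≥0∞) (hF : Measurable F) :
    ∫⁻ t in Ioo 0 R, (ENNReal.ofReal t * ∫⁻ θ in Ioo (-π) π, F (isvC x₀ t θ))
      ≤ ∫⁻ x in closedBall x₀ R, F x := by
  have h1 : ∫⁻ x in closedBall x₀ R, F x =
      ∫⁻ x, (closedBall x₀ R).indicator F (x₀ + x) := by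
    rw [lintegral_add_left_eq_self (fun x => (closedBall x₀ R).indicator F x) x₀,
      lintegral_indicator measurableSet_closedBall]
  have hm : Measurable (fun p : ℝ × ℝ => ENNReal.ofReal p.1 * F (isvC x₀ p.1 p.2)) :=
    (ENNReal.measurable_ofReal.comp measurable_fst).mul (hF.comp (isvC_cont x₀).measurable)
  rw [h1, isv_polar]
  calc ∫⁻ t in Ioo 0 R, (ENNReal.ofReal t * ∫⁻ θ in Ioo (-π) π, F (isvC x₀ t θ))
      = ∫⁻ t in Ioo 0 R, ∫⁻ θ in Ioo (-π) π, ENNReal.ofReal t * F (isvC x₀ t θ) := by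
        refine lintegral_congr fun t => ?_
        rw [lintegral_const_mul' _ _ (by simp)]
    _ = ∫⁻ p in Ioo (0:ℝ) R ×ˢ Ioo (-π) π, ENNReal.ofReal p.1 * F (isvC x₀ p.1 p.2) := by
        rw [Measure.volume_eq_prod, ← Measure.prod_restrict]
        exact (lintegral_prod (μ := volume.restrict (Ioo 0 R)) (ν := volume.restrict (Ioo (-π) π))
          _ hm.aemeasurable).symm
    _ = ∫⁻ p in Ioo (0:ℝ) R ×ˢ Ioo (-π) π, ENNReal.ofReal p.1 *
          (closedBall x₀ R).indicator F (x₀ + isvC 0 p.1 p.2) := by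
        refine setLIntegral_congr_fun (measurableSet_Ioo.prod measurableSet_Ioo) ?_
        intro p hp
        have e : x₀ + isvC 0 p.1 p.2 = isvC x₀ p.1 p.2 := by simp [isvC]
        simp only [e]
        rw [indicator_of_mem]
        rw [mem_closedBall, dist_eq_norm, isvC_norm, abs_of_pos hp.1.1]
        exact hp.1.2.le
    _ ≤ _ := lintegral_mono_set (prod_mono Ioo_subset_Ioi_self subset_rfl)

lemma isvC_hasDeriv (x₀ : E2) (t θ : ℝ) :
    HasDerivAt (isvC x₀ t) (isvC 0 t (θ + π / 2)) θ := by
  unfold isvC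
  rw [zero_add]
  refine HasDerivAt.const_add x₀ ?_
  have h0 : HasDerivAt (fun θ => ![t * Real.cos θ, t * Real.sin θ])
      ![t * Real.cos (θ + π / 2), t * Real.sin (θ + π / 2)] θ := ?_
  · exact ((PiLp.continuousLinearEquiv 2 ℝ (fun _ : Fin 2 => ℝ)).symm.toContinuousLinearMap).hasFDerivAt.comp_hasDerivAt θ h0
  rw [hasDerivAt_pi]
  intro i
  fin_cases i
  · simpa [Real.cos_add_pi_div_two] using (Real.hasDerivAt_cos θ).const_mul t
  · simpa [Real.sin_add_pi_div_two] using (Real.hasDerivAt_sin θ).const_mul t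

open Metric in
lemma isv_osc {G : Type*} [NormedAddCommGroup G] [NormedSpace ℝ G] [CompleteSpace G]
    (u : E2 → G) (x₀ : E2) (t : ℝ) (ht : 0 < t)
    (hu : ∀ x ∈ sphere x₀ t, ContDiffAt ℝ 1 u x) (p q : E2) (hp : p ∈ sphere x₀ t)
    (hq : q ∈ sphere x₀ t) :
    ‖u p - u q‖ₑ ≤ ENNReal.ofReal t * ∫⁻ θ in Ioo (-π) π, ‖fderiv ℝ u (isvC x₀ t θ)‖ₑ := by
  have hS : ∀ θ, isvC x₀ t θ ∈ sphere x₀ t := fun θ => by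
    rw [mem_sphere, dist_eq_norm, isvC_norm, abs_of_pos ht]
  have hcθ : ∀ y : E2, Continuous (isvC y t) := fun y =>
    (isvC_cont y).comp (continuous_const.prodMk continuous_id)
  have hd : ∀ θ, HasDerivAt (fun θ => u (isvC x₀ t θ))
      (fderiv ℝ u (isvC x₀ t θ) (isvC 0 t (θ + π / 2))) θ := fun θ =>
    (((hu _ (hS θ)).differentiableAt (by norm_num)).hasFDerivAt).comp_hasDerivAt θ
      (isvC_hasDeriv x₀ t θ)
  have hc1 : Continuous (fun θ => fderiv ℝ u (isvC x₀ t θ)) := by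
    rw [continuous_iff_continuousAt]
    intro θ
    exact ContinuousAt.comp (f := isvC x₀ t) ((hu _ (hS θ)).fderiv_right (m := 0) (by norm_num)).continuousAt
      (hcθ x₀).continuousAt
  have hc : Continuous (fun θ => fderiv ℝ u (isvC x₀ t θ) (isvC 0 t (θ + π / 2))) :=
    hc1.clm_apply ((hcθ 0).comp (by fun_prop))
  have main : ∀ a b, a ∈ Icc (-π) π → b ∈ Icc (-π) π → a ≤ b →
      ‖u (isvC x₀ t b) - u (isvC x₀ t a)‖ₑ ≤
        ENNReal.ofReal t * ∫⁻ θ in Ioo (-π) π, ‖fderiv ℝ u (isvC x₀ t θ)‖ₑ := by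
    intro a b ha hb hab
    rw [← intervalIntegral.integral_eq_sub_of_hasDerivAt (fun θ _ => hd θ)
      (hc.intervalIntegrable _ _), intervalIntegral.integral_of_le hab]
    refine (enorm_integral_le_lintegral_enorm _).trans ?_
    rw [← lintegral_const_mul' _ _ (by simp)]
    rw [← restrict_Ioo_eq_restrict_Ioc]
    refine (lintegral_mono_set (Ioo_subset_Ioo ha.1 hb.2)).trans ?_
    refine lintegral_mono fun θ => ?_
    simp only
    rw [← ofReal_norm, ← ofReal_norm, ← ENNReal.ofReal_mul ht.le]
    refine ENNReal.ofReal_le_ofReal ?_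
    refine (ContinuousLinearMap.le_opNorm _ _).trans ?_
    have := isvC_norm 0 t (θ + π / 2)
    rw [sub_zero, abs_of_pos ht] at this
    rw [this, mul_comm]
  obtain ⟨a, ha, rfl⟩ := isvC_surj x₀ t p (by rw [← dist_eq_norm]; exact hp)
  obtain ⟨b, hb, rfl⟩ := isvC_surj x₀ t q (by rw [← dist_eq_norm]; exact hq)
  rcases le_total a b with h | h
  · rw [← neg_sub, enorm_neg]
    exact main a b ha hb h
  · exact main b a hb ha h

open Filter Metric in
lemma isv_circ_fatou (x₀ : E2) (R : ℝ) (F : ℕ → E2 → ℝ≥0∞) (hF : ∀ n, Measurable (F n))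
    (A : ℝ≥0∞) (hA : ∀ n, ∫⁻ x in closedBall x₀ R, F n x ≤ A) :
    ∫⁻ t in Ioo 0 R, liminf (fun n => ENNReal.ofReal t * ∫⁻ θ in Ioo (-π) π, F n (isvC x₀ t θ))
      atTop ≤ A := by
  refine (lintegral_liminf_le fun n => ?_).trans ?_
  · refine ENNReal.measurable_ofReal.mul ?_
    exact Measurable.lintegral_prod_right' (f := fun p : ℝ × ℝ => F n (isvC x₀ p.1 p.2))
      ((hF n).comp (isvC_cont x₀).measurable)
  · refine liminf_le_of_le (by isBoundedDefault) fun b hb => ?_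
    obtain ⟨n, hn⟩ := hb.exists
    exact hn.trans ((isv_polar_ball x₀ R (F n) (hF n)).trans (hA n))

open Filter Metric in
lemma isv_circ_a (x₀ : E2) (R : ℝ) (F : ℕ → E2 → ℝ≥0∞) (hF : ∀ n, Measurable (F n))
    (A : ℝ≥0∞) (hAt : A ≠ ⊤) (hA : ∀ n, ∫⁻ x in closedBall x₀ R, F n x ≤ A) :
    ∀ᵐ t ∂(volume.restrict (Ioo 0 R)), ∃ C : ℝ≥0∞, C ≠ ⊤ ∧ ∃ᶠ n in atTop,
      ENNReal.ofReal t * ∫⁻ θ in Ioo (-π) π, F n (isvC x₀ t θ) < C := by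
  have h := isv_circ_fatou x₀ R F hF A hA
  have h2 := ae_lt_top' (AEMeasurable.mono_measure (Measurable.aemeasurable (μ := volume)
    (Measurable.liminf fun n => ?_)) Measure.restrict_le_self) (h.trans_lt hAt.lt_top).ne
  · filter_upwards [h2] with t ht
    obtain ⟨C, hC1, hC2⟩ := exists_between ht
    exact ⟨C, hC2.ne, frequently_lt_of_liminf_lt (by isBoundedDefault) hC1⟩
  · refine ENNReal.measurable_ofReal.mul ?_
    exact Measurable.lintegral_prod_right' (f := fun p : ℝ × ℝ => F n (isvC x₀ p.1 p.2))
      ((hF n).comp (isvC_cont x₀).measurable)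

open Filter Metric in
lemma isv_circ_b (x₀ : E2) (r R : ℝ) (hr : 0 < r) (hrR : r < R) (F : ℕ → E2 → ℝ≥0∞)
    (hF : ∀ n, Measurable (F n))
    (A A' : ℝ) (hA0 : 0 ≤ A) (hAA : A < A')
    (hA : ∀ n, ∫⁻ x in closedBall x₀ R, F n x ≤ ENNReal.ofReal A) :
    ∃ t ∈ Ioo r R, ∃ᶠ n in atTop, ENNReal.ofReal t * (ENNReal.ofReal t *
      ∫⁻ θ in Ioo (-π) π, F n (isvC x₀ t θ)) < ENNReal.ofReal (A' / Real.log (R / r)) := by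
  by_contra hcon
  push Not at hcon
  have h := isv_circ_fatou x₀ R F hF _ hA
  have hlog : 0 < Real.log (R / r) := Real.log_pos (by rw [lt_div_iff₀ hr]; linarith)
  have h1 : ENNReal.ofReal A' ≤ ∫⁻ t in Ioo r R, ENNReal.ofReal ((A' / Real.log (R / r)) * t⁻¹) := by
    rw [← ofReal_integral_eq_lintegral_ofReal]
    · rw [integral_const_mul, ← integral_Ioc_eq_integral_Ioo, ← intervalIntegral.integral_of_le hrR.le,
        integral_inv_of_pos hr (hr.trans hrR), div_mul_cancel₀ _ hlog.ne']
    · refine Integrable.const_mul ?_ _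
      have : IntervalIntegrable (fun t : ℝ => t⁻¹) volume r R := by
        refine ContinuousOn.intervalIntegrable ?_
        rw [uIcc_of_le hrR.le]
        exact continuousOn_inv₀.mono fun t ht => (hr.trans_le ht.1).ne'
      rw [intervalIntegrable_iff_integrableOn_Ioo_of_le hrR.le] at this
      exact this
    · filter_upwards [ae_restrict_mem measurableSet_Ioo] with t ht
      have : 0 < t := hr.trans ht.1
      have : 0 < A' := by linarith
      simp only [Pi.zero_apply]; positivity
  have h2 : ∫⁻ t in Ioo r R, ENNReal.ofReal ((A' / Real.log (R / r)) * t⁻¹) ≤ ∫⁻ t in Ioo 0 R,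
      liminf (fun n => ENNReal.ofReal t * ∫⁻ θ in Ioo (-π) π, F n (isvC x₀ t θ)) atTop := by
    refine le_trans ?_ (lintegral_mono_set (Ioo_subset_Ioo_left hr.le))
    refine setLIntegral_mono' measurableSet_Ioo fun t ht => ?_
    refine le_liminf_of_le (by isBoundedDefault) ?_
    filter_upwards [hcon t ht] with n hn
    have ht0 : 0 < t := hr.trans ht.1
    rw [ENNReal.ofReal_mul' (by positivity), ENNReal.ofReal_inv_of_pos ht0, ← div_eq_mul_inv]
    exact ENNReal.div_le_of_le_mul' hn
  have h3 := (h1.trans h2).trans h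
  rw [ENNReal.ofReal_le_ofReal_iff hA0] at h3
  linarith


open Filter Metric in
lemma isv_mp2 {x₀ : E2} {t : ℝ} (ht : 0 < t) {g f Df} (H : IsvApprox (ball x₀ t) g f Df)
    (hFD : ∀ᵐ x ∂(volume.restrict (ball x₀ t)), isvFD (Df x)) (c : E2) (ε : ℝ)
    (hM : ∃ᶠ n in atTop, ∀ x ∈ sphere x₀ t, ‖g n x - c‖ < ε) :
    ∀ᵐ x ∂(volume.restrict (ball x₀ t)), ‖f x - c‖ ≤ 2 * ε := by
  obtain ⟨φ, hφ, hn⟩ := extraction_of_frequently_atTop hM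
  have H2 := H.comp hφ
  have key : ∀ e : E2, ‖e‖ = 1 → ∀ᵐ x ∂(volume.restrict (ball x₀ t)), inner ℝ e (f x - c) ≤ ε := by
    intro e he
    have := isv_mp ht H2 hFD e he (inner ℝ e c + ε) (fun n x hx => by
      have h1 := hn n x hx
      have h2 := real_inner_le_norm e (g (φ n) x - c)
      rw [inner_sub_right, he, one_mul] at h2
      linarith)
    filter_upwards [this] with x hx
    rw [inner_sub_right]; linarith
  have hE : ∀ i, ‖isvE i‖ = 1 := fun i => by simp [isvE]
  filter_upwards [key (isvE 0) (hE 0), key (isvE 1) (hE 1), key (-isvE 0) (by rw [norm_neg, hE]),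
    key (-isvE 1) (by rw [norm_neg, hE])] with x h1 h2 h3 h4
  set v := f x - c
  simp only [inner_neg_left, isvE, EuclideanSpace.inner_single_left] at h1 h2 h3 h4
  simp at h1 h2 h3 h4
  have a0 : |v 0| ≤ ε := abs_le.2 ⟨by linarith, h1⟩
  have a1 : |v 1| ≤ ε := abs_le.2 ⟨by linarith, h2⟩
  rw [isv_decomp v]
  refine (norm_add_le _ _).trans ?_
  rw [norm_smul, norm_smul, hE, hE, Real.norm_eq_abs, Real.norm_eq_abs]
  linarith

open Filter Metric in
lemma isv_approx' {Ω : Set E2} (hΩ : IsOpen Ω) {f Df} (hf : MemW12loc Ω f Df) {x₀ : E2} {R : ℝ}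
    (hR0 : 0 ≤ R) (hR : closedBall x₀ R ⊆ Ω) :
    ∃ g : ℕ → E2 → E2, IsvApprox (closedBall x₀ R) g f Df ∧
     (∃ C : ℝ≥0∞, C ≠ ⊤ ∧ ∀ n, ∫⁻ x in closedBall x₀ R, ‖g n x‖ₑ ≤ C) ∧
     (ContinuousOn f Ω → TendstoUniformlyOn g f atTop (closedBall x₀ R)) := by
  obtain ⟨g, h1, h2, h3, h4, h5, h6⟩ := isv_approx hΩ hf hR0 hR
  refine ⟨g, ⟨h1, h2, h4, h5, hf.2.1, ?_⟩, h3, h6⟩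
  refine lt_of_le_of_lt (le_of_eq ?_) (hf.2.2.1 _ hR (isCompact_closedBall _ _))
  refine lintegral_congr fun x => ?_
  rw [← ofReal_norm, ENNReal.ofReal_pow (norm_nonneg _)]

open Filter Metric in
theorem isv_ke {Ω : Set E2} (hΩ : IsOpen Ω) {f Df} (hf : MemW12loc Ω f Df)
    (hFD : ∀ᵐ x ∂(volume.restrict Ω), isvFD (Df x)) {x₀ : E2} {r R A₀ ε : ℝ}
    (hr : 0 < r) (hrR : r < R) (hR : closedBall x₀ R ⊆ Ω) (hε : 0 < ε) (hA0 : 0 ≤ A₀)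
    (hA : ∫⁻ x in closedBall x₀ R, ‖Df x‖ₑ ^ 2 ≤ ENNReal.ofReal A₀)
    (hAε : 2 * π * A₀ < ε ^ 2 * Real.log (R / r)) :
    ∃ c, ∀ᵐ x ∂(volume.restrict (ball x₀ r)), ‖f x - c‖ ≤ 2 * ε := by
  have hR0 : 0 < R := hr.trans hrR
  obtain ⟨g₀, H₀, ⟨C, hC, hgC₀⟩, -⟩ := isv_approx' hΩ hf hR0.le hR
  have hlog : 0 < Real.log (R / r) := Real.log_pos (by rw [lt_div_iff₀ hr]; linarith)
  set L := Real.log (R / r) with hL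
  have hpi := Real.pi_pos
  obtain ⟨A', hAA', hA'⟩ : ∃ A', A₀ < A' ∧ 2 * π * A' < ε ^ 2 * L := by
    obtain ⟨A', h1, h2⟩ := exists_between (show A₀ < ε ^ 2 * L / (2 * π) by
      rw [lt_div_iff₀ (by positivity)]; linarith)
    exact ⟨A', h1, by rw [lt_div_iff₀ (by positivity)] at h2; linarith⟩
  obtain ⟨A, hA1, hA2⟩ := exists_between hAA'
  obtain ⟨A₁, hA3, hA4⟩ := exists_between hA1
  -- energy bound
  have hvol : volume (closedBall x₀ R) ≠ ⊤ := measure_closedBall_lt_top.ne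
  have hGc₀ : ∀ n, Continuous (fderiv ℝ (g₀ n)) := fun n =>
    (H₀.smooth n).continuous_fderiv (by simp)
  have hlim := isv_lim hvol H₀ (P := fun n x => ‖fderiv ℝ (g₀ n) x‖ ^ 2) (Q := fun x => ‖Df x‖ ^ 2)
    (fun n => ((hGc₀ n).norm.pow 2).aestronglyMeasurable)
    (by filter_upwards [H₀.aeD] with x hx using hx.norm.pow 2) 1
    (fun n => Eventually.of_forall fun x => by
      rw [abs_of_nonneg (by positivity)]; linarith)
  have hDle : ∫ x in closedBall x₀ R, ‖Df x‖ ^ 2 ≤ A₀ := by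
    rw [integral_eq_lintegral_of_nonneg_ae (Eventually.of_forall fun x => by positivity)
      hlim.2.1.1]
    refine ENNReal.toReal_le_of_le_ofReal hA0 (le_trans (le_of_eq ?_) hA)
    refine lintegral_congr fun x => ?_
    rw [← ofReal_norm, ENNReal.ofReal_pow (norm_nonneg _)]
  have hev := (hlim.2.2).eventually_lt_const (hDle.trans_lt hA3)
  obtain ⟨N, hN⟩ := eventually_atTop.1 hev
  set g : ℕ → E2 → E2 := fun n => g₀ (n + N) with hg
  have H : IsvApprox (closedBall x₀ R) g f Df := H₀.comp (φ := fun n => n + N)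
    (strictMono_id.add_const N)
  have hgC : ∀ n, ∫⁻ x in closedBall x₀ R, ‖g n x‖ₑ ≤ C := fun n => hgC₀ _
  have hGc : ∀ n, Continuous (fderiv ℝ (g n)) := fun n => hGc₀ _
  have hgc : ∀ n, Continuous (g n) := fun n => (H.smooth n).continuous
  have hE : ∀ n, ∫⁻ x in closedBall x₀ R, ‖fderiv ℝ (g n) x‖ₑ ^ 2 ≤ ENNReal.ofReal A₁ := by
    intro n
    have h1 := (hN (n + N) (by omega)).le
    have h2 : IntegrableOn (fun x => ‖fderiv ℝ (g n) x‖ ^ 2) (closedBall x₀ R) :=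
      ((hGc n).norm.pow 2).continuousOn.integrableOn_compact (isCompact_closedBall _ _)
    refine le_trans (le_of_eq ?_) (ENNReal.ofReal_le_ofReal h1)
    rw [ofReal_integral_eq_lintegral_ofReal h2 (Eventually.of_forall fun x => by positivity)]
    refine lintegral_congr fun x => ?_
    rw [← ofReal_norm, ENNReal.ofReal_pow (norm_nonneg _)]
  obtain ⟨κ, hκ, hκC⟩ : ∃ κ : ℝ, 0 < κ ∧ ENNReal.ofReal κ * C ≤ ENNReal.ofReal (A - A₁) := by
    refine ⟨(A - A₁) / (C.toReal + 1), div_pos (by linarith) (by positivity), ?_⟩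
    rw [← ENNReal.ofReal_toReal hC, ← ENNReal.ofReal_mul (by
      have : 0 < A - A₁ := by linarith
      positivity), ENNReal.toReal_ofReal (by positivity)]
    refine ENNReal.ofReal_le_ofReal ?_
    rw [div_mul_eq_mul_div, div_le_iff₀ (by positivity)]
    nlinarith [ENNReal.toReal_nonneg (a := C)]
  set F : ℕ → E2 → ℝ≥0∞ := fun n x => ‖fderiv ℝ (g n) x‖ₑ ^ 2 + ENNReal.ofReal κ * ‖g n x‖ₑ with hF
  have hm1 : ∀ n, Measurable (fun x => ‖fderiv ℝ (g n) x‖ₑ ^ 2) := fun n =>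
    (hGc n).measurable.enorm.pow_const 2
  have hm2 : ∀ n, Measurable (fun x => ENNReal.ofReal κ * ‖g n x‖ₑ) := fun n =>
    (hgc n).measurable.enorm.const_mul _
  obtain ⟨t, ht, hfreq⟩ := isv_circ_b x₀ r R hr hrR F (fun n => (hm1 n).add (hm2 n)) A A'
    (by linarith) hA2 (fun n => by
      simp only [hF]
      rw [lintegral_add_left (hm1 n), lintegral_const_mul _ (hgc n).measurable.enorm]
      calc _ ≤ ENNReal.ofReal A₁ + ENNReal.ofReal κ * C := by gcongr; exact hE n; exact hgC n
        _ ≤ ENNReal.ofReal A₁ + ENNReal.ofReal (A - A₁) := by gcongr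
        _ = _ := by rw [← ENNReal.ofReal_add (by linarith) (by linarith)]; congr 1; ring)
  have ht0 : 0 < t := hr.trans ht.1
  set ε₁ := √(2 * π * (A' / L)) with hε₁
  have hε₁ε : ε₁ < ε := by
    rw [hε₁, Real.sqrt_lt' hε, ← mul_div_assoc, div_lt_iff₀ hlog]; exact hA'
  have hA'0 : 0 < A' := by linarith
  have hcθ : Continuous (isvC x₀ t) := (isvC_cont x₀).comp (continuous_const.prodMk continuous_id)
  have hS : ∀ θ, isvC x₀ t θ ∈ sphere x₀ t := fun θ => by
    rw [mem_sphere, dist_eq_norm, isvC_norm, abs_of_pos ht0]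
  have hvolI : volume (Ioo (-π) π) = ENNReal.ofReal (2 * π) := by
    rw [Real.volume_Ioo]; congr 1; ring
  set p₀ := isvC x₀ t 0 with hp₀
  set T := ENNReal.ofReal t with hT
  have hT0 : T ≠ 0 := by simp [hT, ht0]
  have hTt : T ≠ ⊤ := by simp [hT]
  have hosc : ∃ᶠ n in atTop, (∀ p ∈ sphere x₀ t, ‖g n p - g n p₀‖ ≤ ε₁) ∧
      ∫⁻ θ in Ioo (-π) π, F n (isvC x₀ t θ) ≤ ENNReal.ofReal (A' / L) / (T * T) := by
    refine hfreq.mono fun n hn => ⟨fun p hp => ?_, ?_⟩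
    · have h1 := isv_osc (g n) x₀ t ht0 (fun x _ => (H.c1 n).contDiffAt) p p₀ hp (hS 0)
      have h2 := ENNReal.lintegral_mul_le_Lp_mul_Lq (volume.restrict (Ioo (-π) π))
        Real.HolderConjugate.two_two (f := fun θ => ‖fderiv ℝ (g n) (isvC x₀ t θ)‖ₑ)
        (g := fun _ => 1) (((hGc n).comp hcθ).measurable.enorm.aemeasurable) aemeasurable_const
      simp only [Pi.mul_apply, mul_one, ENNReal.one_rpow, lintegral_const,
        Measure.restrict_apply_univ, hvolI, one_mul, ENNReal.rpow_two, one_pow] at h2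
      have h3 : ∫⁻ θ in Ioo (-π) π, ‖fderiv ℝ (g n) (isvC x₀ t θ)‖ₑ ^ 2 ≤
        ∫⁻ θ in Ioo (-π) π, F n (isvC x₀ t θ) := lintegral_mono fun θ => le_self_add
      have h4 : ‖g n p - g n p₀‖ₑ ^ 2 ≤ ENNReal.ofReal (2 * π * (A' / L)) := by
        have hsq : ∀ a : ℝ≥0∞, (a ^ (1/2 : ℝ)) ^ 2 = a := fun a => by
          rw [← ENNReal.rpow_natCast, ← ENNReal.rpow_mul]; norm_num
        calc ‖g n p - g n p₀‖ₑ ^ 2 ≤ (T * ((∫⁻ θ in Ioo (-π) π, F n (isvC x₀ t θ)) ^ (1/2:ℝ)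
              * (ENNReal.ofReal (2 * π)) ^ (1/2:ℝ))) ^ 2 := by
              gcongr
              refine h1.trans ?_
              gcongr
              refine h2.trans ?_
              gcongr
          _ = ENNReal.ofReal (2 * π) * (T * (T * ∫⁻ θ in Ioo (-π) π, F n (isvC x₀ t θ))) := by
              rw [mul_pow, mul_pow, hsq, hsq]; ring
          _ ≤ ENNReal.ofReal (2 * π) * ENNReal.ofReal (A' / L) := by gcongr
          _ = _ := by rw [← ENNReal.ofReal_mul (by positivity)]
      rw [← ofReal_norm, ← ENNReal.ofReal_pow (norm_nonneg _),
        ENNReal.ofReal_le_ofReal_iff (by positivity)] at h4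
      exact Real.le_sqrt_of_sq_le h4
    · rw [ENNReal.le_div_iff_mul_le (Or.inl (mul_ne_zero hT0 hT0))
        (Or.inl (ENNReal.mul_ne_top hTt hTt)), mul_comm, mul_assoc]
      exact hn.le
  obtain ⟨φ, hφ, hφn⟩ := extraction_of_frequently_atTop hosc
  have hbd : ∃ B : ℝ, ∀ n, g (φ n) p₀ ∈ closedBall (0:E2) B := by
    set V := ENNReal.ofReal (2 * π) with hV
    set W := ENNReal.ofReal (A' / L) / (T * T) + ENNReal.ofReal κ * (ENNReal.ofReal ε₁ * V) with hW
    have hWt : W ≠ ⊤ := by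
      refine ENNReal.add_ne_top.2 ⟨ENNReal.div_ne_top (by simp) (mul_ne_zero hT0 hT0), ?_⟩
      exact ENNReal.mul_ne_top (by simp) (ENNReal.mul_ne_top (by simp) ENNReal.ofReal_ne_top)
    have hκV : ENNReal.ofReal κ * V ≠ 0 := mul_ne_zero (by simp [hκ]) (by simp [hV, hpi])
    have hκVt : ENNReal.ofReal κ * V ≠ ⊤ := ENNReal.mul_ne_top (by simp) ENNReal.ofReal_ne_top
    refine ⟨(W / (ENNReal.ofReal κ * V)).toReal, fun n => ?_⟩
    rw [mem_closedBall_zero_iff]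
    have h1 : ‖g (φ n) p₀‖ₑ * (ENNReal.ofReal κ * V) ≤ W := by
      calc ‖g (φ n) p₀‖ₑ * (ENNReal.ofReal κ * V)
          = ∫⁻ θ in Ioo (-π) π, ENNReal.ofReal κ * ‖g (φ n) p₀‖ₑ := by
            rw [lintegral_const, Measure.restrict_apply_univ, hvolI]; ring
        _ ≤ ∫⁻ θ in Ioo (-π) π, (F (φ n) (isvC x₀ t θ) + ENNReal.ofReal κ * ENNReal.ofReal ε₁) := by
            refine lintegral_mono fun θ => ?_
            have h2 := (hφn n).1 _ (hS θ)
            have h3 : ‖g (φ n) p₀‖ₑ ≤ ‖g (φ n) (isvC x₀ t θ)‖ₑ + ENNReal.ofReal ε₁ := by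
              rw [← ofReal_norm, ← ofReal_norm, ← ENNReal.ofReal_add (norm_nonneg _)
                (Real.sqrt_nonneg _)]
              refine ENNReal.ofReal_le_ofReal ?_
              have := norm_sub_norm_le (g (φ n) p₀) (g (φ n) (isvC x₀ t θ))
              rw [norm_sub_rev] at this
              linarith
            calc ENNReal.ofReal κ * ‖g (φ n) p₀‖ₑ
                ≤ ENNReal.ofReal κ * (‖g (φ n) (isvC x₀ t θ)‖ₑ + ENNReal.ofReal ε₁) := by gcongr
              _ ≤ _ := by
                rw [mul_add]
                gcongr
                exact le_add_self
        _ = (∫⁻ θ in Ioo (-π) π, F (φ n) (isvC x₀ t θ)) +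
              ENNReal.ofReal κ * (ENNReal.ofReal ε₁ * V) := by
            rw [lintegral_add_right _ measurable_const, lintegral_const,
              Measure.restrict_apply_univ, hvolI, mul_assoc]
        _ ≤ W := by
            rw [hW]; gcongr; exact (hφn n).2
    have h2 : ‖g (φ n) p₀‖ₑ ≤ W / (ENNReal.ofReal κ * V) :=
      (ENNReal.le_div_iff_mul_le (Or.inl hκV) (Or.inl hκVt)).2 h1
    rw [← toReal_enorm]
    exact ENNReal.toReal_mono (ENNReal.div_ne_top hWt hκV) h2
  obtain ⟨B, hB⟩ := hbd
  obtain ⟨c, -, ψ, hψ, hlimc⟩ := tendsto_subseq_of_bounded isBounded_closedBall hB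
  refine ⟨c, ?_⟩
  have H2 : IsvApprox (ball x₀ t) (fun n => g (φ (ψ n))) f Df :=
    ((H.comp hφ).comp hψ).mono ((ball_subset_ball ht.2.le).trans ball_subset_closedBall)
  have hev2 : ∀ᶠ n in atTop, ‖g (φ (ψ n)) p₀ - c‖ < ε - ε₁ := by
    have := (tendsto_iff_norm_sub_tendsto_zero.1 hlimc).eventually_lt_const (sub_pos.2 hε₁ε)
    exact this
  have hbt : ball x₀ t ⊆ Ω := ((ball_subset_ball ht.2.le).trans ball_subset_closedBall).trans hR
  have hfin := isv_mp2 ht0 H2 (ae_mono (Measure.restrict_mono hbt le_rfl) hFD) c ε (by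
    refine Eventually.frequently ?_
    filter_upwards [hev2] with n hn x hx
    have h1 := (hφn (ψ n)).1 x hx
    calc _ = ‖(g (φ (ψ n)) x - g (φ (ψ n)) p₀) + (g (φ (ψ n)) p₀ - c)‖ := by congr 1; abel
      _ ≤ _ := norm_add_le _ _
      _ < ε := by linarith)
  exact ae_mono (Measure.restrict_mono (ball_subset_ball ht.1.le) le_rfl) hfin


open Filter Metric in
lemma isv_ae_closed {U : Set E2} (hU : IsOpen U) {f : E2 → E2} (hf : ContinuousOn f U)
    {D : Set E2} (hD : IsClosed D) (h : ∀ᵐ x ∂(volume.restrict U), f x ∈ D) :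
    ∀ x ∈ U, f x ∈ D := by
  have ho : IsOpen (U ∩ f ⁻¹' Dᶜ) := hf.isOpen_inter_preimage hU hD.isOpen_compl
  have h0 : volume (U ∩ f ⁻¹' Dᶜ) = 0 := by
    rw [ae_restrict_iff' hU.measurableSet, ae_iff] at h
    convert h using 2
    ext x; simp
  rw [ho.measure_eq_zero_iff volume] at h0
  intro x hx
  by_contra hc
  have : x ∈ U ∩ f ⁻¹' Dᶜ := ⟨hx, hc⟩
  rw [h0] at this
  exact this

open Filter Metric in
lemma isv_const {Ω : Set E2} (hΩ : IsOpen Ω) {f Df} (hf : MemW12loc Ω f Df)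
    (hFD : ∀ᵐ x ∂(volume.restrict Ω), isvFD (Df x)) (hc : ContinuousOn f Ω)
    {x₀ : E2} {R : ℝ} (hR0 : 0 < R) (hR : closedBall x₀ R ⊆ Ω)
    (h0 : ∀ᵐ x ∂(volume.restrict (closedBall x₀ R)), Df x = 0) :
    ∀ x ∈ ball x₀ (R / 2), f x = f x₀ := by
  have hsub : ball x₀ (R / 2) ⊆ Ω := ((ball_subset_ball (by linarith)).trans
    ball_subset_closedBall).trans hR
  intro x hx
  refine eq_of_forall_dist_le fun ε hε => ?_
  obtain ⟨c, hcc⟩ := isv_ke hΩ hf hFD (x₀ := x₀) (r := R / 2) (R := R) (A₀ := 0) (ε := ε / 4)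
    (by positivity) (by linarith) hR (by positivity) le_rfl (by
      rw [ENNReal.ofReal_zero, nonpos_iff_eq_zero]
      rw [lintegral_congr_ae (g := fun _ => 0)]
      · simp
      · filter_upwards [h0] with x hx; rw [hx, ← ofReal_norm, norm_zero]; simp) (by
      rw [mul_zero]
      have : 0 < Real.log (R / (R / 2)) := Real.log_pos (by
        rw [lt_div_iff₀ (by positivity)]; linarith)
      positivity)
  have := isv_ae_closed isOpen_ball (hc.mono hsub) (isClosed_closedBall (x := c) (ε := ε / 2))
    (by filter_upwards [hcc] with x hx
        rw [mem_closedBall, dist_eq_norm]; linarith)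
  have h1 := this x hx
  have h2 := this x₀ (mem_ball_self (by positivity))
  rw [mem_closedBall] at h1 h2
  have := dist_triangle_right (f x) (f x₀) c
  linarith

open Filter Metric in
lemma isv_small {Ω : Set E2} (hΩ : IsOpen Ω) {f Df} (hf : MemW12loc Ω f Df)
    (hFD : ∀ᵐ x ∂(volume.restrict Ω), isvFD (Df x)) {x₀ : E2} (hx : x₀ ∈ Ω) {ε : ℝ} (hε : 0 < ε) :
    ∃ r > 0, ball x₀ r ⊆ Ω ∧ ∃ c, ∀ᵐ x ∂(volume.restrict (ball x₀ r)), ‖f x - c‖ ≤ ε := by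
  obtain ⟨R, hR0, hR⟩ := nhds_basis_closedBall.mem_iff.1 (hΩ.mem_nhds hx)
  set A := (∫⁻ x in closedBall x₀ R, ‖Df x‖ₑ ^ 2).toReal with hA
  have hfin : ∫⁻ x in closedBall x₀ R, ‖Df x‖ₑ ^ 2 ≠ ⊤ := by
    obtain ⟨g, H, -⟩ := isv_approx' hΩ hf hR0.le hR
    exact H.fin.ne
  set q := 2 * π * A / (ε / 2) ^ 2 + 1 with hq
  have hA0 : 0 ≤ A := ENNReal.toReal_nonneg
  have hpi := Real.pi_pos
  have hq1 : 0 < q := by positivity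
  have hr : R * Real.exp (-q) < R := by
    have := Real.exp_lt_one_iff.2 (neg_lt_zero.2 hq1)
    nlinarith
  refine ⟨R * Real.exp (-q), by positivity, ((ball_subset_ball hr.le).trans
    ball_subset_closedBall).trans hR, ?_⟩
  obtain ⟨c, hc⟩ := isv_ke hΩ hf hFD (x₀ := x₀) (r := R * Real.exp (-q)) (R := R) (A₀ := A)
    (ε := ε / 2) (by positivity) hr hR (by positivity) hA0
    (by rw [hA, ENNReal.ofReal_toReal hfin]) (by
      have : R / (R * Real.exp (-q)) = Real.exp q := by
        rw [Real.exp_neg]; field_simp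
      rw [this, Real.log_exp, hq]
      field_simp
      nlinarith [sq_pos_of_pos hε])
  exact ⟨c, by filter_upwards [hc] with x hx; linarith⟩

open Filter Metric in
theorem isv_cont {Ω : Set E2} (hΩ : IsOpen Ω) {f Df} (hf : MemW12loc Ω f Df)
    (hFD : ∀ᵐ x ∂(volume.restrict Ω), isvFD (Df x)) :
    ∃ ft : E2 → E2, ContinuousOn ft Ω ∧ (∀ᵐ x ∂(volume.restrict Ω), ft x = f x) ∧
      MemW12loc Ω ft Df := by
  have h1 : ∀ k : ℕ, ∃ T : Set E2, T ⊆ Ω ∧ T.Countable ∧ ∃ r : E2 → ℝ, ∃ c : E2 → E2,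
      Ω ⊆ ⋃ x ∈ T, ball x (r x) ∧ ∀ x ∈ T, ∀ᵐ z ∂(volume : Measure E2),
        z ∈ ball x (r x) → ‖f z - c x‖ ≤ 1 / (k + 1 : ℝ) := by
    intro k
    have : ∀ x : E2, ∃ r : ℝ, ∃ c : E2, x ∈ Ω → 0 < r ∧ ∀ᵐ z ∂(volume : Measure E2),
        z ∈ ball x r → ‖f z - c‖ ≤ 1 / (k + 1 : ℝ) := by
      intro x
      by_cases hx : x ∈ Ω
      · obtain ⟨r, hr, -, c, hc⟩ := isv_small hΩ hf hFD hx (ε := 1 / (k + 1 : ℝ)) (by positivity)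
        rw [ae_restrict_iff' measurableSet_ball] at hc
        exact ⟨r, c, fun _ => ⟨hr, hc⟩⟩
      · exact ⟨0, 0, fun h => absurd h hx⟩
    choose r c hrc using this
    obtain ⟨T, hT1, hT2, hT3⟩ := TopologicalSpace.countable_cover_nhdsWithin
      (f := fun x => ball x (r x)) (s := Ω)
      (fun x hx => mem_nhdsWithin_of_mem_nhds (ball_mem_nhds x (hrc x hx).1))
    exact ⟨T, hT1, hT2, r, c, hT3, fun x hx => (hrc x (hT1 hx)).2⟩
  choose T hTΩ hTc r c hcov hae using h1
  have hall : ∀ᵐ z ∂(volume : Measure E2), ∀ k, ∀ x ∈ T k, z ∈ ball x (r k x) →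
      ‖f z - c k x‖ ≤ 1 / (k + 1 : ℝ) :=
    ae_all_iff.2 fun k => (ae_ball_iff (hTc k)).2 (hae k)
  set G := {z | ∀ k, ∀ x ∈ T k, z ∈ ball x (r k x) → ‖f z - c k x‖ ≤ 1 / (k + 1 : ℝ)} with hG
  have hGd : Dense G := Measure.dense_of_ae hall
  have hnb : ∀ x, NeBot (𝓝[G] x) := fun x => mem_closure_iff_nhdsWithin_neBot.1 (hGd x)
  have hosc : ∀ x ∈ Ω, ∀ ε > 0, ∃ U ∈ 𝓝 x, ∀ y ∈ U ∩ G, ∀ z ∈ U ∩ G, dist (f y) (f z) < ε := by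
    intro x hx ε hε
    obtain ⟨k, hk⟩ := exists_nat_one_div_lt (show 0 < ε / 2 by positivity)
    obtain ⟨a, haT, hxa⟩ := mem_iUnion₂.1 (hcov k hx)
    refine ⟨ball a (r k a), isOpen_ball.mem_nhds hxa, fun y hy z hz => ?_⟩
    have e1 := hy.2 k a haT hy.1
    have e2 := hz.2 k a haT hz.1
    have := dist_triangle_right (f y) (f z) (c k a)
    rw [dist_eq_norm (f y) (c k a), dist_eq_norm (f z) (c k a)] at this
    linarith
  have hlim : ∀ x ∈ Ω, ∃ y, Tendsto f (𝓝[G] x) (𝓝 y) := by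
    intro x hx
    have := hnb x
    have hca : Cauchy (map f (𝓝[G] x)) := by
      rw [Metric.cauchy_iff]
      refine ⟨inferInstance, fun ε hε => ?_⟩
      obtain ⟨U, hU, hUG⟩ := hosc x hx ε hε
      refine ⟨f '' (U ∩ G), image_mem_map (inter_mem (mem_nhdsWithin_of_mem_nhds hU)
        self_mem_nhdsWithin), ?_⟩
      rintro _ ⟨y, hy, rfl⟩ _ ⟨z, hz, rfl⟩
      exact hUG y hy z hz
    exact CompleteSpace.complete hca
  have hcont : ContinuousOn (extendFrom G f) Ω := continuousOn_extendFrom (fun x _ => hGd x) hlim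
  have heq : ∀ x ∈ Ω, x ∈ G → extendFrom G f x = f x := by
    intro x hx hxG
    refine extendFrom_eq (hGd x) ?_
    rw [Metric.tendsto_nhds]
    intro ε hε
    obtain ⟨U, hU, hUG⟩ := hosc x hx ε hε
    filter_upwards [mem_nhdsWithin_of_mem_nhds hU, self_mem_nhdsWithin] with z hz hz2
    exact hUG z ⟨hz, hz2⟩ x ⟨mem_of_mem_nhds hU, hxG⟩
  have haeq : ∀ᵐ x ∂(volume.restrict Ω), extendFrom G f x = f x := by
    filter_upwards [ae_restrict_mem hΩ.measurableSet, ae_restrict_of_ae hall] with x hx hx2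
    exact heq x hx hx2
  refine ⟨extendFrom G f, hcont, haeq, hcont.locallyIntegrableOn hΩ.measurableSet, hf.2.1,
    hf.2.2.1, ?_⟩
  intro φ h1 h2 h3 i
  rw [← hf.2.2.2 φ h1 h2 h3 i]
  refine integral_congr_ae ?_
  filter_upwards [haeq] with x hx
  rw [hx]


lemma isv_Q_le (w : E2) (d : E2 →L[ℝ] ℝ) (L : E2 →L[ℝ] E2) :
    |isvQ w d L| ≤ 4 * ‖w‖ * ‖d‖ * ‖L‖ := by
  have hw : ∀ i, |w i| ≤ ‖w‖ := fun i => by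
    have := PiLp.norm_apply_le w i
    rwa [Real.norm_eq_abs] at this
  have hd : ∀ i, |d (isvE i)| ≤ ‖d‖ := fun i => by
    have := d.le_opNorm (isvE i)
    simpa [isvE] using this
  have hp : ∀ i j k l, |w i * (d (isvE j) * (L (isvE k)) l)| ≤ ‖w‖ * (‖d‖ * ‖L‖) := by
    intro i j k l
    rw [abs_mul, abs_mul]
    exact mul_le_mul (hw i) (mul_le_mul (hd j) (isv_entry_le L k l) (abs_nonneg _) (norm_nonneg _))
      (by positivity) (norm_nonneg _)
  have h1 := abs_le.1 (hp 0 0 1 1)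
  have h2 := abs_le.1 (hp 0 1 0 1)
  have h3 := abs_le.1 (hp 1 1 0 0)
  have h4 := abs_le.1 (hp 1 0 1 0)
  unfold isvQ
  rw [abs_le]
  constructor <;> nlinarith [h1.1, h1.2, h2.1, h2.2, h3.1, h3.2, h4.1, h4.2]

lemma isv_Q_cont : Continuous (fun p : E2 × (E2 →L[ℝ] ℝ) × (E2 →L[ℝ] E2) =>
    isvQ p.1 p.2.1 p.2.2) := by
  have hw : ∀ i, Continuous (fun p : E2 × (E2 →L[ℝ] ℝ) × (E2 →L[ℝ] E2) => p.1 i) := fun i =>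
    (EuclideanSpace.proj (𝕜 := ℝ) i).continuous.comp continuous_fst
  have hd : ∀ i, Continuous (fun p : E2 × (E2 →L[ℝ] ℝ) × (E2 →L[ℝ] E2) => p.2.1 (isvE i)) :=
    fun i => (continuous_eval_const (isvE i)).comp (continuous_fst.comp continuous_snd)
  have hL : ∀ i j, Continuous (fun p : E2 × (E2 →L[ℝ] ℝ) × (E2 →L[ℝ] E2) => (p.2.2 (isvE i)) j) :=
    fun i j => (EuclideanSpace.proj (𝕜 := ℝ) j).continuous.comp
      ((continuous_eval_const (isvE i)).comp (continuous_snd.comp continuous_snd))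
  unfold isvQ
  exact ((hw 0).mul (((hd 0).mul (hL 1 1)).sub ((hd 1).mul (hL 0 1)))).add
    ((hw 1).mul (((hL 0 0).mul (hd 1)).sub ((hL 1 0).mul (hd 0))))

open Filter Metric in
lemma isv_unif_maps {T : Set E2} {g : ℕ → E2 → E2} {f : E2 → E2}
    (hu : TendstoUniformlyOn g f atTop T) {D V : Set E2} (hD : IsCompact D) (hV : IsOpen V)
    (hDV : D ⊆ V) (hfD : MapsTo f T D) :
    ∃ D', IsCompact D' ∧ D' ⊆ V ∧ D ⊆ D' ∧ ∃ N, ∀ n ≥ N, MapsTo (g n) T D' := by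
  obtain ⟨δ, hδ, hδV⟩ := hD.exists_cthickening_subset_open hV hDV
  refine ⟨cthickening δ D, hD.cthickening, hδV, self_subset_cthickening _, ?_⟩
  rw [Metric.tendstoUniformlyOn_iff] at hu
  obtain ⟨N, hN⟩ := eventually_atTop.1 (hu δ hδ)
  exact ⟨N, fun n hn x hx => mem_cthickening_of_dist_le _ _ _ _ (hfD hx)
    (by rw [dist_comm]; exact (hN n hn x hx).le)⟩

open Filter Metric in
lemma isv_lim_master {x₀ : E2} {R : ℝ} {g f Df} (H : IsvApprox (closedBall x₀ R) g f Df)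
    (hu : TendstoUniformlyOn g f atTop (closedBall x₀ R)) {ζ : E2 → ℝ} (hζ : ContDiff ℝ 1 ζ)
    (hζs : tsupport ζ ⊆ closedBall x₀ R) {X : E2 → E2} {V D : Set E2} (hV : IsOpen V)
    (hX : ContDiffOn ℝ 1 X V) (hD : IsCompact D) (hDV : D ⊆ V)
    (hfD : MapsTo f (closedBall x₀ R) D) :
    IntegrableOn (fun x => ζ x * isvDiv X (f x) * (Df x).det
      + isvQ (X (f x)) (fderiv ℝ ζ x) (Df x)) (closedBall x₀ R) ∧
    ∫ x in closedBall x₀ R, (ζ x * isvDiv X (f x) * (Df x).det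
      + isvQ (X (f x)) (fderiv ℝ ζ x) (Df x)) = 0 := by
  obtain ⟨D', hD', hD'V, hDD', N, hN⟩ := isv_unif_maps hu hD hV hDV hfD
  have hζc : HasCompactSupport ζ := (isCompact_closedBall x₀ R).of_isClosed_subset
    (isClosed_tsupport ζ) hζs
  have H2 := H.comp (φ := fun n => n + N) (strictMono_id.add_const N)
  have hm : ∀ n, MapsTo (g (n + N)) (closedBall x₀ R) D' := fun n => hN _ (by omega)
  have hfc : ContinuousOn (fderiv ℝ X) V := hX.continuousOn_fderiv_of_isOpen hV le_rfl
  have hdc : ContinuousOn (isvDiv X) V := by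
    unfold isvDiv; fun_prop
  have hζdc : Continuous (fderiv ℝ ζ) := hζ.continuous_fderiv one_ne_zero
  obtain ⟨M1, hM1⟩ := hD'.exists_bound_of_continuousOn (hdc.mono hD'V)
  obtain ⟨M2, hM2⟩ := hD'.exists_bound_of_continuousOn (hX.continuousOn.mono hD'V)
  obtain ⟨Z1, hZ1⟩ := hζ.continuous.bounded_above_of_compact_support hζc
  obtain ⟨Z2, hZ2⟩ := hζdc.bounded_above_of_compact_support (hζc.fderiv ℝ)
  have hZ10 : 0 ≤ Z1 := (norm_nonneg _).trans (hZ1 0)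
  have hZ20 : 0 ≤ Z2 := (norm_nonneg _).trans (hZ2 0)
  have hmem := ae_restrict_mem (μ := volume) (isClosed_closedBall (x := x₀) (ε := R)).measurableSet
  have hl := isv_lim (isCompact_closedBall x₀ R).measure_lt_top.ne H2
    (P := fun n x => ζ x * isvDiv X (g (n + N) x) * (fderiv ℝ (g (n + N)) x).det
      + isvQ (X (g (n + N) x)) (fderiv ℝ ζ x) (fderiv ℝ (g (n + N)) x))
    (Q := fun x => ζ x * isvDiv X (f x) * (Df x).det
      + isvQ (X (f x)) (fderiv ℝ ζ x) (Df x))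
    (fun n => by
      refine ContinuousOn.aestronglyMeasurable ?_ isClosed_closedBall.measurableSet
      have h1 : ContinuousOn (fun x => isvDiv X (g (n + N) x)) (closedBall x₀ R) :=
        hdc.comp (H2.smooth n).continuous.continuousOn ((hm n).mono_right hD'V)
      have h2 : ContinuousOn (fun x => X (g (n + N) x)) (closedBall x₀ R) :=
        hX.continuousOn.comp (H2.smooth n).continuous.continuousOn ((hm n).mono_right hD'V)
      have h3 : Continuous (fderiv ℝ (g (n + N))) := (H2.c1 n).continuous_fderiv one_ne_zero
      have h4 := isv_det_cont.comp h3
      have h5 := hζ.continuous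
      refine ((h5.continuousOn.mul h1).mul h4.continuousOn).add ?_
      exact isv_Q_cont.comp_continuousOn
        (h2.prodMk (hζdc.continuousOn.prodMk h3.continuousOn)))
    (by
      filter_upwards [hmem, H2.ae, H2.aeD] with x hx h1 h2
      have hfx : f x ∈ V := hDV (hfD hx)
      have e1 : Tendsto (fun n => isvDiv X (g (n + N) x)) atTop (𝓝 (isvDiv X (f x))) :=
        (hdc.continuousAt (hV.mem_nhds hfx)).tendsto.comp h1
      have e2 : Tendsto (fun n => X (g (n + N) x)) atTop (𝓝 (X (f x))) :=
        (hX.continuousOn.continuousAt (hV.mem_nhds hfx)).tendsto.comp h1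
      have e3 := (isv_det_cont.tendsto _).comp h2
      exact ((e1.const_mul (ζ x)).mul e3).add ((isv_Q_cont.tendsto (X (f x), fderiv ℝ ζ x, Df x)).comp
        (e2.prodMk_nhds (tendsto_const_nhds.prodMk_nhds h2))))
    (2 * Z1 * M1 + 4 * M2 * Z2)
    (fun n => by
      filter_upwards [hmem] with x hx
      have b1 := hM1 _ (hm n hx)
      have b2 := hM2 _ (hm n hx)
      have b3 := hZ1 x
      have b4 := hZ2 x
      have b5 := isv_det_le (fderiv ℝ (g (n + N)) x)
      have b6 := isv_Q_le (X (g (n + N) x)) (fderiv ℝ ζ x) (fderiv ℝ (g (n + N)) x)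
      set q := ‖fderiv ℝ (g (n + N)) x‖
      have hq0 : 0 ≤ q := norm_nonneg _
      have c1 : |ζ x * isvDiv X (g (n + N) x) * (fderiv ℝ (g (n + N)) x).det| ≤
          Z1 * M1 * (2 * q ^ 2) := by
        rw [abs_mul, abs_mul]
        refine mul_le_mul (mul_le_mul b3 b1 (abs_nonneg _) hZ10) b5 (abs_nonneg _) ?_
        exact mul_nonneg hZ10 ((norm_nonneg _).trans b1)
      have hM20 : 0 ≤ M2 := (norm_nonneg _).trans b2
      have hM10 : 0 ≤ M1 := (norm_nonneg _).trans b1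
      have c2 : |isvQ (X (g (n + N) x)) (fderiv ℝ ζ x) (fderiv ℝ (g (n + N)) x)| ≤
          4 * M2 * Z2 * q := by
        refine b6.trans ?_
        gcongr
      refine (abs_add_le _ _).trans ((add_le_add c1 c2).trans ?_)
      have hq1 : q ≤ 1 + q ^ 2 := by nlinarith [sq_nonneg (q - 1)]
      have d1 : 0 ≤ Z1 * M1 := by positivity
      have d2 : 4 * M2 * Z2 * q ≤ 4 * M2 * Z2 * (1 + q ^ 2) := by gcongr
      nlinarith)
  refine ⟨hl.2.1, tendsto_nhds_unique hl.2.2 ?_⟩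
  refine tendsto_const_nhds.congr fun n => ?_
  have hz := isv_master (g (n + N)) (H2.c2 n) ζ hζ hζc X (fun x hx =>
    hX.contDiffAt (hV.mem_nhds (hD'V (hm n (hζs hx)))))
  rw [← hz]
  refine (setIntegral_eq_integral_of_forall_compl_eq_zero fun x hx => ?_).symm
  have hx2 : x ∉ tsupport ζ := fun h => hx (hζs h)
  have e1 : ζ x = 0 := image_eq_zero_of_notMem_tsupport hx2
  have e2 : fderiv ℝ ζ x = 0 := by
    have : x ∉ tsupport (fderiv ℝ ζ) := fun h => hx2 (tsupport_fderiv_subset ℝ h)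
    exact image_eq_zero_of_notMem_tsupport this
  simp [e1, e2, isvQ]


def isvs (y : E2) (ε : ℝ) (w : E2) : ℝ := ‖w - y‖ ^ 2 + ε
def isvm (y : E2) (ε : ℝ) (w : E2) : ℝ := (Real.sqrt (isvs y ε w) * (-Real.log (isvs y ε w)))⁻¹
def isvX (y : E2) (ε : ℝ) (w : E2) : E2 :=
  (isvs y ε w * (-Real.log (isvs y ε w)))⁻¹ • (w - y)

lemma isvs_pos {y : E2} {ε : ℝ} (hε : 0 < ε) (w : E2) : 0 < isvs y ε w := by
  unfold isvs; positivity

lemma isv_log_bd {s : ℝ} (h0 : 0 < s) (h : s < 27 / 100) : 1 < -Real.log s := by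
  have : Real.log s < -1 := by
    rw [Real.log_lt_iff_lt_exp h0, Real.exp_neg]
    refine h.trans ?_
    have := Real.exp_one_lt_d9
    rw [lt_inv_comm₀ (by norm_num) (Real.exp_pos 1)]
    linarith
  linarith

open Metric in
lemma isvs_lt {y : E2} {ε : ℝ} (hε : ε ≤ 1 / 100) {w : E2} (hw : w ∈ ball y (1 / 2)) :
    isvs y ε w < 27 / 100 := by
  rw [mem_ball, dist_eq_norm] at hw
  unfold isvs
  nlinarith [norm_nonneg (w - y)]

lemma isvs_fderiv (y : E2) (ε : ℝ) (w : E2) :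
    HasFDerivAt (isvs y ε) (2 • innerSL ℝ (w - y)) w := by
  have h1 : HasFDerivAt (fun w : E2 => w - y) (ContinuousLinearMap.id ℝ E2) w :=
    (hasFDerivAt_id w).sub_const y
  exact h1.norm_sq.add_const ε

lemma isvs_contDiff (y : E2) (ε : ℝ) : ContDiff ℝ 1 (isvs y ε) := by
  unfold isvs
  exact ((contDiff_id.sub contDiff_const).norm_sq ℝ).add contDiff_const

open Metric in
lemma isvX_contDiffOn {y : E2} {ε : ℝ} (hε0 : 0 < ε) (hε : ε ≤ 1 / 100) :
    ContDiffOn ℝ 1 (isvX y ε) (ball y (1 / 2)) := by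
  unfold isvX
  have hs := (isvs_contDiff y ε).contDiffOn (s := ball y (1 / 2))
  refine ContDiffOn.smul (ContDiffOn.inv (hs.mul (hs.log ?_).neg) ?_)
    (contDiff_id.sub contDiff_const).contDiffOn
  · intro w _; exact (isvs_pos hε0 w).ne'
  · intro w hw
    have := isv_log_bd (isvs_pos hε0 w) (isvs_lt hε hw)
    have := isvs_pos (y := y) hε0 w
    positivity

open Metric in
lemma isvm_contOn {y : E2} {ε : ℝ} (hε0 : 0 < ε) (hε : ε ≤ 1 / 100) :
    ContinuousOn (isvm y ε) (ball y (1 / 2)) := by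
  unfold isvm
  have hs := (isvs_contDiff y ε).continuous.continuousOn (s := ball y (1 / 2))
  refine ContinuousOn.inv₀ (hs.sqrt.mul (hs.log ?_).neg) ?_
  · intro w _; exact (isvs_pos hε0 w).ne'
  · intro w hw
    have := isv_log_bd (isvs_pos hε0 w) (isvs_lt hε hw)
    have := isvs_pos (y := y) hε0 w
    positivity

open Metric in
lemma isvm_pos {y : E2} {ε : ℝ} (hε0 : 0 < ε) (hε : ε ≤ 1 / 100) {w : E2}
    (hw : w ∈ ball y (1 / 2)) : 0 < isvm y ε w := by
  unfold isvm
  have := isv_log_bd (isvs_pos hε0 w) (isvs_lt hε hw)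
  have := isvs_pos (y := y) hε0 w
  positivity

lemma isv_norm_le_sqrt {y : E2} {ε : ℝ} (hε0 : 0 < ε) (w : E2) :
    ‖w - y‖ ≤ Real.sqrt (isvs y ε w) := by
  apply Real.le_sqrt_of_sq_le
  unfold isvs; linarith

open Metric in
lemma isvX_norm {y : E2} {ε : ℝ} (hε0 : 0 < ε) (hε : ε ≤ 1 / 100) {w : E2}
    (hw : w ∈ ball y (1 / 2)) : ‖isvX y ε w‖ ≤ isvm y ε w := by
  have h1 := isv_log_bd (isvs_pos hε0 w) (isvs_lt hε hw)
  have h2 := isvs_pos (y := y) hε0 w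
  have h3 := isv_norm_le_sqrt (y := y) hε0 w
  unfold isvX isvm
  set s := isvs y ε w
  set l := -Real.log s
  have hsq : Real.sqrt s * Real.sqrt s = s := Real.mul_self_sqrt h2.le
  have hr : 0 < Real.sqrt s := Real.sqrt_pos.2 h2
  rw [norm_smul, Real.norm_eq_abs, abs_of_pos (by positivity)]
  calc (s * l)⁻¹ * ‖w - y‖ ≤ (s * l)⁻¹ * Real.sqrt s := by gcongr
    _ = (Real.sqrt s * l)⁻¹ := by
      nth_rewrite 1 [← hsq]
      field_simp

open Metric in
lemma isvX_div {y : E2} {ε : ℝ} (hε0 : 0 < ε) (hε : ε ≤ 1 / 100) {w : E2}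
    (hw : w ∈ ball y (1 / 2)) : 2 * isvm y ε w ^ 2 ≤ isvDiv (isvX y ε) w := by
  have h1 := isv_log_bd (isvs_pos hε0 w) (isvs_lt hε hw)
  have h2 := isvs_pos (y := y) hε0 w
  have hd : HasDerivAt (fun s : ℝ => (s * (-Real.log s))⁻¹)
      (-(-Real.log (isvs y ε w) - 1) / (isvs y ε w * (-Real.log (isvs y ε w))) ^ 2)
      (isvs y ε w) := by
    have e1 := ((hasDerivAt_id (isvs y ε w)).mul (Real.hasDerivAt_log h2.ne').neg).inv
      (mul_pos h2 (show 0 < -Real.log (isvs y ε w) by linarith)).ne'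
    refine e1.congr_deriv ?_
    simp
    field_simp
  have hX : HasFDerivAt (isvX y ε) _ w :=
    (hd.comp_hasFDerivAt w (isvs_fderiv y ε w)).smul
      ((hasFDerivAt_id w).sub_const y)
  have hn : ‖w - y‖ ^ 2 = (w - y) 0 ^ 2 + (w - y) 1 ^ 2 := by
    rw [EuclideanSpace.real_norm_sq_eq, Fin.sum_univ_two]
  have hdiv : isvDiv (isvX y ε) w = 2 * (isvs y ε w * (-Real.log (isvs y ε w)))⁻¹ +
      2 * (-(-Real.log (isvs y ε w) - 1) / (isvs y ε w * (-Real.log (isvs y ε w))) ^ 2)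
        * ‖w - y‖ ^ 2 := by
    rw [hn]
    simp only [isvDiv, hX.fderiv]
    simp [isvE, EuclideanSpace.inner_single_right]
    ring
  have hns : ‖w - y‖ ^ 2 = isvs y ε w - ε := by unfold isvs; ring
  rw [hdiv, hns]
  unfold isvm
  set s := isvs y ε w
  set l := -Real.log s
  have hsq : Real.sqrt s ^ 2 = s := Real.sq_sqrt h2.le
  have e1 : 2 * ((Real.sqrt s * l)⁻¹) ^ 2 = 2 * (s * l)⁻¹ + 2 * (-(l - 1) / (s * l) ^ 2) * s := by
    rw [inv_pow, mul_pow, hsq]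
    field_simp
    ring
  rw [e1]
  have : 0 ≤ (l - 1) / (s * l) ^ 2 * ε := by
    have : 0 ≤ l - 1 := by linarith
    positivity
  have e2 : -(l - 1) / (s * l) ^ 2 * (s - ε) = -(l - 1) / (s * l) ^ 2 * s +
    (l - 1) / (s * l) ^ 2 * ε := by ring
  nlinarith

lemma isv_amgm {D J K p z : ℝ} (hK : 1 ≤ K) (h : D ^ 2 ≤ K * J) (hp : 0 ≤ p)
    (hz : 0 ≤ z) : p * D ≤ 2 * p ^ 2 * J - 8 * p * z * D + (16 * z ^ 2 + 1) * K := by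
  have hJ : 0 ≤ J := by
    by_contra hc
    push Not at hc
    nlinarith [sq_nonneg D]
  have h1 : D ≤ Real.sqrt K * Real.sqrt J := by
    rw [← Real.sqrt_mul (by linarith)]
    exact Real.le_sqrt_of_sq_le h
  have hk : Real.sqrt K ^ 2 = K := Real.sq_sqrt (by linarith)
  have hj : Real.sqrt J ^ 2 = J := Real.sq_sqrt hJ
  set k := Real.sqrt K
  set j := Real.sqrt J
  have h2 : p * D * (8 * z + 1) ≤ p * (k * j) * (8 * z + 1) := by gcongr
  rw [← hk, ← hj]
  nlinarith [sq_nonneg (p * j - 4 * z * k), sq_nonneg (p * j - k), sq_nonneg (p * j), sq_nonneg k]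

open Filter Metric in
lemma isv_cacc {x₀ y : E2} {R : ℝ} (hR : 0 < R) {g f Df} (H : IsvApprox (closedBall x₀ R) g f Df)
    (hu : TendstoUniformlyOn g f atTop (closedBall x₀ R))
    (hfD : MapsTo f (closedBall x₀ R) (closedBall y (1 / 4)))
    {K : E2 → ℝ} (hKm : Measurable K) (hK1 : ∀ x, 1 ≤ K x)
    (hKi : ∫⁻ x in closedBall x₀ R, ENNReal.ofReal (K x) < ⊤)
    (hdist : ∀ᵐ x ∂(volume.restrict (closedBall x₀ R)), ‖Df x‖ ^ 2 ≤ K x * (Df x).det) :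
    ∃ A : ℝ≥0∞, A ≠ ⊤ ∧ ∀ ε, 0 < ε → ε ≤ 1 / 100 →
      ∫⁻ x in closedBall x₀ (R / 2), ‖isvm y ε (f x) * ‖Df x‖‖ₑ ≤ A := by
  let η : ContDiffBump x₀ := ⟨R / 2, R, by linarith, by linarith⟩
  have hηc : ContDiff ℝ 1 η := η.contDiff
  obtain ⟨Z, hZ⟩ := (hηc.continuous_fderiv one_ne_zero).bounded_above_of_compact_support
    (η.hasCompactSupport.fderiv ℝ)
  have hZ0 : 0 ≤ Z := (norm_nonneg _).trans (hZ 0)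
  have hKint : IntegrableOn K (closedBall x₀ R) := by
    refine ⟨hKm.aestronglyMeasurable, ?_⟩
    refine lt_of_le_of_lt (le_of_eq ?_) hKi
    refine lintegral_congr fun x => ?_
    rw [← ofReal_norm, Real.norm_eq_abs, abs_of_nonneg (by linarith [hK1 x])]
  refine ⟨ENNReal.ofReal (∫ x in closedBall x₀ R, (16 * Z ^ 2 + 1) * K x), ENNReal.ofReal_ne_top,
    fun ε hε0 hε => ?_⟩
  have hsub : (closedBall y (1 / 4) : Set E2) ⊆ ball y (1 / 2) :=
    closedBall_subset_ball (by norm_num)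
  set ζ : E2 → ℝ := fun x => η x ^ 2 with hζ
  have hζs : tsupport ζ ⊆ closedBall x₀ R := by
    have : tsupport ζ ⊆ tsupport η := by
      refine closure_mono fun x hx hx2 => hx ?_
      simp [hζ, hx2]
    exact this.trans η.tsupport_eq.subset
  obtain ⟨hI, hI0⟩ := isv_lim_master H hu (ζ := ζ) (hηc.pow 2) hζs isOpen_ball
    (isvX_contDiffOn (y := y) hε0 hε) (isCompact_closedBall y (1 / 4)) hsub hfD
  have hζd : ∀ x, fderiv ℝ ζ x = (2 * η x) • fderiv ℝ η x := by
    intro x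
    have := ((hηc.differentiable one_ne_zero x).hasFDerivAt.pow 2).fderiv
    simp only [hζ]
    rw [this]
    simp
  have hpt : ∀ᵐ x ∂(volume.restrict (closedBall x₀ R)), η x * (isvm y ε (f x) * ‖Df x‖) ≤
      (ζ x * isvDiv (isvX y ε) (f x) * (Df x).det
      + isvQ (isvX y ε (f x)) (fderiv ℝ ζ x) (Df x)) + (16 * Z ^ 2 + 1) * K x := by
    filter_upwards [hdist, ae_restrict_mem isClosed_closedBall.measurableSet] with x hx hxm
    have hfx := hsub (hfD hxm)
    have hm0 := isvm_pos hε0 hε hfx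
    have hη0 : 0 ≤ η x := η.nonneg
    have hJ : 0 ≤ (Df x).det := by
      by_contra hc
      push Not at hc
      nlinarith [sq_nonneg ‖Df x‖, hK1 x]
    have a1 := isv_amgm (hK1 x) hx
      (p := η x * isvm y ε (f x)) (by positivity) hZ0
    have a2 : 2 * (η x * isvm y ε (f x)) ^ 2 * (Df x).det ≤
        ζ x * isvDiv (isvX y ε) (f x) * (Df x).det := by
      have := mul_le_mul_of_nonneg_left (isvX_div hε0 hε hfx) (sq_nonneg (η x))
      refine mul_le_mul_of_nonneg_right ?_ hJ
      simp only [hζ]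
      linarith
    have a3 := isv_Q_le (isvX y ε (f x)) (fderiv ℝ ζ x) (Df x)
    rw [hζd, norm_smul, Real.norm_eq_abs, abs_of_nonneg (show 0 ≤ 2 * η x by positivity)] at a3
    have a4 : 4 * ‖isvX y ε (f x)‖ * (2 * η x * ‖fderiv ℝ η x‖) * ‖Df x‖ ≤
        4 * isvm y ε (f x) * (2 * η x * Z) * ‖Df x‖ := by
      have := isvX_norm hε0 hε hfx
      have := hZ x
      gcongr
    have a5 := (abs_le.1 (a3.trans a4)).1
    rw [← hζd] at a5
    nlinarith
  calc ∫⁻ x in closedBall x₀ (R / 2), ‖isvm y ε (f x) * ‖Df x‖‖ₑ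
      ≤ ∫⁻ x in closedBall x₀ (R / 2), ENNReal.ofReal
        ((ζ x * isvDiv (isvX y ε) (f x) * (Df x).det
      + isvQ (isvX y ε (f x)) (fderiv ℝ ζ x) (Df x)) + (16 * Z ^ 2 + 1) * K x) := by
        have hs2 : closedBall x₀ (R / 2) ⊆ closedBall x₀ R := closedBall_subset_closedBall (by linarith)
        refine lintegral_mono_ae ?_
        filter_upwards [ae_mono (Measure.restrict_mono hs2 le_rfl) hpt,
          ae_restrict_mem isClosed_closedBall.measurableSet] with x hx hxm
        have h1 : η x = 1 := η.one_of_mem_closedBall hxm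
        rw [h1, one_mul] at hx
        have hm0 := isvm_pos hε0 hε (hsub (hfD (hs2 hxm)))
        rw [← ofReal_norm, Real.norm_eq_abs, abs_of_nonneg (by positivity)]
        exact ENNReal.ofReal_le_ofReal hx
    _ ≤ ∫⁻ x in closedBall x₀ R, ENNReal.ofReal
        ((ζ x * isvDiv (isvX y ε) (f x) * (Df x).det
      + isvQ (isvX y ε (f x)) (fderiv ℝ ζ x) (Df x)) + (16 * Z ^ 2 + 1) * K x) :=
        lintegral_mono_set (closedBall_subset_closedBall (by linarith))
    _ = _ := by
      rw [← ofReal_integral_eq_lintegral_ofReal]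
      · rw [integral_add hI (hKint.const_mul _), hI0, zero_add]
      · exact hI.add (hKint.const_mul _)
      · filter_upwards [hpt, ae_restrict_mem isClosed_closedBall.measurableSet] with x hx hxm
        have hm0 := isvm_pos hε0 hε (hsub (hfD hxm))
        have hη0 : 0 ≤ η x := η.nonneg
        exact le_trans (by positivity) hx


def isvu (y : E2) (ε : ℝ) (w : E2) : ℝ := Real.log (-Real.log (isvs y ε w))

open Metric in
lemma isvu_contDiffAt {y : E2} {ε : ℝ} (hε0 : 0 < ε) (hε : ε ≤ 1 / 100) {w : E2}
    (hw : w ∈ ball y (1 / 2)) : ContDiffAt ℝ 1 (isvu y ε) w := by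
  unfold isvu
  have h1 := isv_log_bd (isvs_pos hε0 w) (isvs_lt hε hw)
  exact (((isvs_contDiff y ε).contDiffAt.log (isvs_pos hε0 w).ne').neg).log (by linarith)

open Metric in
lemma isvu_fderiv {y : E2} {ε : ℝ} (hε0 : 0 < ε) (hε : ε ≤ 1 / 100) {w : E2}
    (hw : w ∈ ball y (1 / 2)) : ‖fderiv ℝ (isvu y ε) w‖ ≤ 2 * isvm y ε w := by
  have h1 := isv_log_bd (isvs_pos hε0 w) (isvs_lt hε hw)
  have h2 := isvs_pos (y := y) hε0 w
  have h0 : HasFDerivAt (isvs y ε) ((2 : ℝ) • innerSL ℝ (w - y)) w := by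
    have := isvs_fderiv y ε w
    rw [two_nsmul] at this
    rwa [two_smul]
  have h3 : HasFDerivAt (isvu y ε) _ w :=
    (((h0).log h2.ne').neg).log (show -Real.log (isvs y ε w) ≠ 0 by linarith)
  refine le_trans ?_ (mul_le_mul_of_nonneg_left (isvX_norm hε0 hε hw) zero_le_two)
  rw [h3.fderiv, norm_smul, norm_neg, norm_smul, isvX, norm_smul, norm_smul,
    innerSL_apply_norm]
  simp only [norm_inv, norm_mul]
  simp
  apply le_of_eq
  ring

open Filter Metric in
lemma isv_cacc_n {x₀ y : E2} {R : ℝ} (hR : 0 < R) {g f Df} (H : IsvApprox (closedBall x₀ R) g f Df)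
    (hu : TendstoUniformlyOn g f atTop (closedBall x₀ R))
    (hfD : MapsTo f (closedBall x₀ R) (closedBall y (1 / 4))) {A : ℝ≥0∞}
    {ε : ℝ} (hε0 : 0 < ε) (hε : ε ≤ 1 / 100)
    (hAε : ∫⁻ x in closedBall x₀ (R / 2), ‖isvm y ε (f x) * ‖Df x‖‖ₑ ≤ A) :
    ∃ N, ∀ n ≥ N, MapsTo (g n) (closedBall x₀ R) (ball y (1 / 2)) ∧
      ∫⁻ x in closedBall x₀ (R / 2), ‖isvm y ε (g n x) * ‖fderiv ℝ (g n) x‖‖ₑ ≤ A + 1 := by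
  have hsub : (closedBall y (1 / 4) : Set E2) ⊆ ball y (1 / 2) :=
    closedBall_subset_ball (by norm_num)
  obtain ⟨D', hD', hD'V, hDD', N, hN⟩ := isv_unif_maps hu (isCompact_closedBall y (1 / 4))
    isOpen_ball hsub hfD
  have hs2 : closedBall x₀ (R / 2) ⊆ closedBall x₀ R := closedBall_subset_closedBall (by linarith)
  have H2 := (H.comp (φ := fun n => n + N) (strictMono_id.add_const N)).mono hs2
  have hm : ∀ n, MapsTo (g (n + N)) (closedBall x₀ (R / 2)) D' :=
    fun n => (hN _ (by omega)).mono_left hs2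
  have hmc := isvm_contOn (y := y) hε0 hε
  obtain ⟨M, hM⟩ := hD'.exists_bound_of_continuousOn (hmc.mono hD'V)
  have hmem := ae_restrict_mem (μ := volume) (isClosed_closedBall (x := x₀) (ε := R / 2)).measurableSet
  have hl := (isv_lim (isCompact_closedBall x₀ (R / 2)).measure_lt_top.ne H2
    (P := fun n x => isvm y ε (g (n + N) x) * ‖fderiv ℝ (g (n + N)) x‖)
    (Q := fun x => isvm y ε (f x) * ‖Df x‖)
    (fun n => by
      refine ContinuousOn.aestronglyMeasurable ?_ isClosed_closedBall.measurableSet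
      have h1 : ContinuousOn (fun x => isvm y ε (g (n + N) x)) (closedBall x₀ (R / 2)) :=
        hmc.comp (H2.smooth n).continuous.continuousOn ((hm n).mono_right hD'V)
      have h3 : Continuous (fderiv ℝ (g (n + N))) := (H2.c1 n).continuous_fderiv one_ne_zero
      exact h1.mul h3.norm.continuousOn)
    (by
      filter_upwards [hmem, H2.ae, H2.aeD] with x hx h1 h2
      have hfx := hsub (hfD (hs2 hx))
      exact ((hmc.continuousAt (isOpen_ball.mem_nhds hfx)).tendsto.comp h1).mul h2.norm)
    M
    (fun n => by
      filter_upwards [hmem] with x hx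
      have b1 := hM _ (hm n hx)
      rw [abs_mul, abs_norm]
      set q := ‖fderiv ℝ (g (n + N)) x‖
      have hq1 : q ≤ 1 + q ^ 2 := by nlinarith [sq_nonneg (q - 1)]
      exact mul_le_mul b1 hq1 (norm_nonneg _) ((norm_nonneg _).trans b1))).1
  obtain ⟨N2, hN2⟩ := eventually_atTop.1 (hl.eventually_le_const (zero_lt_one))
  refine ⟨N2 + N, fun n hn => ⟨(hN n (by omega)).mono_right hD'V, ?_⟩⟩
  have h1 := hN2 (n - N) (by omega)
  rw [Nat.sub_add_cancel (by omega)] at h1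
  have hms : AEMeasurable (fun x => ‖isvm y ε (g n x) * ‖fderiv ℝ (g n) x‖ -
      isvm y ε (f x) * ‖Df x‖‖ₑ) (volume.restrict (closedBall x₀ (R / 2))) := by
    have e1 : ContinuousOn (fun x => isvm y ε (g n x)) (closedBall x₀ (R / 2)) :=
        hmc.comp (H.smooth n).continuous.continuousOn
          (((hN n (by omega)).mono_right hD'V).mono_left hs2)
    have h3 : Continuous (fderiv ℝ (g n)) := (H.c1 n).continuous_fderiv one_ne_zero
    have e2 := (e1.mul h3.norm.continuousOn).aestronglyMeasurable (μ := volume)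
      isClosed_closedBall.measurableSet
    have e3 : AEMeasurable f (volume.restrict (closedBall x₀ (R / 2))) :=
      aemeasurable_of_tendsto_metrizable_ae' (fun n => (H2.smooth n).continuous.aemeasurable) H2.ae
    have e4 : Measurable (isvm y ε) := by unfold isvm isvs; fun_prop
    have e5 : AEMeasurable (fun x => isvm y ε (f x) * ‖Df x‖)
        (volume.restrict (closedBall x₀ (R / 2))) :=
      (e4.comp_aemeasurable e3).mul H.meas.norm.aemeasurable
    exact (e2.aemeasurable.sub e5).enorm
  calc ∫⁻ x in closedBall x₀ (R / 2), ‖isvm y ε (g n x) * ‖fderiv ℝ (g n) x‖‖ₑ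
      ≤ ∫⁻ x in closedBall x₀ (R / 2), (‖isvm y ε (g n x) * ‖fderiv ℝ (g n) x‖ -
        isvm y ε (f x) * ‖Df x‖‖ₑ + ‖isvm y ε (f x) * ‖Df x‖‖ₑ) := by
        refine lintegral_mono fun x => ?_
        have := enorm_add_le (isvm y ε (g n x) * ‖fderiv ℝ (g n) x‖ - isvm y ε (f x) * ‖Df x‖)
          (isvm y ε (f x) * ‖Df x‖)
        rwa [sub_add_cancel] at this
    _ ≤ A + 1 := by
        rw [lintegral_add_left' hms, add_comm]
        exact add_le_add hAε h1

open Filter Metric in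
theorem isv_dich {x₀ y : E2} {R : ℝ} (hR : 0 < R) {g f Df} (H : IsvApprox (closedBall x₀ R) g f Df)
    (hu : TendstoUniformlyOn g f atTop (closedBall x₀ R))
    (hfD : MapsTo f (closedBall x₀ R) (closedBall y (1 / 4)))
    {K : E2 → ℝ} (hKm : Measurable K) (hK1 : ∀ x, 1 ≤ K x)
    (hKi : ∫⁻ x in closedBall x₀ R, ENNReal.ofReal (K x) < ⊤)
    (hdist : ∀ᵐ x ∂(volume.restrict (closedBall x₀ R)), ‖Df x‖ ^ 2 ≤ K x * (Df x).det) :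
    ∀ᵐ t ∂(volume.restrict (Ioo 0 (R / 2))), ∀ p ∈ sphere x₀ t, f p = y →
      ∀ q ∈ sphere x₀ t, f q = y := by
  obtain ⟨A, hA, hAε⟩ := isv_cacc hR H hu hfD hKm hK1 hKi hdist
  set e : ℕ → ℝ := fun k => 1 / 100 * (1 / ((k : ℝ) + 1)) with he
  have he0 : ∀ k, 0 < e k := fun k => by simp only [he]; positivity
  have he1 : ∀ k, e k ≤ 1 / 100 := fun k => by
    have : 1 / ((k : ℝ) + 1) ≤ 1 := by
      rw [div_le_one (by positivity)]; linarith [(Nat.cast_nonneg k : (0:ℝ) ≤ k)]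
    simp only [he]; linarith
  have hel : Tendsto e atTop (𝓝 0) := by
    have := (tendsto_one_div_add_atTop_nhds_zero_nat (𝕜 := ℝ)).const_mul (1 / 100 : ℝ)
    simpa [he] using this
  have hex : ∀ k, ∃ n, k ≤ n ∧ MapsTo (g n) (closedBall x₀ R) (ball y (1 / 2)) ∧
      ∫⁻ x in closedBall x₀ (R / 2), ‖isvm y (e k) (g n x) * ‖fderiv ℝ (g n) x‖‖ₑ ≤ A + 1 := by
    intro k
    obtain ⟨N, hN⟩ := isv_cacc_n hR H hu hfD (he0 k) (he1 k) (hAε _ (he0 k) (he1 k))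
    exact ⟨max N k, le_max_right _ _, hN _ (le_max_left _ _)⟩
  choose ν hν hmap hinn using hex
  have hνt : Tendsto ν atTop atTop := tendsto_atTop_mono hν tendsto_id
  have hFm : ∀ k, Measurable (fun x => 2 * ‖isvm y (e k) (g (ν k) x) * ‖fderiv ℝ (g (ν k)) x‖‖ₑ) := by
    intro k
    have e4 : Measurable (isvm y (e k)) := by unfold isvm isvs; fun_prop
    have e5 := (H.smooth (ν k)).continuous.measurable
    have h3 : Continuous (fderiv ℝ (g (ν k))) := (H.c1 (ν k)).continuous_fderiv one_ne_zero
    exact (((e4.comp e5).mul h3.norm.measurable).enorm).const_mul 2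
  have hc := isv_circ_a x₀ (R / 2)
    (fun k x => 2 * ‖isvm y (e k) (g (ν k) x) * ‖fderiv ℝ (g (ν k)) x‖‖ₑ) hFm (2 * (A + 1))
    (ENNReal.mul_ne_top (by norm_num) (by simp [hA])) (fun k => by
      rw [lintegral_const_mul' _ _ (by norm_num)]
      gcongr
      exact hinn k)
  filter_upwards [hc, ae_restrict_mem measurableSet_Ioo] with t ht htm p hp hpy q hq
  by_contra hqy
  obtain ⟨C, hC, hfr⟩ := ht
  have hsph : ∀ x ∈ sphere x₀ t, x ∈ closedBall x₀ R := fun x hx => by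
    rw [mem_sphere] at hx; rw [mem_closedBall, hx]; linarith [htm.2]
  have hbd : ∃ᶠ k in atTop, isvu y (e k) (g (ν k) p) ≤ isvu y (e k) (g (ν k) q) + C.toReal := by
    refine hfr.mono fun k hk => ?_
    have h1 := isv_osc (fun x => isvu y (e k) (g (ν k) x)) x₀ t htm.1 (fun x hx =>
      (isvu_contDiffAt (he0 k) (he1 k) (hmap k (hsph x hx))).comp x (H.c1 (ν k)).contDiffAt) p q
      (by rwa [mem_sphere] at hp) (by rwa [mem_sphere] at hq)
    have h2 : ENNReal.ofReal t * ∫⁻ θ in Ioo (-π) π,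
        ‖fderiv ℝ (fun x => isvu y (e k) (g (ν k) x)) (isvC x₀ t θ)‖ₑ ≤ ENNReal.ofReal t *
        ∫⁻ θ in Ioo (-π) π, 2 * ‖isvm y (e k) (g (ν k) (isvC x₀ t θ)) *
          ‖fderiv ℝ (g (ν k)) (isvC x₀ t θ)‖‖ₑ := by
      gcongr with θ
      set x := isvC x₀ t θ
      have hxs : x ∈ sphere x₀ t := by
        rw [mem_sphere, dist_eq_norm, isvC_norm, abs_of_pos htm.1]
      have hgx := hmap k (hsph x hxs)
      have e1 : fderiv ℝ (fun x => isvu y (e k) (g (ν k) x)) x =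
          (fderiv ℝ (isvu y (e k)) (g (ν k) x)).comp (fderiv ℝ (g (ν k)) x) :=
        fderiv_comp x ((isvu_contDiffAt (he0 k) (he1 k) hgx).differentiableAt one_ne_zero)
          ((H.c1 (ν k)).differentiable one_ne_zero x)
      have e2 := isvu_fderiv (he0 k) (he1 k) hgx
      have e3 := isvm_pos (he0 k) (he1 k) hgx
      rw [e1, ← ofReal_norm, ← ofReal_norm, Real.norm_eq_abs, abs_of_nonneg (by positivity)]
      refine le_trans (ENNReal.ofReal_le_ofReal
        (q := 2 * (isvm y (e k) (g (ν k) x) * ‖fderiv ℝ (g (ν k)) x‖))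
        ((ContinuousLinearMap.opNorm_comp_le _ _).trans ?_))
        (by rw [ENNReal.ofReal_mul zero_le_two, ENNReal.ofReal_ofNat])
      rw [← mul_assoc]
      gcongr
    have h3 := (h1.trans h2).trans hk.le
    rw [← ofReal_norm, Real.norm_eq_abs] at h3
    have h4 := (ENNReal.ofReal_le_iff_le_toReal hC).1 h3
    linarith [le_abs_self (isvu y (e k) (g (ν k) p) - isvu y (e k) (g (ν k) q))]
  have hlimg : ∀ x ∈ sphere x₀ t, Tendsto (fun k => isvs y (e k) (g (ν k) x)) atTop
      (𝓝 (‖f x - y‖ ^ 2)) := by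
    intro x hx
    have e1 := (hu.tendsto_at (hsph x hx)).comp hνt
    have := (((e1.sub_const y).norm).pow 2).add hel
    rw [add_zero] at this
    exact this
  have hq1 : Tendsto (fun k => isvu y (e k) (g (ν k) q)) atTop
      (𝓝 (Real.log (-Real.log (‖f q - y‖ ^ 2)))) := by
    have h0 : 0 < ‖f q - y‖ := norm_pos_iff.2 (sub_ne_zero.2 hqy)
    have hfq := hfD (hsph q hq)
    rw [mem_closedBall, dist_eq_norm] at hfq
    have h1 := isv_log_bd (show 0 < ‖f q - y‖ ^ 2 by positivity) (by nlinarith)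
    exact (((hlimg q hq).log (by positivity)).neg).log (by linarith)
  have hp1 : Tendsto (fun k => isvu y (e k) (g (ν k) p)) atTop atTop := by
    have h0 := hlimg p hp
    rw [hpy, sub_self, norm_zero, zero_pow two_ne_zero] at h0
    have h1 : Tendsto (fun k => isvs y (e k) (g (ν k) p)) atTop (𝓝[>] 0) :=
      tendsto_nhdsWithin_iff.2 ⟨h0, Eventually.of_forall fun k => isvs_pos (he0 k) _⟩
    exact Real.tendsto_log_atTop.comp
      (tendsto_neg_atBot_atTop.comp (Real.tendsto_log_nhdsGT_zero.comp h1))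
  have hev : ∀ᶠ k in atTop, isvu y (e k) (g (ν k) q) + C.toReal < isvu y (e k) (g (ν k) p) := by
    filter_upwards [hq1.eventually_lt_const (lt_add_one _),
      hp1.eventually_gt_atTop (Real.log (-Real.log (‖f q - y‖ ^ 2)) + 1 + C.toReal)] with k a b
    linarith
  obtain ⟨k, h1, h2⟩ := (hbd.and_eventually hev).exists
  linarith


structure IsvMap (Ω : Set E2) (f : E2 → E2) (Df : E2 → E2 →L[ℝ] E2) (K : E2 → ℝ) : Prop where
  hΩ : IsOpen Ω
  hf : MemW12loc Ω f Df
  hc : ContinuousOn f Ω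
  hKm : Measurable K
  hK1 : ∀ x, 1 ≤ K x
  hKl : ∀ A : Set E2, A ⊆ Ω → IsCompact A → ∫⁻ x in A, ENNReal.ofReal (K x) < ⊤
  hdist : ∀ᵐ x ∂(volume.restrict Ω), ‖Df x‖ ^ 2 ≤ K x * (Df x).det

lemma isv_FD_of {Ω : Set E2} {Df : E2 → E2 →L[ℝ] E2} {K : E2 → ℝ} (hK1 : ∀ x, 1 ≤ K x)
    (hdist : ∀ᵐ x ∂(volume.restrict Ω), ‖Df x‖ ^ 2 ≤ K x * (Df x).det) :
    ∀ᵐ x ∂(volume.restrict Ω), isvFD (Df x) := by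
  filter_upwards [hdist] with x hx
  constructor
  · by_contra hc
    push Not at hc
    nlinarith [sq_nonneg ‖Df x‖, hK1 x]
  · intro h0
    rw [h0, mul_zero] at hx
    have : ‖Df x‖ = 0 := by nlinarith [norm_nonneg (Df x)]
    exact norm_eq_zero.1 this

lemma IsvMap.FD {Ω : Set E2} {f Df K} (M : IsvMap Ω f Df K) :
    ∀ᵐ x ∂(volume.restrict Ω), isvFD (Df x) := isv_FD_of M.hK1 M.hdist

lemma isv_exists_Ioo {a b : ℝ} (hab : a < b) {P : ℝ → Prop}
    (h : ∀ᵐ t ∂(volume.restrict (Ioo a b)), P t) : ∃ t ∈ Ioo a b, P t := by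
  have hne : (ae (volume.restrict (Ioo a b))).NeBot := by
    rw [ae_restrict_neBot]
    simp [hab]
  exact ((ae_restrict_mem measurableSet_Ioo).and h).exists

open Filter Metric in
lemma IsvMap.sphere_ball {Ω : Set E2} {f Df K} (M : IsvMap Ω f Df K) {x₀ y : E2} {t : ℝ}
    (ht : 0 < t) (hs : closedBall x₀ t ⊆ Ω) (h : ∀ x ∈ sphere x₀ t, f x = y) :
    ∀ x ∈ ball x₀ t, f x = y := by
  obtain ⟨g, H, -, hu⟩ := isv_approx' M.hΩ M.hf ht.le hs
  have hu := hu M.hc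
  have hbs : ball x₀ t ⊆ Ω := ball_subset_closedBall.trans hs
  intro x hx
  refine eq_of_forall_dist_le fun ε hε => ?_
  have h1 := isv_mp2 ht (H.mono ball_subset_closedBall)
    (ae_mono (Measure.restrict_mono hbs le_rfl) M.FD) y (ε / 2) (by
      refine Eventually.frequently ?_
      rw [Metric.tendstoUniformlyOn_iff] at hu
      filter_upwards [hu (ε / 2) (by positivity)] with n hn z hz
      have := hn z (sphere_subset_closedBall hz)
      rwa [h z hz, dist_comm, dist_eq_norm] at this)
  have := isv_ae_closed isOpen_ball (M.hc.mono hbs) (isClosed_closedBall (x := y) (ε := ε))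
    (by filter_upwards [h1] with x hx
        rw [mem_closedBall, dist_eq_norm]; linarith)
  exact this x hx

open Filter Metric in
lemma IsvMap.loc {Ω : Set E2} {f Df K} (M : IsvMap Ω f Df K) {x₀ : E2} (hx : x₀ ∈ Ω) :
    ∃ R > 0, closedBall x₀ R ⊆ Ω ∧ ∀ᵐ t ∂(volume.restrict (Ioo 0 R)),
      (∃ p ∈ sphere x₀ t, f p = f x₀) → ∀ q ∈ ball x₀ t, f q = f x₀ := by
  have hpre : f ⁻¹' (closedBall (f x₀) (1 / 4)) ∈ 𝓝 x₀ :=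
    ContinuousAt.preimage_mem_nhds (ContinuousOn.continuousAt M.hc (M.hΩ.mem_nhds hx))
      (closedBall_mem_nhds (f x₀) (by norm_num))
  have hinn : Ω ∩ f ⁻¹' (closedBall (f x₀) (1 / 4)) ∈ 𝓝 x₀ := inter_mem (M.hΩ.mem_nhds hx) hpre
  obtain ⟨R, hR0, hR⟩ := nhds_basis_closedBall.mem_iff.1 hinn
  have hRΩ : closedBall x₀ R ⊆ Ω := hR.trans inter_subset_left
  obtain ⟨g, H, -, hu⟩ := isv_approx' M.hΩ M.hf hR0.le hRΩ
  have hmt : MapsTo f (closedBall x₀ R) (closedBall (f x₀) (1 / 4)) := fun x hx => (hR hx).2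
  have hd := isv_dich hR0 H (hu M.hc) hmt M.hKm M.hK1
    (M.hKl _ hRΩ (isCompact_closedBall _ _)) (ae_mono (Measure.restrict_mono hRΩ le_rfl) M.hdist)
  refine ⟨R / 2, by positivity, (closedBall_subset_closedBall (by linarith)).trans hRΩ, ?_⟩
  filter_upwards [hd, ae_restrict_mem measurableSet_Ioo] with t ht htm hex
  obtain ⟨p, hp, hpy⟩ := hex
  exact M.sphere_ball htm.1 ((closedBall_subset_closedBall (by linarith [htm.2])).trans hRΩ)
    (ht p hp hpy)

open Filter Metric in
lemma IsvMap.not_loc_const {Ω : Set E2} {f Df K} (M : IsvMap Ω f Df K) (hconn : IsPreconnected Ω)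
    (hnc : ¬ ∃ c, ∀ x ∈ Ω, f x = c) {x₀ : E2} (hx₀ : x₀ ∈ Ω) {r : ℝ} (hr : 0 < r)
    (h : ∀ x ∈ ball x₀ r, f x = f x₀) : False := by
  set y := f x₀ with hy
  set A := interior (Ω ∩ f ⁻¹' {y}) with hA
  refine hnc ⟨y, fun x hx => ?_⟩
  have hsub : Ω ⊆ A := by
    refine hconn.subset_of_closure_inter_subset isOpen_interior ⟨x₀, hx₀, ?_⟩ ?_
    · rw [hA, mem_interior_iff_mem_nhds]
      filter_upwards [M.hΩ.mem_nhds hx₀, ball_mem_nhds x₀ hr] with z h1 h2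
      exact ⟨h1, h z h2⟩
    · rintro z ⟨hzc, hzΩ⟩
      have hzy : f z = y := by
        by_contra hne
        have ho : IsOpen (Ω ∩ f ⁻¹' {y}ᶜ) := M.hc.isOpen_inter_preimage M.hΩ
          isClosed_singleton.isOpen_compl
        obtain ⟨w, hw1, hw2⟩ := mem_closure_iff.1 hzc _ ho ⟨hzΩ, hne⟩
        exact hw1.2 (interior_subset hw2).2
      obtain ⟨R, hR0, hRΩ, hR⟩ := M.loc hzΩ
      obtain ⟨a, haR, haA⟩ := mem_closure_iff.1 hzc _ isOpen_ball (mem_ball_self hR0)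
      by_cases haz : a = z
      · rwa [← haz]
      obtain ⟨ρ, hρ, hρA⟩ := Metric.isOpen_iff.1 (isOpen_interior (s := Ω ∩ f ⁻¹' {y})) a haA
      rw [mem_ball, dist_eq_norm] at haR
      set d := ‖a - z‖ with hd
      have hd0 : 0 < d := norm_pos_iff.2 (sub_ne_zero.2 haz)
      have hsubI : Ioo d (min (d + ρ) R) ⊆ Ioo 0 R := fun t ht =>
        ⟨hd0.trans ht.1, ht.2.trans_le (min_le_right _ _)⟩
      obtain ⟨t, ht, hP⟩ := isv_exists_Ioo (lt_min (by linarith) haR)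
        (ae_mono (Measure.restrict_mono hsubI le_rfl) hR)
      have htp : 0 < t := hd0.trans ht.1
      have hball := hP ⟨z + (t / d) • (a - z), by
        rw [mem_sphere, dist_eq_norm, add_sub_cancel_left, norm_smul, Real.norm_eq_abs,
          abs_of_pos (by positivity), ← hd]
        field_simp, by
        rw [hzy]
        refine (interior_subset (hρA ?_)).2
        rw [mem_ball, dist_eq_norm]
        have e1 : z + (t / d) • (a - z) - a = ((t - d) / d) • (a - z) := by
          rw [sub_div, div_self hd0.ne', sub_smul, one_smul]; abel
        have h1 := ht.2.trans_le (min_le_left _ _)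
        rw [e1, norm_smul, Real.norm_eq_abs, abs_of_pos (div_pos (by linarith [ht.1]) hd0), ← hd]
        rw [div_mul_cancel₀ _ hd0.ne']
        linarith⟩
      change z ∈ A
      rw [hA, mem_interior_iff_mem_nhds]
      filter_upwards [M.hΩ.mem_nhds hzΩ, ball_mem_nhds z htp] with w h1 h2
      exact ⟨h1, (hball w h2).trans hzy⟩
  exact (interior_subset (hsub hx)).2

open Filter Metric in
lemma IsvMap.exists_sphere {Ω : Set E2} {f Df K} (M : IsvMap Ω f Df K) (hconn : IsPreconnected Ω)
    (hnc : ¬ ∃ c, ∀ x ∈ Ω, f x = c) {x₀ : E2} (hx₀ : x₀ ∈ Ω) {δ : ℝ} (hδ : 0 < δ) :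
    ∃ t, 0 < t ∧ t < δ ∧ closedBall x₀ t ⊆ Ω ∧ ∃ d > 0, ∀ p ∈ sphere x₀ t, d ≤ dist (f p) (f x₀) := by
  obtain ⟨R, hR0, hRΩ, hR⟩ := M.loc hx₀
  have hsubI : Ioo 0 (min δ R) ⊆ Ioo 0 R := fun t ht =>
        ⟨ht.1, ht.2.trans_le (min_le_right _ _)⟩
  obtain ⟨t, ht, hP⟩ := isv_exists_Ioo (lt_min hδ hR0)
        (ae_mono (Measure.restrict_mono hsubI le_rfl) hR)
  have hcb : closedBall x₀ t ⊆ Ω := (closedBall_subset_closedBall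
    (ht.2.le.trans (min_le_right _ _))).trans hRΩ
  refine ⟨t, ht.1, ht.2.trans_le (min_le_left _ _), hcb, ?_⟩
  have hne : ∀ p ∈ sphere x₀ t, f p ≠ f x₀ := fun p hp hpe =>
    M.not_loc_const hconn hnc hx₀ ht.1 (hP ⟨p, hp, hpe⟩)
  have hcont : ContinuousOn (fun p => dist (f p) (f x₀)) (sphere x₀ t) :=
    continuous_dist.comp_continuousOn
      ((M.hc.mono (sphere_subset_closedBall.trans hcb)).prodMk continuousOn_const)
  have hsne : (sphere x₀ t).Nonempty := NormedSpace.sphere_nonempty.2 ht.1.le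
  obtain ⟨p, hp, hmin⟩ := (isCompact_sphere x₀ t).exists_isMinOn hsne hcont
  exact ⟨_, dist_pos.2 (hne p hp), fun q hq => hmin hq⟩


def isvb (φ : E2 → ℝ) (z : E2) (s : ℝ) (w : E2) : ℝ := (s⁻¹) ^ 2 * φ (s⁻¹ • (w - z))

def isvbX (φ : E2 → ℝ) (z : E2) (s : ℝ) (v : E2) (r : ℝ) (w : E2) : E2 :=
  ((s⁻¹) ^ 2 * φ (s⁻¹ • (w - z))) • (v + r • (s⁻¹ • (w - z)))

def isvbd (φ : E2 → ℝ) (z : E2) (s : ℝ) (v : E2) (r : ℝ) (w : E2) : ℝ :=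
  (s⁻¹) ^ 3 * (fderiv ℝ φ (s⁻¹ • (w - z)) (v + r • (s⁻¹ • (w - z))) + 2 * r * φ (s⁻¹ • (w - z)))

lemma isvbX_contDiff {φ : E2 → ℝ} (hφ : ContDiff ℝ 1 φ) (z : E2) (s : ℝ) (v : E2) (r : ℝ) :
    ContDiff ℝ 1 (isvbX φ z s v r) := by
  unfold isvbX
  have h1 : ContDiff ℝ 1 (fun w : E2 => s⁻¹ • (w - z)) :=
    (contDiff_id.sub contDiff_const).const_smul s⁻¹
  have h2 : ContDiff ℝ 1 (fun w : E2 => (s⁻¹) ^ 2 * φ (s⁻¹ • (w - z))) :=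
    contDiff_const.mul (hφ.comp h1)
  exact h2.smul (contDiff_const.add (h1.const_smul r))

lemma isvbX_div {φ : E2 → ℝ} (hφ : ContDiff ℝ 1 φ) (z : E2) (s : ℝ) (v : E2) (r : ℝ) (w : E2) :
    isvDiv (isvbX φ z s v r) w = isvbd φ z s v r w := by
  have h1 : HasFDerivAt (fun w : E2 => s⁻¹ • (w - z)) (s⁻¹ • ContinuousLinearMap.id ℝ E2) w :=
    ((hasFDerivAt_id w).sub_const z).const_smul s⁻¹
  have h2 : HasFDerivAt (fun w : E2 => φ (s⁻¹ • (w - z)))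
      ((fderiv ℝ φ (s⁻¹ • (w - z))).comp (s⁻¹ • ContinuousLinearMap.id ℝ E2)) w :=
    (hφ.differentiable one_ne_zero _).hasFDerivAt.comp w h1
  have h3 : HasFDerivAt (isvbX φ z s v r) _ w :=
    (h2.const_mul ((s⁻¹) ^ 2)).smul ((h1.const_smul r).const_add v)
  unfold isvbd
  set ξ := s⁻¹ • (w - z) with hξ
  have h4 : fderiv ℝ φ ξ (v + r • ξ) = (v + r • ξ) 0 * fderiv ℝ φ ξ (isvE 0) +
      (v + r • ξ) 1 * fderiv ℝ φ ξ (isvE 1) := by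
    conv_lhs => rw [isv_decomp (v + r • ξ)]
    rw [map_add, map_smul, map_smul, smul_eq_mul, smul_eq_mul]
  rw [h4]
  simp only [isvDiv, h3.fderiv]
  simp [isvE, ← hξ]
  ring

lemma isvb_deriv {φ : E2 → ℝ} (hφ : ContDiff ℝ 1 φ) (z v : E2) (s r τ : ℝ) (w : E2)
    (hs : 0 < s + τ * r) :
    HasDerivAt (fun τ => isvb φ (z + τ • v) (s + τ * r) w)
      (-isvbd φ (z + τ • v) (s + τ * r) v r w) τ := by
  have h1 : HasDerivAt (fun τ : ℝ => s + τ * r) r τ := by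
    simpa using ((hasDerivAt_id τ).mul_const r).const_add s
  have h2 : HasDerivAt (fun τ : ℝ => (s + τ * r)⁻¹) _ τ := h1.inv hs.ne'
  have h3 : HasDerivAt (fun τ : ℝ => w - (z + τ • v)) (-v) τ := by
    have := (((hasDerivAt_id τ).smul_const v).const_add z).const_sub w
    simpa using this
  have h4 : HasDerivAt (fun τ : ℝ => (s + τ * r)⁻¹ • (w - (z + τ • v))) _ τ := h2.smul h3
  have h5 := (hφ.differentiable one_ne_zero
    ((s + τ * r)⁻¹ • (w - (z + τ • v)))).hasFDerivAt.comp_hasDerivAt τ h4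
  have h6 := (h2.pow 2).mul h5
  unfold isvb
  refine h6.congr_deriv ?_
  unfold isvbd
  simp only [map_add, map_smul, map_neg, smul_eq_mul, Pi.pow_apply, Function.comp, Nat.add_one_sub_one, pow_one, Nat.reduceSub]
  have hs' := hs.ne'
  generalize s + τ * r = σ at *
  field_simp
  ring

lemma isvb_supp {φ : E2 → ℝ} (hφs : ∀ ξ, φ ξ ≠ 0 → ‖ξ‖ ≤ 1) (z : E2) {s : ℝ} (hs : 0 < s) (w : E2)
    (h : φ (s⁻¹ • (w - z)) ≠ 0) : dist w z ≤ s := by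
  have := hφs _ h
  rw [norm_smul, Real.norm_eq_abs, abs_of_pos (by positivity)] at this
  rw [dist_eq_norm]
  rwa [inv_mul_le_iff₀ hs, mul_one] at this

open Metric in
lemma isvbX_tsupport {φ : E2 → ℝ} (hφs : ∀ ξ, φ ξ ≠ 0 → ‖ξ‖ ≤ 1) (z : E2) {s : ℝ} (hs : 0 < s)
    (v : E2) (r : ℝ) : tsupport (isvbX φ z s v r) ⊆ closedBall z s := by
  refine closure_minimal (fun w hw => ?_) isClosed_closedBall
  refine isvb_supp hφs z hs w fun h0 => hw ?_
  simp [isvbX, h0]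

open Metric in
theorem isv_INV0 {φ : E2 → ℝ} (hφ : ContDiff ℝ 1 φ) (hφs : ∀ ξ, φ ξ ≠ 0 → ‖ξ‖ ≤ 1)
    (g : E2 → E2) (hg : ContDiff ℝ 2 g) (x₀ y : E2) {t δ : ℝ} (ht : 0 < t)
    (hS : ∀ x ∈ sphere x₀ t, g x ∉ ball y δ) {z₀ z₁ : E2} {s₀ s₁ : ℝ} (hs₀ : 0 < s₀) (hs₁ : 0 < s₁)
    (h₀ : dist z₀ y + s₀ < δ) (h₁ : dist z₁ y + s₁ < δ) :
    ∫ x in ball x₀ t, isvb φ z₀ s₀ (g x) * (fderiv ℝ g x).det =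
      ∫ x in ball x₀ t, isvb φ z₁ s₁ (g x) * (fderiv ℝ g x).det := by
  set v := z₁ - z₀ with hv
  set r := s₁ - s₀ with hr
  have hpos : ∀ τ ∈ Icc (0:ℝ) 1, 0 < s₀ + τ * r := by
    intro τ hτ
    have : s₀ + τ * r = (1 - τ) * s₀ + τ * s₁ := by rw [hr]; ring
    rw [this]
    rcases eq_or_lt_of_le hτ.1 with h | h
    · rw [← h]; simpa using hs₀
    · have := mul_nonneg (sub_nonneg.2 hτ.2) hs₀.le
      have := mul_pos h hs₁
      linarith
  have hin : ∀ τ ∈ Icc (0:ℝ) 1, closedBall (z₀ + τ • v) (s₀ + τ * r) ⊆ ball y δ := by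
    intro τ hτ
    apply closedBall_subset_ball'
    have e1 : z₀ + τ • v - y = (1 - τ) • (z₀ - y) + τ • (z₁ - y) := by rw [hv]; module
    have e2 := norm_add_le ((1 - τ) • (z₀ - y)) (τ • (z₁ - y))
    rw [norm_smul, norm_smul, Real.norm_eq_abs, Real.norm_eq_abs, abs_of_nonneg hτ.1,
      abs_of_nonneg (sub_nonneg.2 hτ.2)] at e2
    rw [dist_eq_norm] at h₀ h₁ ⊢
    rw [e1, hr]
    have a1 : 0 ≤ 1 - τ := sub_nonneg.2 hτ.2
    have a2 := hτ.1
    rcases eq_or_lt_of_le a2 with h | h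
    · rw [← h] at e2 ⊢; simp only [sub_zero, one_mul, zero_mul, add_zero] at e2 ⊢; linarith
    · nlinarith [mul_le_mul_of_nonneg_left h₀.le a1, mul_lt_mul_of_pos_left h₁ h]
  have hz : ∀ τ ∈ Icc (0:ℝ) 1, ∫ x in ball x₀ t,
      isvbd φ (z₀ + τ • v) (s₀ + τ * r) v r (g x) * (fderiv ℝ g x).det = 0 := by
    intro τ hτ
    have := isv_L1 g hg (isvbX φ (z₀ + τ • v) (s₀ + τ * r) v r) (isvbX_contDiff hφ _ _ _ _) x₀ t ht
      (fun x hx hx2 => hS x hx (hin τ hτ (isvbX_tsupport hφs _ (hpos τ hτ) _ _ hx2)))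
    simpa only [isvbX_div hφ] using this
  have hφd : Continuous (fderiv ℝ φ) := hφ.continuous_fderiv one_ne_zero
  have hdc : ContinuousOn (fun p : ℝ × E2 => isvbd φ (z₀ + p.1 • v) (s₀ + p.1 * r) v r (g p.2))
      (Icc 0 1 ×ˢ univ) := by
    have hgc := hg.continuous
    have e1 : ContinuousOn (fun p : ℝ × E2 => (s₀ + p.1 * r)⁻¹) (Icc 0 1 ×ˢ univ) :=
      ContinuousOn.inv₀ (by fun_prop) (fun p hp => (hpos p.1 hp.1).ne')
    have e2 : ContinuousOn (fun p : ℝ × E2 => (s₀ + p.1 * r)⁻¹ • (g p.2 - (z₀ + p.1 • v)))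
      (Icc 0 1 ×ˢ univ) := e1.smul (by fun_prop)
    unfold isvbd
    refine (e1.pow 3).mul (ContinuousOn.add ?_ (continuousOn_const.mul
      (hφ.continuous.comp_continuousOn e2)))
    exact (hφd.comp_continuousOn e2).clm_apply (continuousOn_const.add (e2.const_smul r))
  have hdet : Continuous fun x => (fderiv ℝ g x).det :=
    isv_det_cont.comp (hg.continuous_fderiv two_ne_zero)
  have hFTC : ∀ w, ∫ τ in (0:ℝ)..1, isvbd φ (z₀ + τ • v) (s₀ + τ * r) v r (g w) =
      isvb φ z₀ s₀ (g w) - isvb φ z₁ s₁ (g w) := by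
    intro w
    have hc : ContinuousOn (fun τ => isvbd φ (z₀ + τ • v) (s₀ + τ * r) v r (g w)) (uIcc 0 1) := by
      rw [uIcc_of_le zero_le_one]
      exact hdc.comp (f := fun τ : ℝ => (τ, w)) (by fun_prop) (fun τ hτ => ⟨hτ, mem_univ _⟩)
    have := intervalIntegral.integral_eq_sub_of_hasDerivAt (a := 0) (b := 1)
      (f := fun τ => -isvb φ (z₀ + τ • v) (s₀ + τ * r) (g w))
      (f' := fun τ => isvbd φ (z₀ + τ • v) (s₀ + τ * r) v r (g w))
      (fun τ hτ => by
        rw [uIcc_of_le zero_le_one] at hτ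
        exact (isvb_deriv hφ z₀ v s₀ r τ (g w) (hpos τ hτ)).neg.congr_deriv (neg_neg _)) hc.intervalIntegrable
    rw [this]
    simp [hv, hr]
    ring
  have hcI : ∀ z s, Continuous fun x => isvb φ z s (g x) * (fderiv ℝ g x).det := by
    intro z s
    unfold isvb
    have hgc := hg.continuous
    have := hφ.continuous
    exact (continuous_const.mul (hφ.continuous.comp (by fun_prop))).mul hdet
  have hii : ∀ z s, IntegrableOn (fun x => isvb φ z s (g x) * (fderiv ℝ g x).det) (ball x₀ t) :=
    fun z s => ((hcI z s).continuousOn.integrableOn_compact (isCompact_closedBall x₀ t)).mono_set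
      ball_subset_closedBall
  rw [← sub_eq_zero, ← integral_sub (hii _ _) (hii _ _)]
  have hprod : Integrable (Function.uncurry fun (x : E2) (τ : ℝ) =>
      isvbd φ (z₀ + τ • v) (s₀ + τ * r) v r (g x) * (fderiv ℝ g x).det)
      ((volume.restrict (ball x₀ t)).prod (volume.restrict (Ioc 0 1))) := by
    have e1 : ContinuousOn (Function.uncurry fun (x : E2) (τ : ℝ) =>
      isvbd φ (z₀ + τ • v) (s₀ + τ * r) v r (g x) * (fderiv ℝ g x).det)
      (closedBall x₀ t ×ˢ Icc 0 1) := by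
      have := hdc.comp (f := fun p : E2 × ℝ => (p.2, p.1)) (s := closedBall x₀ t ×ˢ Icc 0 1)
        (by fun_prop) (fun p hp => ⟨hp.2, mem_univ _⟩)
      exact this.mul (hdet.comp continuous_fst).continuousOn
    have e2 := e1.integrableOn_compact (μ := (volume : Measure E2).prod (volume : Measure ℝ))
      ((isCompact_closedBall x₀ t).prod isCompact_Icc)
    have e3 := e2.mono_set (prod_mono (ball_subset_closedBall (x := x₀) (ε := t))
      (Ioc_subset_Icc_self (a := (0:ℝ)) (b := 1)))
    rwa [IntegrableOn, ← Measure.prod_restrict] at e3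
  calc ∫ x in ball x₀ t, (isvb φ z₀ s₀ (g x) * (fderiv ℝ g x).det -
        isvb φ z₁ s₁ (g x) * (fderiv ℝ g x).det)
      = ∫ x in ball x₀ t, ∫ τ in Ioc (0:ℝ) 1,
        isvbd φ (z₀ + τ • v) (s₀ + τ * r) v r (g x) * (fderiv ℝ g x).det := by
        refine integral_congr_ae (Filter.Eventually.of_forall fun x => ?_)
        simp only
        rw [integral_mul_const, ← intervalIntegral.integral_of_le zero_le_one, hFTC]
        ring
    _ = ∫ τ in Ioc (0:ℝ) 1, ∫ x in ball x₀ t,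
        isvbd φ (z₀ + τ • v) (s₀ + τ * r) v r (g x) * (fderiv ℝ g x).det :=
        integral_integral_swap hprod
    _ = ∫ τ in Ioc (0:ℝ) 1, 0 :=
        setIntegral_congr_fun measurableSet_Ioc fun τ hτ => hz τ (Ioc_subset_Icc_self hτ)
    _ = 0 := by simp

lemma isvb_cont {φ : E2 → ℝ} (hφ : ContDiff ℝ 1 φ) (z : E2) (s : ℝ) : Continuous (isvb φ z s) := by
  unfold isvb
  exact continuous_const.mul (hφ.continuous.comp (by fun_prop))

open Filter in
theorem isv_bl {φ : E2 → ℝ} (hφ : ContDiff ℝ 1 φ)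
    (hφb : ∀ ξ, |φ ξ| ≤ 1) {S : Set E2} (hS : volume S ≠ ⊤) {g f Df}
    (H : IsvApprox S g f Df) (z : E2) (s : ℝ) :
    Tendsto (fun n => ∫⁻ x in S, ‖isvb φ z s (g n x) * (fderiv ℝ (g n) x).det -
      isvb φ z s (f x) * (Df x).det‖ₑ) atTop (𝓝 0) ∧
    IntegrableOn (fun x => isvb φ z s (f x) * (Df x).det) S ∧
    Tendsto (fun n => ∫ x in S, isvb φ z s (g n x) * (fderiv ℝ (g n) x).det)
      atTop (𝓝 (∫ x in S, isvb φ z s (f x) * (Df x).det)) := by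
  have hbc := isvb_cont hφ z s
  refine isv_lim hS H (fun n => ?_) ?_ (2 * (s⁻¹) ^ 2) (fun n => ?_)
  · exact ((hbc.comp (H.smooth n).continuous).mul
      (isv_det_cont.comp ((H.c1 n).continuous_fderiv one_ne_zero))).aestronglyMeasurable
  · filter_upwards [H.ae, H.aeD] with x h1 h2
    exact ((hbc.tendsto _).comp h1).mul ((isv_det_cont.tendsto _).comp h2)
  · refine Eventually.of_forall fun x => ?_
    have e1 := isv_det_le (fderiv ℝ (g n) x)
    have e2 : |isvb φ z s (g n x)| ≤ (s⁻¹) ^ 2 := by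
      unfold isvb
      rw [abs_mul, abs_of_nonneg (sq_nonneg _)]
      exact mul_le_of_le_one_right (sq_nonneg _) (hφb _)
    rw [abs_mul]
    have := mul_le_mul e2 e1 (abs_nonneg _) (sq_nonneg _)
    nlinarith [sq_nonneg (s⁻¹)]

open Filter Metric in
theorem isv_INV {φ : E2 → ℝ} (hφ : ContDiff ℝ 1 φ) (hφs : ∀ ξ, φ ξ ≠ 0 → ‖ξ‖ ≤ 1)
    (hφb : ∀ ξ, |φ ξ| ≤ 1) {x₀ y : E2} {t d : ℝ} (ht : 0 < t) {g f Df}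
    (H : IsvApprox (closedBall x₀ t) g f Df)
    (hu : TendstoUniformlyOn g f atTop (closedBall x₀ t))
    (hS : ∀ x ∈ sphere x₀ t, d ≤ dist (f x) y)
    {z₀ z₁ : E2} {s₀ s₁ : ℝ} (hs₀ : 0 < s₀) (hs₁ : 0 < s₁)
    (h₀ : dist z₀ y + s₀ < d) (h₁ : dist z₁ y + s₁ < d) :
    ∫ x in ball x₀ t, isvb φ z₀ s₀ (f x) * (Df x).det =
      ∫ x in ball x₀ t, isvb φ z₁ s₁ (f x) * (Df x).det := by
  have hl : ∀ z s, Tendsto (fun n => ∫ x in ball x₀ t, isvb φ z s (g n x) * (fderiv ℝ (g n) x).det)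
      atTop (𝓝 (∫ x in ball x₀ t, isvb φ z s (f x) * (Df x).det)) := fun z s =>
    (isv_bl hφ hφb measure_ball_lt_top.ne
      (H.mono (ball_subset_closedBall (x := x₀) (ε := t))) z s).2.2
  refine tendsto_nhds_unique (hl z₀ s₀) ((hl z₁ s₁).congr' ?_)
  obtain ⟨δ, hδ1, hδ2⟩ := exists_between (max_lt h₀ h₁)
  rw [Metric.tendstoUniformlyOn_iff] at hu
  filter_upwards [hu (d - δ) (by linarith)] with n hn
  refine (isv_INV0 hφ hφs (g n) (H.c2 n) x₀ y (δ := δ) ht (fun x hx hx2 => ?_) hs₀ hs₁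
    ((le_max_left _ _).trans_lt hδ1) ((le_max_right _ _).trans_lt hδ1)).symm
  have e1 := hn x (sphere_subset_closedBall hx)
  have e2 := hS x hx
  rw [mem_ball] at hx2
  linarith [dist_triangle (f x) (g n x) y]


structure IsvBump (φ : E2 → ℝ) : Prop where
  sm : ContDiff ℝ 1 φ
  supp : ∀ ξ, φ ξ ≠ 0 → ‖ξ‖ ≤ 1
  nonneg : ∀ ξ, 0 ≤ φ ξ
  le_one : ∀ ξ, φ ξ ≤ 1
  one : ∀ ξ, ‖ξ‖ ≤ 1 / 2 → φ ξ = 1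

lemma IsvBump.ab {φ : E2 → ℝ} (B : IsvBump φ) (ξ : E2) : |φ ξ| ≤ 1 := by
  rw [abs_of_nonneg (B.nonneg ξ)]; exact B.le_one ξ

lemma isv_bump_exists : ∃ φ : E2 → ℝ, IsvBump φ := by
  let b : ContDiffBump (0 : E2) := ⟨1 / 2, 1, by norm_num, by norm_num⟩
  refine ⟨b, b.contDiff, fun ξ h => ?_, fun ξ => b.nonneg, fun ξ => b.le_one, fun ξ h => ?_⟩
  · have : ξ ∈ Function.support b := h
    rw [b.support_eq, mem_ball_zero_iff] at this
    exact this.le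
  · exact b.one_of_mem_closedBall (by rw [mem_closedBall_zero_iff]; exact h)

lemma isvb_nonneg {φ : E2 → ℝ} (B : IsvBump φ) (z : E2) (s : ℝ) (w : E2) : 0 ≤ isvb φ z s w :=
  mul_nonneg (sq_nonneg _) (B.nonneg _)

lemma isvb_one {φ : E2 → ℝ} (B : IsvBump φ) (z : E2) {s : ℝ} (hs : 0 < s) {w : E2}
    (h : dist w z ≤ s / 2) : isvb φ z s w = (s⁻¹) ^ 2 := by
  unfold isvb
  rw [B.one, mul_one]
  rw [norm_smul, Real.norm_eq_abs, abs_of_pos (by positivity), ← dist_eq_norm, inv_mul_le_iff₀ hs]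
  linarith

lemma isvb_zero {φ : E2 → ℝ} (B : IsvBump φ) (z : E2) {s : ℝ} (hs : 0 < s) {w : E2}
    (h : s < dist w z) : isvb φ z s w = 0 := by
  by_contra h0
  exact absurd (isvb_supp B.supp z hs w (right_ne_zero_of_mul h0)) (not_le.2 h)

open Filter Metric in
lemma IsvMap.INV {Ω : Set E2} {f Df K} (M : IsvMap Ω f Df K) {φ : E2 → ℝ} (B : IsvBump φ)
    {x₀ y : E2} {t d : ℝ} (ht : 0 < t) (hs : closedBall x₀ t ⊆ Ω)
    (hS : ∀ x ∈ sphere x₀ t, d ≤ dist (f x) y)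
    {z₀ z₁ : E2} {s₀ s₁ : ℝ} (hs₀ : 0 < s₀) (hs₁ : 0 < s₁)
    (h₀ : dist z₀ y + s₀ < d) (h₁ : dist z₁ y + s₁ < d) :
    ∫ x in ball x₀ t, isvb φ z₀ s₀ (f x) * (Df x).det =
      ∫ x in ball x₀ t, isvb φ z₁ s₁ (f x) * (Df x).det := by
  obtain ⟨g, H, -, hu⟩ := isv_approx' M.hΩ M.hf ht.le hs
  exact isv_INV B.sm B.supp B.ab ht H (hu M.hc) hS hs₀ hs₁ h₀ h₁

open Filter Metric in
lemma IsvMap.int {Ω : Set E2} {f Df K} (M : IsvMap Ω f Df K) {φ : E2 → ℝ} (B : IsvBump φ)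
    {x₀ : E2} {t : ℝ} (ht : 0 < t) (hs : closedBall x₀ t ⊆ Ω) (z : E2) (s : ℝ) :
    IntegrableOn (fun x => isvb φ z s (f x) * (Df x).det) (ball x₀ t) := by
  obtain ⟨g, H, -, hu⟩ := isv_approx' M.hΩ M.hf ht.le hs
  exact (isv_bl B.sm B.ab measure_ball_lt_top.ne (H.mono ball_subset_closedBall) z s).2.1

open Filter Metric in
lemma IsvMap.nn {Ω : Set E2} {f Df K} (M : IsvMap Ω f Df K) {φ : E2 → ℝ} (B : IsvBump φ)
    {S : Set E2} (hs : S ⊆ Ω) (z : E2) (s : ℝ) :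
    0 ≤ᵐ[volume.restrict S] (fun x => isvb φ z s (f x) * (Df x).det) := by
  filter_upwards [ae_mono (Measure.restrict_mono hs le_rfl) M.FD] with x hx
  exact mul_nonneg (isvb_nonneg B _ _ _) hx.1

open Filter Metric in
lemma IsvMap.pos {Ω : Set E2} {f Df K} (M : IsvMap Ω f Df K) (hconn : IsPreconnected Ω)
    (hnc : ¬ ∃ c, ∀ x ∈ Ω, f x = c) {φ : E2 → ℝ} (B : IsvBump φ)
    {x₀ : E2} {t s : ℝ} (ht : 0 < t) (hs : closedBall x₀ t ⊆ Ω) (hs0 : 0 < s) :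
    0 < ∫ x in ball x₀ t, isvb φ (f x₀) s (f x) * (Df x).det := by
  have hb : ball x₀ t ⊆ Ω := ball_subset_closedBall.trans hs
  have hnn := M.nn B hb (f x₀) s
  refine lt_of_le_of_ne (integral_nonneg_of_ae hnn) fun h0 => ?_
  have h1 := (setIntegral_eq_zero_iff_of_nonneg_ae hnn (M.int B ht hs _ _)).1 h0.symm
  have hx₀ : x₀ ∈ Ω := hs (mem_closedBall_self ht.le)
  have hpre : f ⁻¹' (closedBall (f x₀) (s / 2)) ∈ 𝓝 x₀ :=
    ContinuousAt.preimage_mem_nhds (ContinuousOn.continuousAt M.hc (M.hΩ.mem_nhds hx₀))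
      (closedBall_mem_nhds (f x₀) (by linarith))
  obtain ⟨R, hR0, hR⟩ := Metric.nhds_basis_closedBall.mem_iff.1
    (inter_mem hpre (ball_mem_nhds x₀ ht))
  have hRb : closedBall x₀ R ⊆ ball x₀ t := fun x hx => (hR hx).2
  refine M.not_loc_const hconn hnc hx₀ (r := R / 2) (by linarith)
    (isv_const M.hΩ M.hf M.FD M.hc hR0 (hRb.trans hb) ?_)
  filter_upwards [ae_mono (Measure.restrict_mono hRb le_rfl) h1,
    ae_mono (Measure.restrict_mono (hRb.trans hb) le_rfl) M.FD,
    ae_restrict_mem isClosed_closedBall.measurableSet] with x h2 h3 h4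
  have h5 : isvb φ (f x₀) s (f x) = (s⁻¹) ^ 2 := isvb_one B _ hs0 (hR h4).1
  apply h3.2
  have h6 : isvb φ (f x₀) s (f x) * (Df x).det = 0 := h2
  rw [h5] at h6
  exact (mul_eq_zero.1 h6).resolve_left (by positivity)

open Filter Metric in
theorem IsvMap.isOpen_image {Ω : Set E2} {f Df K} (M : IsvMap Ω f Df K) (hconn : IsPreconnected Ω)
    (hnc : ¬ ∃ c, ∀ x ∈ Ω, f x = c) {U : Set E2} (hU : U ⊆ Ω) (hUo : IsOpen U) :
    IsOpen (f '' U) := by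
  obtain ⟨φ, B⟩ := isv_bump_exists
  rw [isOpen_iff_mem_nhds]
  rintro _ ⟨x₀, hx₀, rfl⟩
  obtain ⟨δ, hδ, hδU⟩ := Metric.isOpen_iff.1 hUo x₀ hx₀
  obtain ⟨t, ht, htδ, htΩ, d, hd, hS⟩ := M.exists_sphere hconn hnc (hU hx₀) hδ
  have hcU : closedBall x₀ t ⊆ U := (closedBall_subset_ball htδ).trans hδU
  refine mem_of_superset (ball_mem_nhds (f x₀) (show 0 < d / 2 by linarith)) fun z hz => ?_
  by_contra hzU
  have hcomp : IsCompact (f '' closedBall x₀ t) :=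
    (isCompact_closedBall x₀ t).image_of_continuousOn (M.hc.mono htΩ)
  have hz2 : z ∈ (f '' closedBall x₀ t)ᶜ := fun h => hzU (image_mono hcU h)
  obtain ⟨ε, hε, hεz⟩ := Metric.isOpen_iff.1 hcomp.isClosed.isOpen_compl z hz2
  obtain ⟨s, hs0, hs1⟩ := exists_between (show 0 < min ε (d / 2) by positivity)
  have hsε := hs1.trans_le (min_le_left _ _)
  have hsd := hs1.trans_le (min_le_right _ _)
  rw [mem_ball] at hz
  have h1 := M.INV B ht htΩ hS (z₀ := f x₀) (z₁ := z) hs0 hs0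
    (by rw [dist_self]; linarith) (by linarith)
  have h2 := M.pos hconn hnc B ht htΩ hs0
  rw [h1, setIntegral_congr_fun (g := fun _ => (0:ℝ)) measurableSet_ball] at h2
  · simp at h2
  · intro x hx
    have : f x ∉ ball z ε := fun h => hεz h (mem_image_of_mem f (ball_subset_closedBall hx))
    rw [mem_ball, not_lt] at this
    simp only
    rw [isvb_zero B z hs0 (hsε.trans_le this), zero_mul]


set_option maxHeartbeats 1000000 in
open Filter Metric in
lemma IsvMap.lower {Ω : Set E2} {f Df K} (M : IsvMap Ω f Df K) (hconn : IsPreconnected Ω)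
    (hnc : ¬ ∃ c, ∀ x ∈ Ω, f x = c) {φ : E2 → ℝ} (B : IsvBump φ)
    {x₀ : E2} {t s d : ℝ} (ht : 0 < t) (hΩ : closedBall x₀ t ⊆ Ω)
    (hS : ∀ x ∈ sphere x₀ t, d ≤ dist (f x) (f x₀)) (hs0 : 0 < s) (hsd : s < d) :
    volume.real (ball (0 : E2) 1) ≤
      4 * ∫ x in ball x₀ t, isvb φ (f x₀) s (f x) * (Df x).det := by
  have hpos := M.pos hconn hnc B ht hΩ hs0
  set y := f x₀ with hy
  set c := ∫ x in ball x₀ t, isvb φ y s (f x) * (Df x).det with hc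
  obtain ⟨g, H, -, hu⟩ := isv_approx' M.hΩ M.hf ht.le hΩ
  have hu := hu M.hc
  obtain ⟨l1, l2, l3⟩ := isv_bl B.sm B.ab measure_ball_lt_top.ne
    (H.mono (ball_subset_closedBall (x := x₀) (ε := t))) y s
  have hQ : ∫⁻ x in ball x₀ t, ‖isvb φ y s (f x) * (Df x).det‖ₑ = ENNReal.ofReal c := by
    rw [hc, ofReal_integral_eq_lintegral_ofReal l2
      (M.nn B (ball_subset_closedBall.trans hΩ) y s)]
    refine lintegral_congr_ae ?_
    filter_upwards [M.nn B (ball_subset_closedBall.trans hΩ) y s] with x hx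
    exact Real.enorm_of_nonneg hx
  obtain ⟨δ, hδ1, hδ2⟩ := exists_between hsd
  have hev : ∀ᶠ n in atTop, volume (ball y (s / 2)) ≤ ENNReal.ofReal (s ^ 2) *
      ((∫⁻ x in ball x₀ t, ‖isvb φ y s (g n x) * (fderiv ℝ (g n) x).det -
        isvb φ y s (f x) * (Df x).det‖ₑ) + ENNReal.ofReal c) := by
    rw [Metric.tendstoUniformlyOn_iff] at hu
    filter_upwards [hu (d - δ) (by linarith), l3.eventually (lt_mem_nhds hpos)] with n hn hp
    have hsph : ∀ x ∈ sphere x₀ t, g n x ∉ ball y δ := by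
      intro x hx hx2
      have e1 := hn x (sphere_subset_closedBall hx)
      have e2 := hS x hx
      rw [mem_ball] at hx2
      linarith [dist_triangle (f x) (g n x) y]
    have hgc : Continuous (g n) := (H.smooth n).continuous
    set A := ball x₀ t ∩ g n ⁻¹' ball y (s / 2) with hA
    have hAm : MeasurableSet A := measurableSet_ball.inter (hgc.measurable measurableSet_ball)
    have hcov : ball y (s / 2) ⊆ g n '' A := by
      intro z hz
      have hz1 : z ∈ g n '' closedBall x₀ t := by
        by_contra hz2
        have hcomp : IsCompact (g n '' closedBall x₀ t) :=
          (isCompact_closedBall x₀ t).image hgc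
        obtain ⟨ε, hε, hεz⟩ := Metric.isOpen_iff.1 hcomp.isClosed.isOpen_compl z hz2
        obtain ⟨s', hs0', hs1'⟩ := exists_between (show 0 < min ε (s / 2) by positivity)
        have hsε := hs1'.trans_le (min_le_left _ _)
        have hsd' := hs1'.trans_le (min_le_right _ _)
        rw [mem_ball] at hz
        have h1 := isv_INV0 B.sm B.supp (g n) (H.c2 n) x₀ y ht hsph (z₀ := y) (z₁ := z) hs0 hs0'
          (by rw [dist_self]; linarith) (by linarith)
        rw [h1, setIntegral_congr_fun (g := fun _ => (0:ℝ)) measurableSet_ball] at hp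
        · simp at hp
        · intro x hx
          have : g n x ∉ ball z ε := fun h =>
            hεz h (mem_image_of_mem (g n) (ball_subset_closedBall hx))
          rw [mem_ball, not_lt] at this
          simp only
          rw [isvb_zero B z hs0' (hsε.trans_le this), zero_mul]
      obtain ⟨x, hx, rfl⟩ := hz1
      refine ⟨x, ⟨?_, hz⟩, rfl⟩
      rcases (mem_closedBall.1 hx).lt_or_eq with h | h
      · exact h
      · exact absurd (ball_subset_ball (by linarith) hz) (hsph x h)
    have hpt : ∀ x ∈ A, ENNReal.ofReal |(fderiv ℝ (g n) x).det| =
        ENNReal.ofReal (s ^ 2) * ‖isvb φ y s (g n x) * (fderiv ℝ (g n) x).det‖ₑ := by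
      intro x hx
      have h8 : g n x ∈ ball y (s / 2) := hx.2
      rw [mem_ball] at h8
      have h7 : dist (g n x) y ≤ s / 2 := h8.le
      rw [isvb_one B y hs0 h7]
      generalize (fderiv ℝ (g n) x).det = J
      rw [Real.enorm_eq_ofReal_abs, ← ENNReal.ofReal_mul (by positivity),
        abs_mul, abs_of_nonneg (sq_nonneg s⁻¹), ← mul_assoc]
      have : s ^ 2 * s⁻¹ ^ 2 = 1 := by field_simp
      rw [this, one_mul]
    calc volume (ball y (s / 2)) ≤ volume (g n '' A) := measure_mono hcov
      _ ≤ ∫⁻ x in A, ENNReal.ofReal |(fderiv ℝ (g n) x).det| :=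
        addHaar_image_le_lintegral_abs_det_fderiv volume hAm fun x _ =>
          ((H.c1 n).differentiable one_ne_zero x).hasFDerivAt.hasFDerivWithinAt
      _ = ∫⁻ x in A, ENNReal.ofReal (s ^ 2) * ‖isvb φ y s (g n x) * (fderiv ℝ (g n) x).det‖ₑ := by
        exact setLIntegral_congr_fun hAm hpt
      _ ≤ ∫⁻ x in ball x₀ t,
          ENNReal.ofReal (s ^ 2) * ‖isvb φ y s (g n x) * (fderiv ℝ (g n) x).det‖ₑ :=
        lintegral_mono_set inter_subset_left
      _ = ENNReal.ofReal (s ^ 2) *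
          ∫⁻ x in ball x₀ t, ‖isvb φ y s (g n x) * (fderiv ℝ (g n) x).det‖ₑ :=
        lintegral_const_mul' _ _ ENNReal.ofReal_ne_top
      _ ≤ _ := by
        gcongr
        rw [← hQ, ← lintegral_add_right' _ l2.aestronglyMeasurable.enorm]
        refine lintegral_mono fun x => ?_
        have := enorm_add_le (isvb φ y s (g n x) * (fderiv ℝ (g n) x).det -
          isvb φ y s (f x) * (Df x).det) (isvb φ y s (f x) * (Df x).det)
        simpa only [sub_add_cancel] using this
  have hlim : volume (ball y (s / 2)) ≤ ENNReal.ofReal (s ^ 2) * ENNReal.ofReal c := by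
    have e1 := ENNReal.Tendsto.const_mul (a := ENNReal.ofReal (s ^ 2))
      (l1.add_const (ENNReal.ofReal c)) (Or.inr ENNReal.ofReal_ne_top)
    rw [zero_add] at e1
    exact ge_of_tendsto e1 hev
  have hvol : volume (ball y (s / 2)) = ENNReal.ofReal ((s / 2) ^ 2) * volume (ball (0 : E2) 1) := by
    rw [Measure.addHaar_ball _ _ (by positivity)]
    simp
  rw [hvol, ← ENNReal.ofReal_mul (by positivity)] at hlim
  have h3 := ENNReal.toReal_mono ENNReal.ofReal_ne_top hlim
  rw [ENNReal.toReal_mul, ENNReal.toReal_ofReal (by positivity),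
    ENNReal.toReal_ofReal (mul_nonneg (sq_nonneg _) hpos.le)] at h3
  rw [measureReal_def]
  have h4 : 0 < s ^ 2 := by positivity
  have : s ^ 2 * (volume (ball (0 : E2) 1)).toReal ≤ s ^ 2 * (4 * c) := by nlinarith
  exact le_of_mul_le_mul_left this h4

open Filter Metric in
lemma IsvMap.count {Ω : Set E2} {f Df K} (M : IsvMap Ω f Df K) (hconn : IsPreconnected Ω)
    (hnc : ¬ ∃ c, ∀ x ∈ Ω, f x = c) {φ : E2 → ℝ} (B : IsvBump φ) {x₀ : E2} (hx₀ : x₀ ∈ Ω)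
    (hacc : ∀ ε > 0, ∃ p ∈ Ω, p ≠ x₀ ∧ dist p x₀ < ε ∧ f p = f x₀) (N : ℕ) :
    ∀ (t s d : ℝ), 0 < t → closedBall x₀ t ⊆ Ω →
    (∀ x ∈ sphere x₀ t, d ≤ dist (f x) (f x₀)) → 0 < s → s < d →
    N * volume.real (ball (0 : E2) 1) ≤
      4 * ∫ x in ball x₀ t, isvb φ (f x₀) s (f x) * (Df x).det := by
  induction N with
  | zero =>
    intro t s d ht hΩ _ hs _
    have := M.pos hconn hnc B ht hΩ hs
    simp
    exact this.le
  | succ N ih =>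
    intro t s d ht hΩ hS hs hsd
    obtain ⟨p, hpΩ, hpne, hpt, hpf⟩ := hacc t ht
    have hp0 : 0 < dist p x₀ := dist_pos.2 hpne
    obtain ⟨t1, ht1, ht1', hΩ1, d1, hd1, hS1⟩ := M.exists_sphere hconn hnc hx₀
      (show 0 < dist p x₀ / 2 by linarith)
    obtain ⟨t2, ht2, ht2', hΩ2, d2, hd2, hS2⟩ := M.exists_sphere hconn hnc hpΩ
      (show 0 < min (dist p x₀ / 2) (t - dist p x₀) by
        apply lt_min <;> linarith)
    have ht2a := ht2'.trans_le (min_le_left _ _)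
    have ht2b := ht2'.trans_le (min_le_right _ _)
    obtain ⟨σ, hσ0, hσ1⟩ := exists_between (show 0 < min s (min d1 d2) by positivity)
    have hσs := hσ1.trans_le (min_le_left _ _)
    have hσd1 := hσ1.trans_le ((min_le_right _ _).trans (min_le_left _ _))
    have hσd2 := hσ1.trans_le ((min_le_right _ _).trans (min_le_right _ _))
    have h1 := ih t1 σ d1 ht1 hΩ1 hS1 hσ0 hσd1
    have h2 := M.lower hconn hnc B ht2 hΩ2 hS2 hσ0 hσd2
    rw [hpf] at h2
    rw [M.INV B ht hΩ hS (z₀ := f x₀) (z₁ := f x₀) hs hσ0 (by rw [dist_self]; linarith)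
      (by rw [dist_self]; linarith)]
    have hdisj : Disjoint (ball x₀ t1) (ball p t2) := by
      apply ball_disjoint_ball
      rw [dist_comm]
      linarith
    have h3 : ∫ x in ball x₀ t1 ∪ ball p t2, isvb φ (f x₀) σ (f x) * (Df x).det ≤
        ∫ x in ball x₀ t, isvb φ (f x₀) σ (f x) * (Df x).det := by
      refine setIntegral_mono_set (M.int B ht hΩ _ _)
        (M.nn B (ball_subset_closedBall.trans hΩ) _ _) (LE.le.eventuallyLE ?_)
      refine union_subset (ball_subset_ball (by linarith)) (ball_subset_ball' (by linarith))
    rw [setIntegral_union hdisj measurableSet_ball (M.int B ht1 hΩ1 _ _)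
      (M.int B ht2 hΩ2 _ _)] at h3
    push_cast
    linarith

open Filter Metric in
theorem IsvMap.discrete {Ω : Set E2} {f Df K} (M : IsvMap Ω f Df K) (hconn : IsPreconnected Ω)
    (hnc : ¬ ∃ c, ∀ x ∈ Ω, f x = c) (y x₀ : E2) (hx₀ : x₀ ∈ Ω)
    (hacc : AccPt x₀ (𝓟 (Ω ∩ f ⁻¹' {y}))) : False := by
  rw [accPt_iff_nhds] at hacc
  have hca : ContinuousAt f x₀ := ContinuousOn.continuousAt M.hc (M.hΩ.mem_nhds hx₀)
  have hy : f x₀ = y := by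
    refine eq_of_forall_dist_le fun ε hε => ?_
    obtain ⟨p, ⟨hp1, hp2, hp3⟩, -⟩ := hacc _ (hca.preimage_mem_nhds (ball_mem_nhds (f x₀) hε))
    have : dist (f p) (f x₀) < ε := hp1
    rw [show f p = y from hp3, dist_comm] at this
    exact this.le
  have hacc2 : ∀ ε > 0, ∃ p ∈ Ω, p ≠ x₀ ∧ dist p x₀ < ε ∧ f p = f x₀ := by
    intro ε hε
    obtain ⟨p, ⟨hp1, hp2, hp3⟩, hp4⟩ := hacc _ (ball_mem_nhds x₀ hε)
    exact ⟨p, hp2, hp4, hp1, by rw [hy]; exact hp3⟩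
  obtain ⟨φ, B⟩ := isv_bump_exists
  obtain ⟨t, ht, -, hΩ, d, hd, hS⟩ := M.exists_sphere hconn hnc hx₀ one_pos
  have hκ : 0 < volume.real (ball (0 : E2) 1) :=
    ENNReal.toReal_pos (measure_ball_pos _ _ one_pos).ne' measure_ball_lt_top.ne
  obtain ⟨N, hN⟩ := exists_nat_gt ((4 * ∫ x in ball x₀ t,
    isvb φ (f x₀) (d / 2) (f x) * (Df x).det) / volume.real (ball (0 : E2) 1))
  rw [div_lt_iff₀ hκ] at hN
  have := M.count hconn hnc B hx₀ hacc2 N t (d / 2) d ht hΩ hS (by linarith) (by linarith)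
  linarith

/-- **Iwaniec–Šverák theorem.** If `f ∈ W^{1,2}_loc(Ω, ℝ²)` satisfies the distortion
inequality `‖Df‖² ≤ K · det Df` a.e. with `K ≥ 1` locally integrable, and `f` is not
a.e. constant, then (the continuous representative of) `f` is continuous, open and
discrete. -/
theorem iwaniec_sverak
    (Ω : Set E2) (hΩopen : IsOpen Ω) (hΩconn : IsConnected Ω)
    (f : E2 → E2) (Df : E2 → E2 →L[ℝ] E2)
    (hf : MemW12loc Ω f Df)
    (K : E2 → ℝ) (hKmeas : Measurable K) (hK1 : ∀ x, 1 ≤ K x)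
    (hKloc : ∀ A : Set E2, A ⊆ Ω → IsCompact A →
      ∫⁻ x in A, ENNReal.ofReal (K x) < ⊤)
    (hdist : ∀ᵐ x ∂(volume.restrict Ω), ‖Df x‖ ^ 2 ≤ K x * (Df x).det)
    (hnonconst : ¬ ∃ c : E2, ∀ᵐ x ∂(volume.restrict Ω), f x = c) :
    ∃ ftil : E2 → E2,
      ContinuousOn ftil Ω ∧
      (∀ᵐ x ∂(volume.restrict Ω), ftil x = f x) ∧
      (∀ U : Set E2, U ⊆ Ω → IsOpen U → IsOpen (ftil '' U)) ∧
      (∀ y : E2, ∀ x ∈ Ω, ¬ AccPt x (Filter.principal (Ω ∩ ftil ⁻¹' {y}))) := by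
  obtain ⟨ft, hc, hae, hft⟩ := isv_cont hΩopen hf (isv_FD_of hK1 hdist)
  have M : IsvMap Ω ft Df K := ⟨hΩopen, hft, hc, hKmeas, hK1, hKloc, hdist⟩
  have hnc : ¬ ∃ c, ∀ x ∈ Ω, ft x = c := by
    rintro ⟨c, h⟩
    refine hnonconst ⟨c, ?_⟩
    filter_upwards [hae, ae_restrict_mem hΩopen.measurableSet] with x h1 h2
    rw [← h1]
    exact h x h2
  exact ⟨ft, hc, hae, fun U hU hUo => M.isOpen_image hΩconn.isPreconnected hnc hU hUo,
    fun y x hx hacc => M.discrete hΩconn.isPreconnected hnc y x hx hacc⟩
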